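/- Assume [H1] and [H2], and let ψ : [0,T_max) → D^{σ,p}(𝕋ⁿ) be the maximal mild solution of the nonlocal Fokker–Planck equation. Then: (1) for every ε ∈ [0, 1−σ/2) and every τ ∈ [0,σ), ψ ∈ C^μ_loc([0,T_max), D^{τ,p}(𝕋ⁿ)) with μ := min(1 − σ/2 − ε, (σ−τ)/2); and (2) F(ψ(·)) ∈ C^{ν−ε}_loc([0,T_max), L^p_0(𝕋ⁿ)) for every ε ∈ (0,ν), where ν := min(1 − σ/2, σ/2 − 1/2 − n/(2p)). -/

import Mathlib

open MeasureTheory ENNReal Set Filter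

noncomputable section

/-- Ambient space `ℝ × ℝ^m`: the universal cover of the torus `𝕋^{m+1}` (so `n = m + 1`). -/
abbrev Spc (m : ℕ) : Type := ℝ × (Fin m → ℝ)

/-- Unit cube in the last `m` coordinates: a fundamental domain for `𝕋^m`. -/
def cube1 (m : ℕ) : Set (Fin m → ℝ) := Set.pi Set.univ fun _ => Set.Ico (0 : ℝ) 1

/-- A fundamental domain for the torus `𝕋^{m+1}`. -/
def cube (m : ℕ) : Set (Spc m) := Set.Ico (0 : ℝ) 1 ×ˢ cube1 m

/-- The measure of the torus: Lebesgue measure restricted to a fundamental domain. -/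
def μT (m : ℕ) : Measure (Spc m) := volume.restrict (cube m)

/-- `ℤ^{m+1}`-periodicity: `f` is a function on the torus `𝕋^{m+1}`. -/
def IsPeriodic {m : ℕ} (f : Spc m → ℝ) : Prop :=
  ∀ (x : Spc m) (k : ℤ) (j : Fin m → ℤ), f (x.1 + k, fun i => x.2 i + j i) = f x

/-- The first coordinate direction. -/
def e1 (m : ℕ) : Spc m := (1, 0)

/-- The remaining coordinate directions. -/
def eC (m : ℕ) (i : Fin m) : Spc m := (0, Pi.single i 1)

/-- Partial derivative in the direction `v`. -/
def pd {m : ℕ} (v : Spc m) (f : Spc m → ℝ) (x : Spc m) : ℝ := fderiv ℝ f x v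

/-- `∇f ⋅ ∇g`. -/
def gradDot {m : ℕ} (f g : Spc m → ℝ) (x : Spc m) : ℝ :=
  pd (e1 m) f x * pd (e1 m) g x + ∑ i, pd (eC m i) f x * pd (eC m i) g x

/-- The Laplacian. -/
def lap {m : ℕ} (f : Spc m → ℝ) (x : Spc m) : ℝ :=
  pd (e1 m) (pd (e1 m) f) x + ∑ i, pd (eC m i) (pd (eC m i) f) x

/-- The marginal `ψ̄(x₁) = ∫_{𝕋^m} ψ(x₁, ⋅)`. -/
def marg {m : ℕ} (ψ : Spc m → ℝ) (x1 : ℝ) : ℝ := ∫ y in cube1 m, ψ (x1, y)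

/-- The nonlocal coefficient `φ_ψ = (∫ ∂_{x₁}V ψ dx₂…dxₙ) / ψ̄`. -/
def phiF {m : ℕ} (V ψ : Spc m → ℝ) (x1 : ℝ) : ℝ :=
  (∫ y in cube1 m, pd (e1 m) V (x1, y) * ψ (x1, y)) / marg ψ x1

/-- `F(ψ) = ∇V⋅∇ψ + ΔV ψ − ∂_{x₁}(φ_ψ ψ)`. -/
def Fop {m : ℕ} (V ψ : Spc m → ℝ) (x : Spc m) : ℝ :=
  gradDot V ψ x + lap V x * ψ x - pd (e1 m) (fun z => phiF V ψ z.1 * ψ z) x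

/-- `L^p`-norm on the torus. -/
def LpN {m : ℕ} (p : ℝ) (f : Spc m → ℝ) : ℝ≥0∞ := eLpNorm f (ENNReal.ofReal p) (μT m)

/-- Gagliardo (Sobolev–Slobodeckij) seminorm of fractional order `s`. -/
def gagl {m : ℕ} {F : Type*} [NormedAddCommGroup F] (s p : ℝ) (f : Spc m → F) : ℝ≥0∞ :=
  (∫⁻ x in cube m, ∫⁻ y in cube m,
      ENNReal.ofReal (‖f x - f y‖ ^ p / ‖x - y‖ ^ ((m : ℝ) + 1 + s * p))) ^ (1 / p)

/-- The differential of `f`. -/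
def grd {m : ℕ} (f : Spc m → ℝ) (x : Spc m) : Spc m →L[ℝ] ℝ := fderiv ℝ f x

/-- The `W^{σ,p}`-norm on the torus, for `0 ≤ σ ≤ 2`. -/
def WNorm {m : ℕ} (σ p : ℝ) (f : Spc m → ℝ) : ℝ≥0∞ :=
  if σ ≤ 0 then LpN p f
  else if σ < 1 then LpN p f + gagl σ p f
  else if σ < 2 then
    LpN p f + eLpNorm (fun x => ‖grd f x‖) (ENNReal.ofReal p) (μT m)
      + (if σ = 1 then 0 else gagl (σ - 1) p (grd f))
  else
    LpN p f + eLpNorm (fun x => ‖grd f x‖) (ENNReal.ofReal p) (μT m)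
      + eLpNorm (fun x => ‖iteratedFDeriv ℝ 2 f x‖) (ENNReal.ofReal p) (μT m)

/-- Membership in `W^{σ,p}(𝕋^{m+1})`, for `0 ≤ σ ≤ 2`. -/
def MemW {m : ℕ} (σ p : ℝ) (f : Spc m → ℝ) : Prop :=
  IsPeriodic f ∧ Measurable f ∧ (1 ≤ σ → Differentiable ℝ f) ∧
    (2 ≤ σ → Differentiable ℝ (grd f)) ∧ WNorm σ p f < ⊤

/-- Membership in `𝒟^{σ,p}(𝕋^{m+1}) = {ψ ∈ W^{σ,p} | ψ̄ > 0}`. -/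
def MemD {m : ℕ} (σ p : ℝ) (f : Spc m → ℝ) : Prop :=
  MemW σ p f ∧ ∀ x1 : ℝ, 0 < marg f x1

/-- Hypothesis `[H₁]`: `ψ₀ ∈ 𝒟^{σ,p}`, `ψ₀ ≥ 0`, `∫ ψ₀ = 1`. -/
def Hyp1 {m : ℕ} (σ p : ℝ) (ψ0 : Spc m → ℝ) : Prop :=
  MemD σ p ψ0 ∧ (∀ x, 0 ≤ ψ0 x) ∧ (∫ x in cube m, ψ0 x) = 1

/-- Hypothesis `[H₂]`: `n = m + 1 ≥ 2`, `p > n`, `σ ∈ (1 + n/p, 2)`. -/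
def Hyp2 (m : ℕ) (σ p : ℝ) : Prop :=
  1 ≤ m ∧ (m : ℝ) + 1 < p ∧ 1 + ((m : ℝ) + 1) / p < σ ∧ σ < 2

/-- The real interval `[0, Tmax)`, where `Tmax ∈ (0, ∞]`. -/
def Ico0 (Tmax : ℝ≥0∞) : Set ℝ := {t : ℝ | 0 ≤ t ∧ ENNReal.ofReal t < Tmax}

/-- The real interval `(0, Tmax)`, where `Tmax ∈ (0, ∞]`. -/
def Ioo0 (Tmax : ℝ≥0∞) : Set ℝ := {t : ℝ | 0 < t ∧ ENNReal.ofReal t < Tmax}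

/-- Continuity in `W^{σ,p}`-norm of a curve, on a time set `s`. -/
def ContW {m : ℕ} (σ p : ℝ) (s : Set ℝ) (ψ : ℝ → Spc m → ℝ) : Prop :=
  ∀ t ∈ s, ∀ ε : ℝ, 0 < ε → ∃ δ > 0, ∀ t' ∈ s, |t' - t| < δ →
    WNorm σ p (fun x => ψ t' x - ψ t x) < ENNReal.ofReal ε

/-- Hölder continuity (exponent `α`) in `W^{σ,p}`-norm of a curve, on a time set `s`. -/
def HolderW {m : ℕ} (α σ p : ℝ) (s : Set ℝ) (ψ : ℝ → Spc m → ℝ) : Prop :=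
  ∃ C : ℝ, ∀ t ∈ s, ∀ t' ∈ s,
    WNorm σ p (fun x => ψ t' x - ψ t x) ≤ ENNReal.ofReal (C * |t' - t| ^ α)

/-- `ψ` is an `L^p`-solution on `[0, Tmax)` of the nonlocal Fokker–Planck equation
`∂ₜψ = div(∇V ψ + β⁻¹∇ψ) − ∂_{x₁}(φ_ψ ψ) = β⁻¹Δψ + F(ψ)`, `ψ(0) = ψ₀`. -/
structure IsLpSolution {m : ℕ} (V : Spc m → ℝ) (β σ p : ℝ) (ψ0 : Spc m → ℝ)
    (Tmax : ℝ≥0∞) (ψ : ℝ → Spc m → ℝ) : Prop where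
  init : ∀ x, ψ 0 x = ψ0 x
  contLp : ContW 0 p (Ico0 Tmax) ψ
  regW2 : ∀ t ∈ Ioo0 Tmax, MemW 2 p (ψ t)
  regD : ∀ t ∈ Ioo0 Tmax, MemD σ p (ψ t)
  eqn : ∀ t ∈ Ioo0 Tmax,
    Tendsto (fun h : ℝ => LpN p
        (fun x => (ψ (t + h) x - ψ t x) / h - (β⁻¹ * lap (ψ t) x + Fop V (ψ t) x)))
      (nhdsWithin 0 {h : ℝ | h ≠ 0}) (nhds 0)
  derivCont : ContW 0 p (Ioo0 Tmax)
    (fun t x => β⁻¹ * lap (ψ t) x + Fop V (ψ t) x)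

/-- A maximal `L^p`-solution: an `L^p`-solution admitting no proper extension. -/
def IsMaximalLpSolution {m : ℕ} (V : Spc m → ℝ) (β σ p : ℝ) (ψ0 : Spc m → ℝ)
    (Tmax : ℝ≥0∞) (ψ : ℝ → Spc m → ℝ) : Prop :=
  IsLpSolution V β σ p ψ0 Tmax ψ ∧ 0 < Tmax ∧
    ∀ (Tmax' : ℝ≥0∞) (ψ' : ℝ → Spc m → ℝ), IsLpSolution V β σ p ψ0 Tmax' ψ' →
      (∀ t ∈ Ico0 Tmax, ψ' t = ψ t) → Tmax' ≤ Tmax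

/-- The Euclidean quadratic form on `Spc m`. -/
def qd {m : ℕ} (z : Spc m) : ℝ := z.1 ^ 2 + ∑ i, z.2 i ^ 2

/-- The heat semigroup `e^{β⁻¹ t Δ}` on the torus, realized by convolution with the Gaussian
heat kernel on the universal cover (and the identity for `t ≤ 0`). -/
def heatSG {m : ℕ} (β t : ℝ) (f : Spc m → ℝ) (x : Spc m) : ℝ :=
  if t ≤ 0 then f x
  else ∫ y : Spc m, (4 * Real.pi * (t / β)) ^ (-((m : ℝ) + 1) / 2) *
      Real.exp (-qd (x - y) / (4 * (t / β))) * f y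

/-- `ψ` is a mild solution of the nonlocal Fokker–Planck equation on `[0, Tmax)`:
`ψ ∈ C([0,Tmax), 𝒟^{σ,p})` and `ψ(t) = e^{β⁻¹tΔ}ψ₀ + ∫₀ᵗ e^{β⁻¹(t−s)Δ} F(ψ(s)) ds`. -/
def IsMildSolution {m : ℕ} (V : Spc m → ℝ) (β σ p : ℝ) (ψ0 : Spc m → ℝ)
    (Tmax : ℝ≥0∞) (ψ : ℝ → Spc m → ℝ) : Prop :=
  (∀ x, ψ 0 x = ψ0 x) ∧ (∀ t ∈ Ico0 Tmax, MemD σ p (ψ t)) ∧ ContW σ p (Ico0 Tmax) ψ ∧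
    ∀ t ∈ Ico0 Tmax, ∀ᵐ x ∂(volume : Measure (Spc m)),
      ψ t x = heatSG β t ψ0 x + ∫ s in Set.Ioc (0 : ℝ) t, heatSG β (t - s) (Fop V (ψ s)) x

/-- A maximal mild solution. -/
def IsMaximalMildSolution {m : ℕ} (V : Spc m → ℝ) (β σ p : ℝ) (ψ0 : Spc m → ℝ)
    (Tmax : ℝ≥0∞) (ψ : ℝ → Spc m → ℝ) : Prop :=
  IsMildSolution V β σ p ψ0 Tmax ψ ∧ 0 < Tmax ∧
    ∀ (Tmax' : ℝ≥0∞) (ψ' : ℝ → Spc m → ℝ), IsMildSolution V β σ p ψ0 Tmax' ψ' →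
      (∀ t ∈ Ico0 Tmax, ψ' t = ψ t) → Tmax' ≤ Tmax

/-- `L^p`-norm on the one-dimensional torus `𝕋`. -/
def LpN1 (p : ℝ) (g : ℝ → ℝ) : ℝ≥0∞ :=
  eLpNorm g (ENNReal.ofReal p) (volume.restrict (Set.Ico (0 : ℝ) 1))

/-- Membership in `L^p₀(𝕋^{m+1})`: periodic, `L^p` and of mean zero. -/
def MemL0 {m : ℕ} (p : ℝ) (f : Spc m → ℝ) : Prop :=
  IsPeriodic f ∧ Measurable f ∧ LpN p f < ⊤ ∧ (∫ x in cube m, f x) = 0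



instance instHaarSpc (m : ℕ) : (volume : Measure (Spc m)).IsAddHaarMeasure :=
  inferInstanceAs ((volume : Measure ℝ).prod (volume : Measure (Fin m → ℝ))).IsAddHaarMeasure

/-- Periodicity with values in any type. -/
def PerE {m : ℕ} {E : Type*} (f : Spc m → E) : Prop :=
  ∀ (x : Spc m) (k : ℤ) (j : Fin m → ℤ), f (x.1 + k, fun i => x.2 i + j i) = f x

/-- Coordinatewise fractional part. -/
def frc {m : ℕ} (x : Spc m) : Spc m := (Int.fract x.1, fun i => Int.fract (x.2 i))

lemma frc_mem {m : ℕ} (x : Spc m) : frc x ∈ cube m := by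
  refine ⟨⟨Int.fract_nonneg _, Int.fract_lt_one _⟩, fun i _ => ⟨Int.fract_nonneg _, Int.fract_lt_one _⟩⟩

lemma PerE.frc {m : ℕ} {E : Type*} {f : Spc m → E} (hf : PerE f) (x : Spc m) : f (frc x) = f x := by
  have h := hf (_root_.frc x) ⌊x.1⌋ (fun i => ⌊x.2 i⌋)
  rw [← h]
  congr 1
  ext <;> simp [_root_.frc]

lemma PerE.comp_add {m : ℕ} {E : Type*} {f : Spc m → E} (hf : PerE f) (h : Spc m) :
    PerE (fun x => f (x + h)) := by
  intro x k j
  have := hf (x + h) k j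
  simp only at this ⊢
  rw [← this]
  congr 1
  ext <;> simp <;> ring

lemma meas_cube1 (m : ℕ) : MeasurableSet (cube1 m) :=
  MeasurableSet.univ_pi fun _ => measurableSet_Ico

lemma meas_cube (m : ℕ) : MeasurableSet (cube m) :=
  measurableSet_Ico.prod (meas_cube1 m)

lemma vol_cube1 (m : ℕ) : volume (cube1 m) = 1 := by
  unfold cube1
  rw [volume_pi_pi]; simp

lemma vol_cube (m : ℕ) : volume (cube m) = 1 := by
  unfold cube
  rw [Measure.volume_eq_prod, Measure.prod_prod, vol_cube1]; simp

instance (m : ℕ) : IsProbabilityMeasure (μT m) := ⟨by simp [μT, vol_cube]⟩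
instance (m : ℕ) : IsProbabilityMeasure ((volume : Measure (Fin m → ℝ)).restrict (cube1 m)) :=
  ⟨by simp [vol_cube1]⟩

/-- The standard basis. -/
def bss (m : ℕ) : Module.Basis (Unit ⊕ Fin m) ℝ (Spc m) :=
  (Module.Basis.singleton Unit ℝ).prod (Pi.basisFun ℝ (Fin m))

lemma bss_fd (m : ℕ) : ZSpan.fundamentalDomain (bss m) = cube m := by
  ext x
  simp [ZSpan.mem_fundamentalDomain, bss, cube, cube1]

lemma fd_cube (m : ℕ) : IsAddFundamentalDomain (Submodule.span ℤ (Set.range (bss m))) (cube m)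
    (volume : Measure (Spc m)) := by
  rw [← bss_fd]; exact ZSpan.isAddFundamentalDomain _ _

lemma PerE.lattice {m : ℕ} {E : Type*} {f : Spc m → E} (hf : PerE f)
    (g : Submodule.span ℤ (Set.range (bss m))) (x : Spc m) : f (g +ᵥ x) = f x := by
  have hg := (Module.Basis.mem_span_iff_repr_mem ℤ (bss m) g.1).1 g.2
  have h1 := hg (Sum.inl ())
  choose j hj using fun i => hg (Sum.inr i)
  obtain ⟨k, hk⟩ := h1
  simp [bss] at hk hj
  rw [← hf x k j]
  congr 1
  have : g +ᵥ x = (g : Spc m) + x := rfl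
  rw [this]
  ext
  · simp [hk, add_comm]
  · simp [hj, add_comm]

instance instVInv (m : ℕ) : VAddInvariantMeasure (Submodule.span ℤ (Set.range (bss m))) (Spc m)
    volume := ⟨fun c s _ => measure_preimage_add volume (c : Spc m) s⟩

open Pointwise in
lemma lint_per {m : ℕ} {f : Spc m → ℝ≥0∞} (hf : PerE f) (h : Spc m) :
    ∫⁻ x in cube m, f (x + h) = ∫⁻ x in cube m, f x := by
  have hd := (fd_cube m)
  have hd2 := hd.vadd_of_comm h
  have := hd.setLIntegral_eq hd2 f hf.lattice
  rw [this]
  have h3 : (h +ᵥ cube m) = (fun x => h + x) '' cube m := rfl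
  rw [h3]
  have := (measurePreserving_add_left (volume : Measure (Spc m)) h).setLIntegral_comp_emb
    (measurableEmbedding_addLeft h) f (cube m)
  rw [← this]
  simp [add_comm]

open Pointwise in
lemma int_per {m : ℕ} {f : Spc m → ℝ} (hf : PerE f) (h : Spc m) :
    ∫ x in cube m, f (x + h) = ∫ x in cube m, f x := by
  have hd := (fd_cube m)
  have hd2 := hd.vadd_of_comm h
  have := hd.setIntegral_eq hd2 hf.lattice
  rw [this]
  have h3 : (h +ᵥ cube m) = (fun x => h + x) '' cube m := rfl
  rw [h3]
  have := (measurePreserving_add_left (volume : Measure (Spc m)) h).setIntegral_image_emb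
    (measurableEmbedding_addLeft h) f (cube m)
  rw [this]
  simp [add_comm]

/-- Closed unit cube. -/
def cubeC (m : ℕ) : Set (Spc m) := Icc 0 1

lemma mem_cubeC {m : ℕ} {x : Spc m} : x ∈ cubeC m ↔ (0 ≤ x.1 ∧ x.1 ≤ 1) ∧ ∀ i, 0 ≤ x.2 i ∧ x.2 i ≤ 1 := by
  simp only [cubeC, mem_Icc, Prod.le_def, Pi.le_def, Prod.fst_zero, Prod.snd_zero, Pi.zero_apply,
    Prod.fst_one, Prod.snd_one, Pi.one_apply]
  exact ⟨fun h => ⟨⟨h.1.1, h.2.1⟩, fun i => ⟨h.1.2 i, h.2.2 i⟩⟩,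
    fun h => ⟨⟨h.1.1, fun i => (h.2 i).1⟩, ⟨h.1.2, fun i => (h.2 i).2⟩⟩⟩

lemma cube_sub_cubeC (m : ℕ) : cube m ⊆ cubeC m := by
  intro x hx
  rw [mem_cubeC]
  exact ⟨⟨hx.1.1, hx.1.2.le⟩, fun i => ⟨(hx.2 i trivial).1, (hx.2 i trivial).2.le⟩⟩

lemma cube1_ae (m : ℕ) : cube1 m =ᵐ[volume] (Icc 0 1 : Set (Fin m → ℝ)) := by
  have := Measure.univ_pi_Ico_ae_eq_Icc (μ := fun _ : Fin m => (volume : Measure ℝ)) (f := 0) (g := 1)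
  simpa [cube1, volume_pi] using this

lemma cubeC_eq (m : ℕ) : cubeC m = Metric.closedBall ((1/2 : ℝ), fun _ => (1/2:ℝ)) (1/2) := by
  ext x
  rw [mem_cubeC, Metric.mem_closedBall, Prod.dist_eq, max_le_iff, dist_pi_le_iff (by norm_num), Real.dist_eq,
    abs_le]
  simp only [Real.dist_eq, abs_le]
  constructor
  · rintro ⟨h1, h2⟩
    exact ⟨⟨by linarith, by linarith⟩, fun i => ⟨by linarith [h2 i], by linarith [h2 i]⟩⟩
  · rintro ⟨h1, h2⟩
    exact ⟨⟨by linarith, by linarith⟩, fun i => ⟨by linarith [h2 i], by linarith [h2 i]⟩⟩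

lemma cube_ae (m : ℕ) : cube m =ᵐ[volume] cubeC m := by
  have h : volume (cubeC m) = 1 := by
    rw [cubeC]
    have : (Icc (0 : Spc m) 1) = Icc (0:ℝ) 1 ×ˢ Icc (0 : Fin m → ℝ) 1 := by
      rw [Set.Icc_prod_Icc]; rfl
    rw [this, Measure.volume_eq_prod, Measure.prod_prod, ← measure_congr (cube1_ae m), vol_cube1]
    simp
  refine ae_eq_of_subset_of_measure_ge (cube_sub_cubeC m) ?_ (meas_cube m).nullMeasurableSet ?_
  · rw [h, vol_cube]
  · rw [h]; simp

lemma vol_cb {m : ℕ} (c : Spc m) {r : ℝ} (hr : 0 ≤ r) :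
    volume (Metric.closedBall c r) = ENNReal.ofReal ((2 * r) ^ ((m : ℝ) + 1)) := by
  obtain ⟨a, b⟩ := c
  rw [← closedBall_prod_same, Measure.volume_eq_prod, Measure.prod_prod, Real.volume_closedBall,
    Real.volume_pi_closedBall _ hr, ← ENNReal.ofReal_mul (by positivity)]
  congr 1
  rw [Fintype.card_fin]
  have : ((m : ℝ) + 1) = ((m + 1 : ℕ) : ℝ) := by push_cast; rfl
  rw [this, Real.rpow_natCast]; ring

lemma finrank_spc (m : ℕ) : Module.finrank ℝ (Spc m) = m + 1 := by
  simp [add_comm]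



/-- Jensen for powers. -/
lemma jensen_pow {α : Type*} [MeasurableSpace α] (ν : Measure α) {p : ℝ} (hp : 1 < p)
    {f : α → ℝ≥0∞} (hf : AEMeasurable f ν) :
    (∫⁻ x, f x ∂ν) ^ p ≤ (ν univ) ^ (p - 1) * ∫⁻ x, f x ^ p ∂ν := by
  have hpq := Real.HolderConjugate.conjExponent hp
  have h := ENNReal.lintegral_mul_le_Lp_mul_Lq ν hpq hf (g := fun _ => 1) aemeasurable_const
  simp only [Pi.mul_apply, mul_one, ENNReal.one_rpow, lintegral_const, one_mul] at h
  calc _ ≤ ((∫⁻ x, f x ^ p ∂ν) ^ (1 / p) * (ν univ) ^ (1 / p.conjExponent)) ^ p := by gcongr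
    _ = _ := by
      rw [ENNReal.mul_rpow_of_nonneg _ _ (by linarith), ← ENNReal.rpow_mul, ← ENNReal.rpow_mul]
      have h1 : 1 / p * p = 1 := by field_simp
      have h2 : 1 / p.conjExponent * p = p - 1 := by
        have := hpq.sub_one_pos.ne'
        rw [Real.conjExponent]; field_simp
      rw [h1, h2, ENNReal.rpow_one, mul_comm]

/-- Gagliardo kernel. -/
def kg {m : ℕ} {E : Type*} [NormedAddCommGroup E] (s p : ℝ) (g : Spc m → E) (u v : Spc m) : ℝ≥0∞ :=
  ENNReal.ofReal (‖g u - g v‖ ^ p / ‖u - v‖ ^ ((m : ℝ) + 1 + s * p))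

section
variable {m : ℕ} {E : Type*} [NormedAddCommGroup E]

lemma pow_le_kg {s p r : ℝ} (hp : 1 < p) (hs : 0 < s) (g : Spc m → E) {u v : Spc m}
    (huv : ‖u - v‖ ≤ 2 * r) :
    ‖g u - g v‖ₑ ^ p ≤ ENNReal.ofReal ((2 * r) ^ ((m : ℝ) + 1 + s * p)) * kg s p g u v := by
  rcases eq_or_ne u v with rfl | hne
  · simp [ENNReal.zero_rpow_of_pos (by linarith : 0 < p)]
  have h0 : 0 < ‖u - v‖ := norm_pos_iff.2 (sub_ne_zero.2 hne)
  have h2r : 0 < 2 * r := h0.trans_le huv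
  rw [← ofReal_norm, ENNReal.ofReal_rpow_of_nonneg (norm_nonneg _) (by linarith), kg,
    ← ENNReal.ofReal_mul (by positivity)]
  apply ENNReal.ofReal_le_ofReal
  have h1 : ‖u - v‖ ^ ((m : ℝ) + 1 + s * p) ≤ (2 * r) ^ ((m : ℝ) + 1 + s * p) := by
    gcongr
  have h2 : 0 < ‖u - v‖ ^ ((m : ℝ) + 1 + s * p) := by positivity
  rw [← mul_div_assoc, le_div_iff₀ h2, mul_comm]
  gcongr

lemma meas_pair {g : Spc m → E} (hg : StronglyMeasurable g) :
    Measurable (fun z : Spc m × Spc m => ‖g z.1 - g z.2‖ₑ) := by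
  have := (hg.comp_measurable (measurable_fst (α := Spc m) (β := Spc m))).sub
    (hg.comp_measurable (measurable_snd (α := Spc m) (β := Spc m)))
  exact this.enorm

lemma meas_kg {g : Spc m → E} (hg : StronglyMeasurable g) (s p : ℝ) :
    Measurable (fun z : Spc m × Spc m => kg s p g z.1 z.2) := by
  have := (hg.comp_measurable (measurable_fst (α := Spc m) (β := Spc m))).sub
    (hg.comp_measurable (measurable_snd (α := Spc m) (β := Spc m)))
  have h1 := this.norm.measurable
  unfold kg
  apply ENNReal.measurable_ofReal.comp
  apply Measurable.div
  · exact h1.pow_const p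
  · exact (by fun_prop : Measurable fun z : Spc m × Spc m => ‖z.1 - z.2‖).pow_const _

/-- double oscillation over a ball -/
lemma dbl_le {s p r : ℝ} (hp : 1 < p) (hs : 0 < s) (hr : 0 < r) {g : Spc m → E}
    (hg : StronglyMeasurable g) (c : Spc m) :
    ∫⁻ u in Metric.closedBall c r, ∫⁻ v in Metric.closedBall c r, ‖g u - g v‖ₑ ≤
      volume (Metric.closedBall c r) * volume (Metric.closedBall c r) *
      (ENNReal.ofReal ((2 * r) ^ (s - ((m : ℝ) + 1) / p)) *
       (∫⁻ u in Metric.closedBall c r, ∫⁻ v in Metric.closedBall c r, kg s p g u v) ^ (1 / p)) := by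
  have hp0 : 0 < p := by linarith
  set B := Metric.closedBall c r with hB
  set I := ∫⁻ u in B, ∫⁻ v in B, kg s p g u v with hI
  have hV : volume B = ENNReal.ofReal ((2 * r) ^ ((m : ℝ) + 1)) := vol_cb c hr.le
  have hmp := meas_pair hg
  have h1 : (∫⁻ u in B, ∫⁻ v in B, ‖g u - g v‖ₑ) ^ p ≤
      (volume B) ^ (p - 1) * ((volume B) ^ (p - 1) * (ENNReal.ofReal ((2 * r) ^ ((m : ℝ) + 1 + s * p)) * I)) := by
    refine (jensen_pow _ hp ?_).trans ?_
    · exact (Measurable.lintegral_prod_right' hmp).aemeasurable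
    rw [Measure.restrict_apply_univ]
    gcongr
    rw [hI, ← lintegral_const_mul' _ _ ENNReal.ofReal_ne_top, ← lintegral_const_mul']
    · refine setLIntegral_mono' Metric.isClosed_closedBall.measurableSet fun u hu => ?_
      refine (jensen_pow _ hp ?_).trans ?_
      · exact (hmp.comp measurable_prodMk_left).aemeasurable
      rw [Measure.restrict_apply_univ]
      gcongr
      rw [← lintegral_const_mul' _ _ ENNReal.ofReal_ne_top]
      refine setLIntegral_mono' Metric.isClosed_closedBall.measurableSet fun v hv => ?_
      apply pow_le_kg hp hs
      rw [← dist_eq_norm]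
      rw [hB, Metric.mem_closedBall] at hu hv
      linarith [dist_triangle_right u v c]
    · rw [hV]; exact ENNReal.rpow_ne_top_of_nonneg (by linarith) ENNReal.ofReal_ne_top
  have h2 : (volume B) ^ (p - 1) * ((volume B) ^ (p - 1) * (ENNReal.ofReal ((2 * r) ^ ((m : ℝ) + 1 + s * p)) * I))
     = (volume B * volume B * (ENNReal.ofReal ((2 * r) ^ (s - ((m : ℝ) + 1) / p)) * I ^ (1 / p))) ^ p := by
    rw [ENNReal.mul_rpow_of_nonneg _ _ hp0.le, ENNReal.mul_rpow_of_nonneg _ _ hp0.le,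
      ENNReal.mul_rpow_of_nonneg _ _ hp0.le, ← ENNReal.rpow_mul,
      show 1 / p * p = 1 by field_simp, ENNReal.rpow_one, ← mul_assoc, ← mul_assoc, ← mul_assoc]
    congr 1
    have h2r : (0:ℝ) < 2 * r := by linarith
    rw [hV]
    rw [ENNReal.ofReal_rpow_of_nonneg (by positivity) (by linarith), ENNReal.ofReal_rpow_of_nonneg (by positivity) (by linarith),
      ENNReal.ofReal_rpow_of_nonneg (by positivity) (by linarith), ← ENNReal.ofReal_mul (by positivity),
      ← ENNReal.ofReal_mul (by positivity), ← ENNReal.ofReal_mul (by positivity), ← ENNReal.ofReal_mul (by positivity)]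
    congr 1
    rw [← Real.rpow_mul h2r.le, ← Real.rpow_mul h2r.le, ← Real.rpow_mul h2r.le, ← Real.rpow_add h2r, ← Real.rpow_add h2r,
      ← Real.rpow_add h2r, ← Real.rpow_add h2r]
    congr 1
    field_simp
    ring
  rw [h2] at h1
  exact (ENNReal.rpow_le_rpow_iff hp0).1 h1

variable [NormedSpace ℝ E] [CompleteSpace E]

lemma avg_sub_le {S : Set (Spc m)} {g : Spc m → E} (hg : IntegrableOn g S) (h0 : volume S ≠ 0)
    (ht : volume S ≠ ⊤) (c : E) :
    ‖(⨍ x in S, g x) - c‖ₑ ≤ (volume S)⁻¹ * ∫⁻ x in S, ‖g x - c‖ₑ := by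
  have : Fact (volume S < ⊤) := ⟨ht.lt_top⟩
  have h1 : (⨍ x in S, g x) - c = ⨍ x in S, (g x - c) := by
    rw [setAverage_eq, setAverage_eq, integral_sub hg (by simp), smul_sub]
    congr 1
    rw [setIntegral_const, smul_smul, Measure.real, inv_mul_cancel₀, one_smul]
    exact (ENNReal.toReal_pos h0 ht).ne'
  rw [h1]
  refine (enorm_integral_le_lintegral_enorm _).trans ?_
  rw [lintegral_smul_measure, Measure.restrict_apply_univ, smul_eq_mul]

lemma avg_avg_le {S S' : Set (Spc m)} (hss : S' ⊆ S) {g : Spc m → E} (hg : IntegrableOn g S)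
    (h0' : volume S' ≠ 0) (ht : volume S ≠ ⊤) :
    ‖(⨍ x in S', g x) - ⨍ x in S, g x‖ₑ ≤ (volume S')⁻¹ * ((volume S)⁻¹ *
      ∫⁻ u in S, ∫⁻ v in S, ‖g u - g v‖ₑ) := by
  have h0 : volume S ≠ 0 := fun h => h0' (measure_mono_null hss h)
  refine (avg_sub_le (hg.mono_set hss) h0' (measure_ne_top_of_subset hss ht) _).trans ?_
  gcongr
  rw [← lintegral_const_mul' _ _ (ENNReal.inv_ne_top.2 h0)]
  refine (lintegral_mono' (Measure.restrict_mono hss le_rfl) fun u => ?_ : _ ≤ _)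
  rw [enorm_sub_rev]
  refine (avg_sub_le hg h0 ht _).trans ?_
  gcongr with v
  rw [enorm_sub_rev]
end


/-- Campanato constant. -/
def CC (m : ℕ) (γ : ℝ) : ℝ := 2 ^ ((m : ℝ) + 1) / (1 - (1 / 2) ^ γ)

lemma half_lt {γ : ℝ} (h : 0 < γ) : ((1:ℝ) / 2) ^ γ < 1 :=
  Real.rpow_lt_one (by norm_num) (by norm_num) h

lemma CC_pos {m : ℕ} {γ : ℝ} (h : 0 < γ) : 0 < CC m γ := by
  have := half_lt h
  unfold CC
  apply div_pos (by positivity) (by linarith)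

section
variable {m : ℕ} {E : Type*} [NormedAddCommGroup E] [NormedSpace ℝ E] [CompleteSpace E]

lemma campanato {s p R : ℝ} (hp : 1 < p) (hs : 0 < s) (hγ : 0 < s - ((m : ℝ) + 1) / p) {g : Spc m → E}
    (hg : StronglyMeasurable g) (c : Spc m) (hR : 0 < R)
    (hgi : IntegrableOn g (Metric.closedBall c R))
    (hI : ∫⁻ u in Metric.closedBall c R, ∫⁻ v in Metric.closedBall c R, kg s p g u v ≠ ⊤) :
    ∀ᵐ x ∂(volume : Measure (Spc m)), x ∈ Metric.closedBall c R →
      ‖g x - ⨍ y in Metric.closedBall c R, g y‖ ≤ CC m (s - ((m : ℝ) + 1) / p) *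
       ((2 * R) ^ (s - ((m : ℝ) + 1) / p) *
        ((∫⁻ u in Metric.closedBall c R, ∫⁻ v in Metric.closedBall c R, kg s p g u v) ^ (1 / p)).toReal) := by
  set γ := s - ((m : ℝ) + 1) / p with hγd
  set Q := Metric.closedBall c R with hQ
  set I := ∫⁻ u in Q, ∫⁻ v in Q, kg s p g u v with hId
  set J := (I ^ (1 / p)).toReal with hJ
  have hQm : MeasurableSet Q := Metric.isClosed_closedBall.measurableSet
  have hli : LocallyIntegrable (Q.indicator g) volume :=
    (hgi.integrable_indicator hQm).locallyIntegrable
  have hIt : I ^ (1 / p) ≠ ⊤ := ENNReal.rpow_ne_top_of_nonneg (by positivity) hI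
  filter_upwards [IsUnifLocDoublingMeasure.ae_tendsto_average (μ := (volume : Measure (Spc m))) hli 1] with x hx hxQ
  set w : ℕ → Spc m := fun k => x + ((1:ℝ)/2) ^ k • (c - x) with hw
  set r : ℕ → ℝ := fun k => ((1:ℝ)/2) ^ k * R with hr
  have hrpos : ∀ k, 0 < r k := fun k => by positivity
  have hdc : ‖c - x‖ ≤ R := by rw [← dist_eq_norm, dist_comm]; exact hxQ
  have hxB : ∀ k, x ∈ Metric.closedBall (w k) (1 * r k) := by
    intro k
    rw [Metric.mem_closedBall, dist_eq_norm, hw]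
    simp only [sub_add_cancel_left, norm_neg, norm_smul]
    rw [one_mul, Real.norm_of_nonneg (by positivity)]
    simp only [hr]; gcongr
  have hsub : ∀ k, Metric.closedBall (w (k+1)) (r (k+1)) ⊆ Metric.closedBall (w k) (r k) := by
    intro k
    apply Metric.closedBall_subset_closedBall'
    have : w (k+1) - w k = -(((1:ℝ)/2) ^ (k+1) • (c - x)) := by
      simp only [hw, pow_succ]; module
    rw [dist_eq_norm, this, norm_neg, norm_smul, Real.norm_of_nonneg (by positivity)]
    have h1 : ((1:ℝ)/2)^(k+1) * ‖c - x‖ ≤ ((1:ℝ)/2)^(k+1) * R := by gcongr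
    have h2 : r k = ((1:ℝ)/2)^(k+1) * R + ((1:ℝ)/2)^(k+1) * R := by simp only [hr, pow_succ]; ring
    rw [h2]; simp only [hr]; linarith
  have hsubQ : ∀ k, Metric.closedBall (w k) (r k) ⊆ Q := by
    intro k
    induction k with
    | zero => simp [hw, hr, hQ]
    | succ k ih => exact (hsub k).trans ih
  have hlim := hx (l := atTop) w r (by
    rw [tendsto_nhdsWithin_iff]
    refine ⟨?_, Eventually.of_forall hrpos⟩
    have := (tendsto_pow_atTop_nhds_zero_of_lt_one (by norm_num : (0:ℝ) ≤ 1/2) (by norm_num)).mul_const R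
    simpa [hr] using this) (Eventually.of_forall hxB)
  have hav : ∀ k, ⨍ y in Metric.closedBall (w k) (r k), Q.indicator g y = ⨍ y in Metric.closedBall (w k) (r k), g y := by
    intro k
    rw [setAverage_eq, setAverage_eq]
    congr 1
    apply setIntegral_congr_fun Metric.isClosed_closedBall.measurableSet
    intro y hy
    exact indicator_of_mem (hsubQ k hy) g
  simp only [hav, indicator_of_mem hxQ] at hlim
  set A : ℕ → E := fun k => ⨍ y in Metric.closedBall (w k) (r k), g y with hA
  have hA0 : A 0 = ⨍ y in Q, g y := by simp [hA, hw, hr, hQ]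
  have hstep : ∀ k, dist (A k) (A (k+1)) ≤ (2 ^ ((m:ℝ)+1) * ((2 * R) ^ γ * J)) * (((1:ℝ)/2) ^ γ) ^ k := by
    intro k
    have hv : ∀ j, volume (Metric.closedBall (w j) (r j)) = ENNReal.ofReal ((2 * r j) ^ ((m : ℝ) + 1)) :=
      fun j => vol_cb _ (hrpos j).le
    have h0 : ∀ j, volume (Metric.closedBall (w j) (r j)) ≠ 0 := by
      intro j; rw [hv]; simp only [ne_eq, ENNReal.ofReal_eq_zero, not_le]
      have := hrpos j; positivity
    have ht : ∀ j, volume (Metric.closedBall (w j) (r j)) ≠ ⊤ := by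
      intro j; rw [hv]; exact ENNReal.ofReal_ne_top
    have h1 := avg_avg_le (hsub k) (hgi.mono_set (hsubQ k)) (h0 (k+1)) (ht k)
    have h2 := dbl_le hp hs (hrpos k) hg (w k)
    have h3 : (∫⁻ u in Metric.closedBall (w k) (r k), ∫⁻ v in Metric.closedBall (w k) (r k), kg s p g u v) ≤ I :=
      lintegral_mono' (Measure.restrict_mono (hsubQ k) le_rfl) fun u =>
        lintegral_mono_set (hsubQ k)
    have h4 : ‖A (k+1) - A k‖ₑ ≤ ENNReal.ofReal ((2 ^ ((m:ℝ)+1) * ((2 * R) ^ γ * J)) * (((1:ℝ)/2) ^ γ) ^ k) := by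
      calc ‖A (k+1) - A k‖ₑ ≤ _ := h1
        _ ≤ (volume (Metric.closedBall (w (k+1)) (r (k+1))))⁻¹ * ((volume (Metric.closedBall (w k) (r k)))⁻¹ *
          (volume (Metric.closedBall (w k) (r k)) * volume (Metric.closedBall (w k) (r k)) *
          (ENNReal.ofReal ((2 * r k) ^ γ) * I ^ (1/p)))) := by
            gcongr
            refine h2.trans ?_
            gcongr
        _ = (volume (Metric.closedBall (w (k+1)) (r (k+1))))⁻¹ * (volume (Metric.closedBall (w k) (r k))) *
          (ENNReal.ofReal ((2 * r k) ^ γ) * I ^ (1/p)) := by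
            rw [mul_assoc (volume (Metric.closedBall (w k) (r k))), ← mul_assoc _⁻¹ (volume (Metric.closedBall (w k) (r k))),
              ENNReal.inv_mul_cancel (h0 k) (ht k), one_mul, mul_assoc]
        _ = _ := by
            rw [hv, hv, ← ENNReal.ofReal_toReal hIt, ← hJ, ← ENNReal.ofReal_inv_of_pos (by have := hrpos (k+1); positivity),
              ← ENNReal.ofReal_mul (by have := hrpos (k+1); positivity), ← ENNReal.ofReal_mul (by have := hrpos (k); positivity),
              ← ENNReal.ofReal_mul (by have := hrpos (k+1); have := hrpos k; positivity)]
            congr 1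
            have e1 : 2 * r k = 2 * (2 * r (k+1)) := by simp only [hr, pow_succ]; ring
            have e2 : (2 * r k) ^ γ = (2 * R) ^ γ * (((1:ℝ)/2) ^ γ) ^ k := by
              rw [← Real.rpow_natCast, ← Real.rpow_mul (by norm_num), mul_comm γ, Real.rpow_mul (by norm_num), Real.rpow_natCast,
                ← Real.mul_rpow (by positivity) (by positivity)]
              congr 1; simp only [hr]; ring
            have e3 : (2 * r k) ^ ((m:ℝ)+1) = 2 ^ ((m:ℝ)+1) * (2 * r (k+1)) ^ ((m:ℝ)+1) := by
              rw [e1, Real.mul_rpow (by norm_num) (by have := hrpos (k+1); positivity)]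
            rw [e2, e3]
            have : (2 * r (k+1)) ^ ((m:ℝ)+1) ≠ 0 := by have := hrpos (k+1); positivity
            field_simp
    rw [dist_comm, dist_eq_norm]
    rw [← ofReal_norm] at h4
    exact (ENNReal.ofReal_le_ofReal_iff (by positivity)).1 h4
  have := dist_le_of_le_geometric_of_tendsto₀ _ _ (half_lt hγ) hstep hlim
  rw [hA0, dist_comm, dist_eq_norm] at this
  refine this.trans (le_of_eq ?_)
  unfold CC; ring
end



lemma grd_sm {m : ℕ} (f : Spc m → ℝ) : StronglyMeasurable (grd f) := by
  have : SecondCountableTopology (Spc m →L[ℝ] ℝ) := by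
    have : ProperSpace (Spc m →L[ℝ] ℝ) := FiniteDimensional.proper ℝ _
    infer_instance
  exact (measurable_fderiv ℝ f).stronglyMeasurable

section
variable {m : ℕ}

lemma ftc_line {F : Spc m → ℝ} (hF : Differentiable ℝ F) {κ : ℝ} {x h : Spc m}
    (hb : ∀ᵐ θ : ℝ, θ ∈ Icc (0:ℝ) 1 → ‖fderiv ℝ F (x + θ • h)‖ ≤ κ) :
    |F (x + h) - F x| ≤ κ * ‖h‖ := by
  have hd : ∀ θ : ℝ, HasDerivAt (fun θ : ℝ => F (x + θ • h)) (fderiv ℝ F (x + θ • h) h) θ := by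
    intro θ
    have h1 : HasDerivAt (fun θ : ℝ => x + θ • h) h θ := by
      simpa using ((hasDerivAt_id θ).smul_const h).const_add x
    exact (hF _).hasFDerivAt.comp_hasDerivAt θ h1
  have hm : Measurable (fun θ : ℝ => fderiv ℝ F (x + θ • h) h) := by
    have := measurable_fderiv_apply_const ℝ F h
    exact this.comp (by fun_prop)
  have hae : ∀ᵐ θ : ℝ, θ ∈ Set.uIoc (0:ℝ) 1 → ‖fderiv ℝ F (x + θ • h) h‖ ≤ κ * ‖h‖ := by
    filter_upwards [hb] with θ hθ hmem
    rw [uIoc_of_le zero_le_one] at hmem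
    exact (ContinuousLinearMap.le_opNorm _ _).trans (by gcongr; exact hθ ⟨hmem.1.le, hmem.2⟩)
  have hi : IntervalIntegrable (fun θ : ℝ => fderiv ℝ F (x + θ • h) h) volume 0 1 := by
    rw [intervalIntegrable_iff]
    refine Measure.integrableOn_of_bounded (M := κ * ‖h‖) (by simp) hm.aestronglyMeasurable ?_
    rw [ae_restrict_iff' measurableSet_uIoc]
    exact hae
  have := intervalIntegral.integral_eq_sub_of_hasDerivAt (fun θ _ => hd θ) hi
  simp only [one_smul, zero_smul, add_zero] at this
  rw [← this, ← Real.norm_eq_abs]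
  have := intervalIntegral.norm_integral_le_of_norm_le_const_ae hae
  simpa using this

lemma lip_of_ae {F : Spc m → ℝ} (hF : Differentiable ℝ F) {κ R : ℝ} (hR : 0 < R) {c : Spc m}
    (hb : ∀ᵐ x : Spc m, x ∈ Metric.closedBall c R → ‖fderiv ℝ F x‖ ≤ κ) {x y : Spc m}
    (hx : x ∈ Metric.closedBall c R) (hy : y ∈ Metric.closedBall c R) :
    |F y - F x| ≤ κ * ‖y - x‖ := by
  have hconv := convex_closedBall c R
  have step1 : ∀ h : Spc m, ∀ᵐ x : Spc m, x ∈ Metric.closedBall c R → x + h ∈ Metric.closedBall c R →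
      |F (x + h) - F x| ≤ κ * ‖h‖ := by
    intro h
    have h1 : ∀ᵐ θ : ℝ, ∀ᵐ x : Spc m, x + θ • h ∈ Metric.closedBall c R → ‖fderiv ℝ F (x + θ • h)‖ ≤ κ := by
      refine Eventually.of_forall fun θ => ?_
      exact (measurePreserving_add_right (volume : Measure (Spc m)) (θ • h)).quasiMeasurePreserving.ae hb
    have h2 : ∀ᵐ x : Spc m, ∀ᵐ θ : ℝ, x + θ • h ∈ Metric.closedBall c R → ‖fderiv ℝ F (x + θ • h)‖ ≤ κ := by
      have hm0 : MeasurableSet {z : Spc m | z ∈ Metric.closedBall c R → ‖fderiv ℝ F z‖ ≤ κ} := by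
        have : {z : Spc m | z ∈ Metric.closedBall c R → ‖fderiv ℝ F z‖ ≤ κ} =
          (Metric.closedBall c R)ᶜ ∪ {z | ‖fderiv ℝ F z‖ ≤ κ} := by
          ext z; simp only [mem_ofPred_eq, mem_union, mem_compl_iff]; tauto
        rw [this]
        exact Metric.isClosed_closedBall.measurableSet.compl.union
          (measurableSet_le (measurable_fderiv ℝ F).norm measurable_const)
      have hm : MeasurableSet {z : ℝ × Spc m | z.2 + z.1 • h ∈ Metric.closedBall c R → ‖fderiv ℝ F (z.2 + z.1 • h)‖ ≤ κ} :=
        (by fun_prop : Measurable fun z : ℝ × Spc m => z.2 + z.1 • h) hm0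
      exact (Measure.ae_ae_comm hm).1 h1
    filter_upwards [h2] with x hx hxQ hxh
    apply ftc_line hF
    filter_upwards [hx] with θ hθ hmem
    apply hθ
    have := hconv hxQ hxh (sub_nonneg.2 hmem.2) hmem.1 (by ring)
    convert this using 1
    module
  have step2 : ∀ x ∈ Metric.ball c R, ∀ y ∈ Metric.ball c R, |F y - F x| ≤ κ * ‖y - x‖ := by
    intro x hx y hy
    have hd := Measure.dense_of_ae (step1 (y - x))
    have hcont := hF.continuous
    have hU : IsOpen (Metric.ball c R ∩ (fun z => z + (y - x)) ⁻¹' Metric.ball c R) :=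
      Metric.isOpen_ball.inter (Metric.isOpen_ball.preimage (by fun_prop))
    have hxU : x ∈ Metric.ball c R ∩ (fun z => z + (y - x)) ⁻¹' Metric.ball c R := ⟨hx, by simpa using hy⟩
    have hcl : IsClosed {z : Spc m | |F (z + (y - x)) - F z| ≤ κ * ‖y - x‖} :=
      isClosed_le (by fun_prop) continuous_const
    have hxc := hd.open_subset_closure_inter hU hxU
    have := closure_minimal (t := {z : Spc m | |F (z + (y - x)) - F z| ≤ κ * ‖y - x‖}) (by
      rintro z ⟨hz1, hz2⟩
      exact hz2 (Metric.ball_subset_closedBall hz1.1) (Metric.ball_subset_closedBall hz1.2)) hcl hxc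
    simpa using this
  have hcl : IsClosed {z : Spc m × Spc m | |F z.2 - F z.1| ≤ κ * ‖z.2 - z.1‖} := by
    have hcont := hF.continuous
    exact isClosed_le (by fun_prop) (by fun_prop)
  have := closure_minimal (s := Metric.ball c R ×ˢ Metric.ball c R) (t := {z : Spc m × Spc m | |F z.2 - F z.1| ≤ κ * ‖z.2 - z.1‖})
    (fun z hz => step2 _ hz.1 _ hz.2) hcl
  rw [closure_prod_eq, closure_ball c hR.ne'] at this
  exact this (show (x, y) ∈ Metric.closedBall c R ×ˢ Metric.closedBall c R from ⟨hx, hy⟩)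

lemma fderiv_le_of_lip {F : Spc m → ℝ} (hF : Differentiable ℝ F) {κ R : ℝ} (hκ : 0 ≤ κ) (hR : 0 < R) {c : Spc m}
    (hb : ∀ x ∈ Metric.closedBall c R, ∀ y ∈ Metric.closedBall c R, |F y - F x| ≤ κ * ‖y - x‖) {x : Spc m}
    (hx : x ∈ Metric.closedBall c R) : ‖fderiv ℝ F x‖ ≤ κ := by
  have hconv := convex_closedBall c R
  have key : ∀ h : Spc m, ‖h‖ ≤ R → ‖fderiv ℝ F x h‖ ≤ κ * ‖h‖ := by
    intro h hh
    have hd : ∀ w : Spc m, HasDerivAt (fun θ : ℝ => F (x + θ • w)) (fderiv ℝ F x w) 0 := by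
      intro w
      have h1 : HasDerivAt (fun θ : ℝ => x + θ • w) w 0 := by
        simpa using ((hasDerivAt_id (0:ℝ)).smul_const w).const_add x
      have h2 : HasFDerivAt F (fderiv ℝ F x) (x + (0:ℝ) • w) := by simpa using (hF x).hasFDerivAt
      exact h2.comp_hasDerivAt 0 h1
    have h3 := (hd (c - x + h)).sub (hd (c - x))
    have h4 := h3.hasDerivWithinAt (s := Ioi 0)
    rw [hasDerivWithinAt_iff_tendsto_slope' (by simp)] at h4
    have h5 := h4.norm
    rw [map_add, add_sub_cancel_left] at h5
    refine le_of_tendsto h5 ?_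
    have : Ioo (0:ℝ) 1 ∈ nhdsWithin (0:ℝ) (Ioi 0) := Ioo_mem_nhdsGT one_pos
    filter_upwards [this] with ε hε
    rw [slope_def_field, norm_div]
    simp only [zero_smul, add_zero, sub_zero, sub_self, Pi.sub_apply]
    rw [div_le_iff₀ (by simpa using hε.1.ne'), Real.norm_eq_abs, Real.norm_of_nonneg hε.1.le]
    have hm1 : x + ε • (c - x) ∈ Metric.closedBall c R := by
      have := hconv hx (Metric.mem_closedBall_self hR.le : c ∈ _) (sub_nonneg.2 hε.2.le) hε.1.le (by ring)
      convert this using 1; module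
    have hm2 : x + ε • (c - x + h) ∈ Metric.closedBall c R := by
      have hch : c + h ∈ Metric.closedBall c R := by simpa [Metric.mem_closedBall, dist_eq_norm] using hh
      have := hconv hx hch (sub_nonneg.2 hε.2.le) hε.1.le (by ring)
      convert this using 1; module
    have := hb _ hm1 _ hm2
    refine this.trans (le_of_eq ?_)
    have e : x + ε • (c - x + h) - (x + ε • (c - x)) = ε • h := by module
    rw [e, norm_smul, Real.norm_of_nonneg hε.1.le]; ring
  refine ContinuousLinearMap.opNorm_le_of_ball hR hκ fun h hh => key h ?_
  simpa using (Metric.mem_ball.1 hh).le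

lemma grd_dev {s p R : ℝ} (hp : 1 < p) (hs : 0 < s) (hγ : 0 < s - ((m : ℝ) + 1) / p) {f : Spc m → ℝ}
    (hf : Differentiable ℝ f) (c : Spc m) (hR : 0 < R)
    (hgi : IntegrableOn (grd f) (Metric.closedBall c R))
    (hI : ∫⁻ u in Metric.closedBall c R, ∫⁻ v in Metric.closedBall c R, kg s p (grd f) u v ≠ ⊤)
    {x : Spc m} (hx : x ∈ Metric.closedBall c R) :
      ‖grd f x - ⨍ y in Metric.closedBall c R, grd f y‖ ≤ CC m (s - ((m : ℝ) + 1) / p) *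
       ((2 * R) ^ (s - ((m : ℝ) + 1) / p) *
        ((∫⁻ u in Metric.closedBall c R, ∫⁻ v in Metric.closedBall c R, kg s p (grd f) u v) ^ (1 / p)).toReal) := by
  have h := campanato hp hs hγ (grd_sm f) c hR hgi hI
  set a := ⨍ y in Metric.closedBall c R, grd f y
  set κ := CC m (s - ((m : ℝ) + 1) / p) * ((2 * R) ^ (s - ((m : ℝ) + 1) / p) *
        ((∫⁻ u in Metric.closedBall c R, ∫⁻ v in Metric.closedBall c R, kg s p (grd f) u v) ^ (1 / p)).toReal) with hκ
  have hκ0 : 0 ≤ κ := by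
    have := CC_pos (m := m) hγ
    positivity
  have hF : Differentiable ℝ (fun z => f z - a z) := hf.sub a.differentiable
  have hfd : ∀ z, fderiv ℝ (fun z => f z - a z) z = grd f z - a := by
    intro z
    rw [fderiv_fun_sub (hf z) a.differentiableAt, a.fderiv, grd]
  rw [← hfd]
  refine fderiv_le_of_lip hF hκ0 hR (fun x hx y hy => lip_of_ae hF hR ?_ hx hy) hx
  filter_upwards [h] with z hz hzQ
  rw [hfd]; exact hz hzQ
end



lemma perE_grd {m : ℕ} {f : Spc m → ℝ} (hf : PerE f) : PerE (grd f) := by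
  intro x k j
  have : f = fun z : Spc m => f (z + ((k : ℝ), fun i => (j i : ℝ))) := by
    ext z; exact (hf z k j).symm
  conv_rhs => rw [grd, this, fderiv_comp_add_right]
  rfl

/-- Working regularity hypothesis. -/
structure Good {m : ℕ} (s p : ℝ) (f : Spc m → ℝ) : Prop where
  per : PerE f
  diff : Differentiable ℝ f
  e1 : ∫⁻ x in cube m, ‖grd f x‖ₑ ^ p ≠ ⊤
  eg : ∫⁻ x in cube m, ∫⁻ y in cube m, kg s p (grd f) x y ≠ ⊤

/-- First energy. -/
def En1 {m : ℕ} (p : ℝ) (f : Spc m → ℝ) : ℝ≥0∞ := ∫⁻ x in cube m, ‖grd f x‖ₑ ^ p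
/-- Gagliardo energy of the gradient. -/
def Eng {m : ℕ} (s p : ℝ) (f : Spc m → ℝ) : ℝ≥0∞ :=
  ∫⁻ x in cube m, ∫⁻ y in cube m, kg s p (grd f) x y

/-- localized energy -/
def Gl {m : ℕ} (s p r : ℝ) (f : Spc m → ℝ) (x : Spc m) : ℝ≥0∞ :=
  ∫⁻ u in cube m, (Metric.closedBall x (2 * r)).indicator (fun u => ∫⁻ v in cube m, kg s p (grd f) u v) u

/-- clamp -/
def clp (a b x : ℝ) : ℝ := max a (min x b)

lemma clp_facts {r x y : ℝ} (hr : 0 < r) (hr2 : r ≤ 1/2) (hx : 0 ≤ x ∧ x ≤ 1) (hy : 0 ≤ y ∧ y ≤ 1)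
   (hxy : |x - y| ≤ r) : |x - clp r (1-r) x| ≤ r ∧ |y - clp r (1-r) x| ≤ r ∧ r ≤ clp r (1-r) x ∧ clp r (1-r) x ≤ 1 - r := by
  unfold clp
  rw [abs_le] at hxy
  rcases max_cases r (min x (1-r)) with h1 | h1 <;> rcases min_cases x (1-r) with h2 | h2 <;>
  refine ⟨abs_le.2 ⟨?_, ?_⟩, abs_le.2 ⟨?_, ?_⟩, ?_, ?_⟩ <;> linarith [hxy.1, hxy.2, hx.1, hx.2, hy.1, hy.2, h1.1, h1.2, h2.1, h2.2]

lemma clp_facts2 {r x h : ℝ} (hr2 : r ≤ 1/2) (hx : 0 ≤ x ∧ x < 1) (hh : |h| ≤ r) :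
    |clp 0 1 (x+h) - x| ≤ r ∧ (0 ≤ clp 0 1 (x + h) ∧ clp 0 1 (x + h) ≤ 1) ∧
    (0 ≤ clp 0 1 (x+h) - ⌊x+h⌋ ∧ clp 0 1 (x+h) - ⌊x+h⌋ ≤ 1) ∧ |clp 0 1 (x+h) - ⌊x+h⌋ - Int.fract (x+h)| ≤ r := by
  have hfr : Int.fract (x+h) = x + h - ⌊x+h⌋ := rfl
  rw [abs_le] at hh
  rcases lt_or_ge (x+h) 0 with h1 | h1
  · have hf : ⌊x+h⌋ = -1 := by rw [Int.floor_eq_iff]; push_cast; constructor <;> linarith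
    have hc : clp 0 1 (x+h) = 0 := by
      unfold clp; rw [min_eq_left (by linarith), max_eq_left h1.le]
    rw [hfr, hf, hc]; push_cast
    refine ⟨abs_le.2 ⟨?_, ?_⟩, ⟨?_, ?_⟩, ⟨?_, ?_⟩, abs_le.2 ⟨?_, ?_⟩⟩ <;> linarith
  rcases lt_or_ge (x+h) 1 with h2 | h2
  · have hf : ⌊x+h⌋ = 0 := by rw [Int.floor_eq_iff]; push_cast; constructor <;> linarith
    have hc : clp 0 1 (x+h) = x + h := by
      unfold clp; rw [min_eq_left (by linarith), max_eq_right h1]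
    rw [hfr, hf, hc]; push_cast
    refine ⟨abs_le.2 ⟨?_, ?_⟩, ⟨?_, ?_⟩, ⟨?_, ?_⟩, abs_le.2 ⟨?_, ?_⟩⟩ <;> linarith
  · have hf : ⌊x+h⌋ = 1 := by rw [Int.floor_eq_iff]; push_cast; constructor <;> linarith
    have hc : clp 0 1 (x+h) = 1 := by
      unfold clp; rw [min_eq_right (by linarith), max_eq_right (by linarith)]
    rw [hfr, hf, hc]; push_cast
    refine ⟨abs_le.2 ⟨?_, ?_⟩, ⟨?_, ?_⟩, ⟨?_, ?_⟩, abs_le.2 ⟨?_, ?_⟩⟩ <;> linarith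

lemma norm_spc_le {m : ℕ} {x : Spc m} {r : ℝ} (hr : 0 ≤ r) : ‖x‖ ≤ r ↔ |x.1| ≤ r ∧ ∀ i, |x.2 i| ≤ r := by
  rw [Prod.norm_def, max_le_iff, pi_norm_le_iff_of_nonneg hr]
  simp [Real.norm_eq_abs]

section
variable {m : ℕ} {s p : ℝ} {f : Spc m → ℝ}

lemma Good.intOn (hf : Good s p f) (hp : 1 < p) : IntegrableOn (grd f) (cubeC m) := by
  have h1 : IntegrableOn (grd f) (cube m) := by
    have h2 : MemLp (grd f) (ENNReal.ofReal p) (μT m) := by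
      refine ⟨(grd_sm f).aestronglyMeasurable, ?_⟩
      rw [eLpNorm_lt_top_iff_lintegral_rpow_enorm_lt_top (by simp; linarith) ENNReal.ofReal_ne_top,
        ENNReal.toReal_ofReal (by linarith)]
      exact hf.e1.lt_top
    exact h2.integrable (by rw [ENNReal.one_le_ofReal]; exact hp.le)
  exact h1.congr_set_ae (cube_ae m).symm

lemma Good.eg_closed (Q : Set (Spc m)) (hQ : Q ⊆ cubeC m) (s p : ℝ) (f : Spc m → ℝ) :
    ∫⁻ u in Q, ∫⁻ v in Q, kg s p (grd f) u v ≤ Eng s p f := by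
  have h2 : ∀ u, ∫⁻ v in cubeC m, kg s p (grd f) u v = ∫⁻ v in cube m, kg s p (grd f) u v :=
    fun u => (setLIntegral_congr (cube_ae m)).symm
  calc _ ≤ ∫⁻ u in cubeC m, ∫⁻ v in cubeC m, kg s p (grd f) u v :=
      lintegral_mono' (Measure.restrict_mono hQ le_rfl) fun u => lintegral_mono_set hQ
    _ = _ := by simp_rw [h2]; exact (setLIntegral_congr (cube_ae m)).symm

/-- constant -/
def K0 (m : ℕ) (s p : ℝ) : ℝ := (2 * CC m (s - ((m : ℝ) + 1) / p) * 2 ^ (s - ((m : ℝ) + 1) / p)) ^ p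

lemma K0_nonneg (hγ : 0 < s - ((m : ℝ) + 1) / p) : 0 ≤ K0 m s p := by
  have := CC_pos (m := m) hγ
  unfold K0; positivity

lemma osc_ball (hp : 1 < p) (hs : 0 < s) (hγ : 0 < s - ((m : ℝ) + 1) / p) (hf : Good s p f)
    {c : Spc m} {r : ℝ} (hr : 0 < r) (hQ : Metric.closedBall c r ⊆ cubeC m) {x y : Spc m}
    (hx : x ∈ Metric.closedBall c r) (hy : y ∈ Metric.closedBall c r) :
    ‖grd f x - grd f y‖ₑ ^ p ≤ ENNReal.ofReal (K0 m s p * r ^ (s * p - ((m:ℝ) + 1))) *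
      ∫⁻ u in Metric.closedBall c r, ∫⁻ v in Metric.closedBall c r, kg s p (grd f) u v := by
  have hp0 : 0 < p := by linarith
  have hI := ((Good.eg_closed _ hQ s p f).trans_lt (show Eng s p f < ⊤ from hf.eg.lt_top)).ne
  have hgi := (hf.intOn hp).mono_set hQ
  have h1 := grd_dev hp hs hγ hf.diff c hr hgi hI hx
  have h2 := grd_dev hp hs hγ hf.diff c hr hgi hI hy
  set I := ∫⁻ u in Metric.closedBall c r, ∫⁻ v in Metric.closedBall c r, kg s p (grd f) u v
  set γ := s - ((m : ℝ) + 1) / p with hγd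
  have hC := CC_pos (m := m) hγ
  have h3 : ‖grd f x - grd f y‖ ≤ 2 * CC m γ * (2 * r) ^ γ * (I ^ (1/p)).toReal := by
    rw [norm_sub_rev] at h2
    have := norm_sub_le_norm_sub_add_norm_sub (grd f x) (⨍ y in Metric.closedBall c r, grd f y) (grd f y)
    refine this.trans ?_
    linarith
  have hIt : I ^ (1 / p) ≠ ⊤ := ENNReal.rpow_ne_top_of_nonneg (by positivity) hI
  have h4 : ‖grd f x - grd f y‖ₑ ≤ ENNReal.ofReal (2 * CC m γ * (2 * r) ^ γ) * I ^ (1/p) := by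
    rw [← ofReal_norm, ← ENNReal.ofReal_toReal hIt, ← ENNReal.ofReal_mul (by positivity)]
    exact ENNReal.ofReal_le_ofReal h3
  calc _ ≤ (ENNReal.ofReal (2 * CC m γ * (2 * r) ^ γ) * I ^ (1/p)) ^ p := by gcongr
    _ = _ := by
      rw [ENNReal.mul_rpow_of_nonneg _ _ hp0.le, ← ENNReal.rpow_mul, show 1 / p * p = 1 by field_simp, ENNReal.rpow_one,
        ENNReal.ofReal_rpow_of_nonneg (by positivity) hp0.le]
      congr 2
      unfold K0
      rw [← hγd, Real.mul_rpow (by norm_num) hr.le, ← mul_assoc, Real.mul_rpow (by positivity) (by positivity),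
        ← Real.rpow_mul hr.le]
      congr 2
      rw [hγd]; field_simp

lemma osc_near (hp : 1 < p) (hs : 0 < s) (hγ : 0 < s - ((m : ℝ) + 1) / p) (hf : Good s p f)
    {r : ℝ} (hr : 0 < r) (hr2 : r ≤ 1/2) {x y : Spc m} (hx : x ∈ cubeC m) (hy : y ∈ cubeC m)
    (hxy : ‖x - y‖ ≤ r) :
    ‖grd f x - grd f y‖ₑ ^ p ≤ ENNReal.ofReal (K0 m s p * r ^ (s * p - ((m:ℝ) + 1))) * Gl s p r f x := by
  rw [mem_cubeC] at hx hy
  rw [norm_spc_le hr.le] at hxy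
  have f1 := clp_facts hr hr2 hx.1 hy.1 hxy.1
  have f2 := fun i => clp_facts hr hr2 (hx.2 i) (hy.2 i) (hxy.2 i)
  set c : Spc m := (clp r (1-r) x.1, fun i => clp r (1-r) (x.2 i)) with hc
  have hxc : x ∈ Metric.closedBall c r := by
    rw [Metric.mem_closedBall, dist_eq_norm, norm_spc_le hr.le]
    exact ⟨f1.1, fun i => (f2 i).1⟩
  have hyc : y ∈ Metric.closedBall c r := by
    rw [Metric.mem_closedBall, dist_eq_norm, norm_spc_le hr.le]
    exact ⟨f1.2.1, fun i => (f2 i).2.1⟩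
  have hQ : Metric.closedBall c r ⊆ cubeC m := by
    intro z hz
    rw [Metric.mem_closedBall, dist_eq_norm, norm_spc_le hr.le] at hz
    have g1 := abs_le.1 hz.1
    have g2 := fun i => abs_le.1 (hz.2 i)
    simp only [hc, Prod.fst_sub, Prod.snd_sub, Pi.sub_apply] at g1 g2
    rw [mem_cubeC]
    exact ⟨⟨by linarith [f1.2.2.1], by linarith [f1.2.2.2]⟩, fun i => ⟨by linarith [(f2 i).2.2.1, (g2 i).1], by linarith [(f2 i).2.2.2, (g2 i).2]⟩⟩
  refine (osc_ball hp hs hγ hf hr hQ hxc hyc).trans ?_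
  gcongr
  unfold Gl
  rw [setLIntegral_congr (cube_ae m), ← lintegral_indicator Metric.isClosed_closedBall.measurableSet]
  rw [← lintegral_indicator (by rw [cubeC_eq]; exact Metric.isClosed_closedBall.measurableSet)]
  apply lintegral_mono
  intro u
  by_cases hu : u ∈ Metric.closedBall c r
  · have hu2 : u ∈ Metric.closedBall x (2 * r) := by
      rw [Metric.mem_closedBall] at *
      linarith [dist_triangle_right u x c]
    rw [indicator_of_mem hu, indicator_of_mem (hQ hu), indicator_of_mem hu2, setLIntegral_congr (cube_ae m)]
    exact lintegral_mono_set hQ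
  · rw [indicator_of_notMem hu]; exact zero_le

lemma osc_shift (hp : 1 < p) (hs : 0 < s) (hγ : 0 < s - ((m : ℝ) + 1) / p) (hf : Good s p f)
    {r : ℝ} (hr : 0 < r) (hr2 : r ≤ 1/2) {x h : Spc m} (hx : x ∈ cube m) (hh : ‖h‖ ≤ r) :
    ‖grd f (x + h) - grd f x‖ₑ ^ p ≤ 2 ^ (p - 1) * (ENNReal.ofReal (K0 m s p * r ^ (s * p - ((m:ℝ) + 1))) *
      (Gl s p r f x + Gl s p r f (frc (x + h)))) := by
  rw [norm_spc_le hr.le] at hh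
  have f1 := clp_facts2 hr2 hx.1 hh.1
  have f2 := fun i => clp_facts2 hr2 (hx.2 i trivial) (hh.2 i)
  set z : Spc m := (clp 0 1 (x.1 + h.1), fun i => clp 0 1 (x.2 i + h.2 i)) with hz
  set z' : Spc m := (clp 0 1 (x.1 + h.1) - ⌊x.1 + h.1⌋, fun i => clp 0 1 (x.2 i + h.2 i) - ⌊x.2 i + h.2 i⌋) with hz'
  have hg := perE_grd hf.per
  have e1 : grd f z' = grd f z := by
    rw [← hg z' ⌊x.1 + h.1⌋ (fun i => ⌊x.2 i + h.2 i⌋)]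
    simp [hz, hz']
  have e2 : grd f (x + h) = grd f (frc (x + h)) := (hg.frc _).symm
  have a1 := osc_near hp hs hγ hf hr hr2 (x := x) (y := z) (cube_sub_cubeC m hx) (by
    rw [mem_cubeC]; exact ⟨f1.2.1, fun i => (f2 i).2.1⟩) (by
    rw [norm_sub_rev, norm_spc_le hr.le]; exact ⟨f1.1, fun i => (f2 i).1⟩)
  have a2 := osc_near hp hs hγ hf hr hr2 (x := frc (x + h)) (y := z') (cube_sub_cubeC m (frc_mem _)) (by
    rw [mem_cubeC]; exact ⟨f1.2.2.1, fun i => (f2 i).2.2.1⟩) (by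
    rw [norm_sub_rev, norm_spc_le hr.le]; exact ⟨f1.2.2.2, fun i => (f2 i).2.2.2⟩)
  rw [e1] at a2
  rw [e2]
  have tri : ‖grd f (frc (x + h)) - grd f x‖ₑ ≤ ‖grd f (frc (x+h)) - grd f z‖ₑ + ‖grd f x - grd f z‖ₑ := by
    rw [enorm_sub_rev (grd f x) (grd f z)]
    have : grd f (frc (x + h)) - grd f x = (grd f (frc (x+h)) - grd f z) + (grd f z - grd f x) := by abel
    rw [this]; exact enorm_add_le (grd f (frc (x+h)) - grd f z) (grd f z - grd f x)
  calc _ ≤ (‖grd f (frc (x+h)) - grd f z‖ₑ + ‖grd f x - grd f z‖ₑ) ^ p := by gcongr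
    _ ≤ 2 ^ (p-1) * (‖grd f (frc (x+h)) - grd f z‖ₑ ^ p + ‖grd f x - grd f z‖ₑ ^ p) :=
      ENNReal.rpow_add_le_mul_rpow_add_rpow _ _ hp.le
    _ ≤ _ := by
      gcongr
      rw [mul_add, add_comm]
      gcongr

lemma meas_phi (s p : ℝ) (f : Spc m → ℝ) : Measurable (fun u => ∫⁻ v in cube m, kg s p (grd f) u v) :=
  Measurable.lintegral_prod_right' (meas_kg (grd_sm f) s p)

lemma meas_Gl_aux (s p r : ℝ) (f : Spc m → ℝ) : Measurable (fun z : Spc m × Spc m =>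
    (Metric.closedBall z.1 (2 * r)).indicator (fun u => ∫⁻ v in cube m, kg s p (grd f) u v) z.2) := by
  have h : MeasurableSet {z : Spc m × Spc m | dist z.2 z.1 ≤ 2 * r} :=
    measurableSet_le (by fun_prop) measurable_const
  have := ((meas_phi s p f).comp (measurable_snd (α := Spc m) (β := Spc m))).indicator h
  exact this

lemma meas_Gl (s p r : ℝ) (f : Spc m → ℝ) : Measurable (Gl s p r f) :=
  Measurable.lintegral_prod_right' (meas_Gl_aux s p r f)

lemma int_Gl (s p : ℝ) {r : ℝ} (hr : 0 < r) (f : Spc m → ℝ) :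
    ∫⁻ x in cube m, Gl s p r f x ≤ ENNReal.ofReal ((4 * r) ^ ((m:ℝ) + 1)) * Eng s p f := by
  unfold Gl
  rw [lintegral_lintegral_swap (meas_Gl_aux s p r f).aemeasurable, Eng, ← lintegral_const_mul' _ _ ENNReal.ofReal_ne_top]
  apply lintegral_mono
  intro u
  dsimp only
  have : ∀ x : Spc m, (Metric.closedBall x (2 * r)).indicator (fun u => ∫⁻ v in cube m, kg s p (grd f) u v) u =
     (Metric.closedBall u (2 * r)).indicator (fun _ => ∫⁻ v in cube m, kg s p (grd f) u v) x := by
    intro x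
    simp only [indicator, Metric.mem_closedBall, dist_comm]
  simp_rw [this]
  rw [lintegral_indicator_const Metric.isClosed_closedBall.measurableSet, mul_comm]
  gcongr
  refine (Measure.restrict_apply_le _ _).trans ?_
  rw [vol_cb _ (by linarith)]
  apply le_of_eq; congr 2; ring

/-- constant -/
def KT (m : ℕ) (s p : ℝ) : ℝ := 2 ^ (p - 1) * (K0 m s p * (2 * 4 ^ ((m:ℝ) + 1)))

lemma trans_small (hp : 1 < p) (hs : 0 < s) (hγ : 0 < s - ((m : ℝ) + 1) / p) (hf : Good s p f)
    {r : ℝ} (hr : 0 < r) (hr2 : r ≤ 1/2) {h : Spc m} (hh : ‖h‖ ≤ r) :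
    ∫⁻ x in cube m, ‖grd f (x + h) - grd f x‖ₑ ^ p ≤ ENNReal.ofReal (KT m s p * r ^ (s * p)) * Eng s p f := by
  have hK := K0_nonneg (m := m) hγ
  have hmg := meas_Gl s p r f
  have hfrc : ∫⁻ x in cube m, Gl s p r f (frc (x + h)) = ∫⁻ x in cube m, Gl s p r f x := by
    have hper : PerE (fun x => Gl s p r f (frc x)) := by
      intro x k j
      dsimp only; congr 1
      ext <;> simp [frc]
    rw [lint_per hper h]
    refine setLIntegral_congr_fun (meas_cube m) fun x hx => ?_
    change Gl s p r f (frc x) = Gl s p r f x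
    congr 1
    ext
    · exact Int.fract_eq_self.2 ⟨hx.1.1, hx.1.2⟩
    · exact Int.fract_eq_self.2 ⟨(hx.2 _ trivial).1, (hx.2 _ trivial).2⟩
  calc _ ≤ ∫⁻ x in cube m, 2 ^ (p - 1) * (ENNReal.ofReal (K0 m s p * r ^ (s * p - ((m:ℝ) + 1))) *
      (Gl s p r f x + Gl s p r f (frc (x + h)))) :=
        setLIntegral_mono' (meas_cube m) fun x hx => osc_shift hp hs hγ hf hr hr2 hx hh
    _ = 2 ^ (p - 1) * (ENNReal.ofReal (K0 m s p * r ^ (s * p - ((m:ℝ) + 1))) *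
      (2 * ∫⁻ x in cube m, Gl s p r f x)) := by
        rw [lintegral_const_mul' _ _ (by finiteness), lintegral_const_mul' _ _ ENNReal.ofReal_ne_top,
          lintegral_add_left hmg, hfrc, two_mul]
    _ ≤ 2 ^ (p - 1) * (ENNReal.ofReal (K0 m s p * r ^ (s * p - ((m:ℝ) + 1))) *
      (2 * (ENNReal.ofReal ((4 * r) ^ ((m:ℝ) + 1)) * Eng s p f))) := by
        gcongr; exact int_Gl s p hr f
    _ = _ := by
      have e2 : (2 : ℝ≥0∞) ^ (p-1) = ENNReal.ofReal (2 ^ (p-1)) := by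
        rw [← ENNReal.ofReal_rpow_of_pos (by norm_num)]; simp
      have e3 : (2 : ℝ≥0∞) = ENNReal.ofReal 2 := by simp
      rw [e2, e3, ← mul_assoc, ← mul_assoc, ← mul_assoc, ← ENNReal.ofReal_mul (by positivity), ← ENNReal.ofReal_mul (by positivity),
        ← ENNReal.ofReal_mul (by positivity)]
      congr 2
      unfold KT
      rw [Real.mul_rpow (by norm_num) hr.le, Real.rpow_sub hr]
      have : r ^ ((m:ℝ)+1) ≠ 0 := by positivity
      field_simp
end



section
variable {m : ℕ} {s p : ℝ} {f : Spc m → ℝ}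

lemma enorm_sub_pow_le {E : Type*} [NormedAddCommGroup E] (hp : 1 < p) (a b : E) :
    ‖a - b‖ₑ ^ p ≤ 2 ^ (p - 1) * (‖a‖ₑ ^ p + ‖b‖ₑ ^ p) := by
  calc ‖a - b‖ₑ ^ p ≤ (‖a‖ₑ + ‖b‖ₑ) ^ p := by gcongr; exact enorm_sub_le
    _ ≤ _ := ENNReal.rpow_add_le_mul_rpow_add_rpow _ _ hp.le

lemma perE_enorm {E : Type*} [NormedAddCommGroup E] {g : Spc m → E} (hg : PerE g) (p : ℝ) :
    PerE (fun x => ‖g x‖ₑ ^ p) := fun x k j => by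
  show ‖g _‖ₑ ^ p = ‖g x‖ₑ ^ p
  rw [hg x k j]

lemma trans_triv {E : Type*} [NormedAddCommGroup E] (hp : 1 < p) {g : Spc m → E} (hg : PerE g)
    (hgm : StronglyMeasurable g) (h : Spc m) :
    ∫⁻ x in cube m, ‖g (x + h) - g x‖ₑ ^ p ≤ 2 ^ p * ∫⁻ x in cube m, ‖g x‖ₑ ^ p := by
  have hm : Measurable (fun x => ‖g x‖ₑ ^ p) := hgm.enorm.pow_const p
  calc _ ≤ ∫⁻ x in cube m, 2 ^ (p - 1) * (‖g (x + h)‖ₑ ^ p + ‖g x‖ₑ ^ p) :=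
        lintegral_mono fun x => enorm_sub_pow_le hp _ _
    _ = 2 ^ (p - 1) * (2 * ∫⁻ x in cube m, ‖g x‖ₑ ^ p) := by
      rw [lintegral_const_mul' _ _ (by finiteness), lintegral_add_right _ hm,
        lint_per (perE_enorm hg p) h, two_mul]
    _ = _ := by
      rw [← mul_assoc]
      congr 1
      conv_lhs => rw [← ENNReal.rpow_one 2, ← ENNReal.rpow_mul, ← ENNReal.rpow_add _ _ (by norm_num) (by norm_num)]
      congr 1; ring

/-- constant -/
def KA (m : ℕ) (s p : ℝ) : ℝ := KT m s p + 2 ^ p * 2 ^ (s * p)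

lemma KT_nonneg (hγ : 0 < s - ((m : ℝ) + 1) / p) : 0 ≤ KT m s p := by
  have := K0_nonneg (m := m) hγ
  unfold KT; positivity

lemma KA_nonneg (hγ : 0 < s - ((m : ℝ) + 1) / p) : 0 ≤ KA m s p := by
  have := KT_nonneg (m := m) hγ
  unfold KA; positivity

lemma trans_all (hp : 1 < p) (hs : 0 < s) (hγ : 0 < s - ((m : ℝ) + 1) / p) (hf : Good s p f)
    {r : ℝ} (hr : 0 < r) {h : Spc m} (hh : ‖h‖ ≤ r) :
    ∫⁻ x in cube m, ‖grd f (x + h) - grd f x‖ₑ ^ p ≤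
      ENNReal.ofReal (KA m s p * r ^ (s * p)) * (En1 p f + Eng s p f) := by
  have hK := KT_nonneg (m := m) hγ
  rcases le_or_gt r (1/2) with hr2 | hr2
  · refine (trans_small hp hs hγ hf hr hr2 hh).trans ?_
    gcongr ?_ * ?_
    · apply ENNReal.ofReal_le_ofReal
      gcongr
      unfold KA
      have : (0:ℝ) ≤ 2 ^ p * 2 ^ (s * p) := by positivity
      linarith
    · exact le_add_self
  · refine (trans_triv hp (perE_grd hf.per) (grd_sm f) h).trans ?_
    gcongr ?_ * ?_
    · rw [← ENNReal.ofReal_ofNat 2, ENNReal.ofReal_rpow_of_pos (by norm_num)]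
      apply ENNReal.ofReal_le_ofReal
      have h1 : 1 ≤ (2 * r) ^ (s * p) := Real.one_le_rpow (by linarith) (by positivity)
      rw [Real.mul_rpow (by norm_num) hr.le] at h1
      unfold KA
      have : 0 ≤ KT m s p * r ^ (s * p) := by positivity
      have h2 : (0:ℝ) < 2 ^ p := by positivity
      nlinarith
    · exact le_self_add

lemma Gl_le (s p r : ℝ) (f : Spc m → ℝ) (x : Spc m) : Gl s p r f x ≤ Eng s p f :=
  lintegral_mono fun u => indicator_le_self' (fun _ _ => zero_le) u

lemma grd_hold (hp : 1 < p) (hs : 0 < s) (hγ : 0 < s - ((m : ℝ) + 1) / p) (hf : Good s p f)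
    {r : ℝ} (hr : 0 < r) (hr2 : r ≤ 1/2) {x h : Spc m} (hh : ‖h‖ ≤ r) :
    ‖grd f (x + h) - grd f x‖ₑ ^ p ≤ 2 ^ (p - 1) * (ENNReal.ofReal (K0 m s p * r ^ (s * p - ((m:ℝ) + 1))) *
      (2 * Eng s p f)) := by
  have e1 : grd f (x + h) = grd f (frc x + h) := by
    exact (((perE_grd hf.per).comp_add h).frc x).symm
  have e2 : grd f x = grd f (frc x) := ((perE_grd hf.per).frc x).symm
  rw [e1, e2]
  refine (osc_shift hp hs hγ hf hr hr2 (frc_mem x) hh).trans ?_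
  rw [two_mul]
  gcongr <;> exact Gl_le _ _ _ _ _

lemma grd_cont (hp : 1 < p) (hs : 0 < s) (hγ : 0 < s - ((m : ℝ) + 1) / p) (hf : Good s p f) :
    Continuous (grd f) := by
  have hp0 : 0 < p := by linarith
  have hγ' : 0 < s * p - ((m:ℝ) + 1) := by
    have : (s - ((m : ℝ) + 1) / p) * p = s * p - ((m:ℝ) + 1) := by field_simp
    rw [← this]; positivity
  have hE : Eng s p f ≠ ⊤ := hf.eg
  rw [continuous_iff_continuousAt]
  intro x
  have key : Tendsto (fun r : ℝ => (2 ^ (p - 1) * (ENNReal.ofReal (K0 m s p * r ^ (s * p - ((m:ℝ) + 1))) *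
      (2 * Eng s p f)) : ℝ≥0∞)) (nhds 0) (nhds 0) := by
    have h1 : Tendsto (fun r : ℝ => ENNReal.ofReal (K0 m s p * r ^ (s * p - ((m:ℝ) + 1)))) (nhds 0) (nhds 0) := by
      have : Continuous (fun r : ℝ => ENNReal.ofReal (K0 m s p * r ^ (s * p - ((m:ℝ) + 1)))) :=
        ENNReal.continuous_ofReal.comp (continuous_const.mul (Real.continuous_rpow_const hγ'.le))
      have h2 := this.tendsto 0
      simpa [Real.zero_rpow hγ'.ne'] using h2
    have h2 := ENNReal.Tendsto.mul_const (b := 2 * Eng s p f) h1 (Or.inr (by finiteness))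
    have h3 := ENNReal.Tendsto.const_mul (a := 2 ^ (p - 1)) h2 (Or.inr (by finiteness))
    simpa using h3
  rw [Metric.continuousAt_iff]
  intro ε hε
  have h4 : ∀ᶠ r : ℝ in nhds 0, (2 ^ (p - 1) * (ENNReal.ofReal (K0 m s p * r ^ (s * p - ((m:ℝ) + 1))) *
      (2 * Eng s p f)) : ℝ≥0∞) < ENNReal.ofReal (ε ^ p) :=
    key.eventually_lt_const (by simp; positivity)
  obtain ⟨δ, hδ, hδ'⟩ := Metric.eventually_nhds_iff.1 h4
  set r := min (δ/2) (1/2) with hr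
  have hr0 : 0 < r := by positivity
  have hrδ : r < δ := (min_le_left _ _).trans_lt (by linarith)
  refine ⟨r, hr0, fun y hy => ?_⟩
  have h5 := grd_hold hp hs hγ hf hr0 (min_le_right _ _) (x := x) (h := y - x) (by
    rw [← dist_eq_norm]; exact hy.le)
  rw [add_sub_cancel] at h5
  have h6 := h5.trans_lt (hδ' (by rw [Real.dist_eq, sub_zero, abs_of_pos hr0]; exact hrδ))
  rw [← ofReal_norm, ENNReal.ofReal_rpow_of_nonneg (norm_nonneg _) hp0.le, ENNReal.ofReal_lt_ofReal_iff (by positivity)] at h6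
  rw [dist_eq_norm]
  exact lt_of_pow_lt_pow_left₀' hp0 hε.le h6
where
  lt_of_pow_lt_pow_left₀' {a b p : ℝ} (hp : 0 < p) (hb : 0 ≤ b) (h : a ^ p < b ^ p) : a < b := by
    by_contra hc
    push Not at hc
    exact absurd h (not_lt.2 (Real.rpow_le_rpow hb hc hp.le))

/-- zeroth energy -/
def En0 {m : ℕ} (p : ℝ) (f : Spc m → ℝ) : ℝ≥0∞ := ∫⁻ x in cube m, ‖f x‖ₑ ^ p

lemma sup_of_osc {E : Type*} [NormedAddCommGroup E] (hp : 1 < p) {g : Spc m → E} (hg : PerE g)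
    (hgm : StronglyMeasurable g) {A : ℝ≥0∞}
    (hosc : ∀ x ∈ cube m, ∀ y ∈ cube m, ‖g x - g y‖ₑ ^ p ≤ A) (x : Spc m) :
    ‖g x‖ₑ ^ p ≤ 2 ^ (p - 1) * (A + ∫⁻ y in cube m, ‖g y‖ₑ ^ p) := by
  rw [← hg.frc x]
  have hm : Measurable (fun x => ‖g x‖ₑ ^ p) := hgm.enorm.pow_const p
  calc ‖g (frc x)‖ₑ ^ p = ∫⁻ y in cube m, ‖g (frc x)‖ₑ ^ p := by simp [vol_cube]
    _ ≤ ∫⁻ y in cube m, 2 ^ (p - 1) * (A + ‖g y‖ₑ ^ p) := by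
      refine setLIntegral_mono' (meas_cube m) fun y hy => ?_
      calc _ ≤ (‖g (frc x) - g y‖ₑ + ‖g y‖ₑ) ^ p := by
            gcongr
            calc ‖g (frc x)‖ₑ = ‖(g (frc x) - g y) + g y‖ₑ := by rw [sub_add_cancel]
              _ ≤ _ := enorm_add_le _ _
        _ ≤ _ := ENNReal.rpow_add_le_mul_rpow_add_rpow _ _ hp.le
        _ ≤ _ := by gcongr; exact hosc _ (frc_mem x) _ hy
    _ = _ := by
      rw [lintegral_const_mul' _ _ (by finiteness), lintegral_const_add]
      simp [vol_cube]
where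
  lintegral_const_add {X : Type _} [MeasurableSpace X] {μ : Measure X} {a : ℝ≥0∞} {f : X → ℝ≥0∞} :
    ∫⁻ x, (a + f x) ∂μ = a * μ univ + ∫⁻ x, f x ∂μ := by
    rw [lintegral_add_left measurable_const, lintegral_const]

lemma sup_grd (hp : 1 < p) (hs : 0 < s) (hγ : 0 < s - ((m : ℝ) + 1) / p) :
    ∃ C : ℝ≥0∞, C ≠ ⊤ ∧ ∀ f : Spc m → ℝ, Good s p f → ∀ x, ‖grd f x‖ₑ ^ p ≤ C * (En1 p f + Eng s p f) := by
  refine ⟨2 ^ (p - 1) * (ENNReal.ofReal (K0 m s p * (1/2) ^ (s * p - ((m:ℝ) + 1))) + 1), by finiteness, fun f hf x => ?_⟩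
  refine (sup_of_osc hp (perE_grd hf.per) (grd_sm f) (A := ENNReal.ofReal (K0 m s p * (1/2) ^ (s * p - ((m:ℝ) + 1))) * Eng s p f)
    (fun x hx y hy => ?_) x).trans ?_
  · have hQ := cubeC_eq m
    refine (osc_ball hp hs hγ hf (by norm_num) hQ.symm.subset (hQ.subset (cube_sub_cubeC m hx)) (hQ.subset (cube_sub_cubeC m hy))).trans ?_
    gcongr
    exact Good.eg_closed _ hQ.symm.subset s p f
  · rw [mul_assoc]
    gcongr
    change _ + En1 p f ≤ _
    rw [add_mul, one_mul, mul_add]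
    calc _ ≤ ENNReal.ofReal (K0 m s p * (1/2) ^ (s * p - ((m:ℝ) + 1))) * Eng s p f + (En1 p f + Eng s p f) := by
          gcongr; exact le_self_add
      _ ≤ _ := by gcongr; exact le_add_self

lemma sup_fun (hp : 1 < p) (hs : 0 < s) (hγ : 0 < s - ((m : ℝ) + 1) / p) :
    ∃ C : ℝ≥0∞, C ≠ ⊤ ∧ ∀ f : Spc m → ℝ, Good s p f → ∀ x, ‖f x‖ₑ ^ p ≤ C * (En0 p f + (En1 p f + Eng s p f)) := by
  have hp0 : 0 < p := by linarith
  obtain ⟨C, hC, h⟩ := sup_grd (m := m) hp hs hγ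
  refine ⟨2 ^ (p - 1) * (C + 1), by finiteness, fun f hf x => ?_⟩
  refine (sup_of_osc hp hf.per hf.diff.continuous.stronglyMeasurable (A := C * (En1 p f + Eng s p f))
    (fun x hx y hy => ?_) x).trans ?_
  · set A := C * (En1 p f + Eng s p f) with hA
    have hAt : A ≠ ⊤ := ENNReal.mul_ne_top hC (ENNReal.add_ne_top.2 ⟨hf.e1, hf.eg⟩)
    have hA1 : A ^ (1 / p) ≠ ⊤ := ENNReal.rpow_ne_top_of_nonneg (by positivity) hAt
    have hb : ∀ z, ‖grd f z‖ ≤ (A ^ (1/p)).toReal := by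
      intro z
      have := ENNReal.rpow_le_rpow (h f hf z) (show 0 ≤ 1 / p by positivity)
      rw [← ENNReal.rpow_mul, show p * (1/p) = 1 by field_simp, ENNReal.rpow_one, ← ofReal_norm] at this
      exact (ENNReal.ofReal_le_iff_le_toReal hA1).1 this
    have h1 := convex_univ.norm_image_sub_le_of_norm_fderiv_le (𝕜 := ℝ) (fun z _ => hf.diff z) (fun z _ => hb z) (mem_univ y) (mem_univ x)
    have h2 : ‖x - y‖ ≤ 1 := by
      have h3 := cube_sub_cubeC m hx
      have h4 := cube_sub_cubeC m hy
      rw [mem_cubeC] at h3 h4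
      rw [norm_spc_le zero_le_one]
      refine ⟨abs_le.2 ⟨?_, ?_⟩, fun i => abs_le.2 ⟨?_, ?_⟩⟩ <;> simp only [Prod.fst_sub, Prod.snd_sub, Pi.sub_apply]
      · linarith [h3.1.1, h4.1.2]
      · linarith [h3.1.2, h4.1.1]
      · linarith [(h3.2 i).1, (h4.2 i).2]
      · linarith [(h3.2 i).2, (h4.2 i).1]
    have h5 : ‖f x - f y‖ ≤ (A ^ (1/p)).toReal := h1.trans (mul_le_of_le_one_right ENNReal.toReal_nonneg h2)
    rw [← ofReal_norm]
    have h6 := (ENNReal.ofReal_le_iff_le_toReal hA1).2 h5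
    calc _ ≤ (A ^ (1/p)) ^ p := by gcongr
      _ = A := by rw [← ENNReal.rpow_mul, show 1/p * p = 1 by field_simp, ENNReal.rpow_one]
  · rw [mul_assoc]
    gcongr
    change _ + En0 p f ≤ _
    rw [add_mul, one_mul]
    exact add_le_add (mul_le_mul' le_rfl le_add_self) le_self_add
end



section
variable {m : ℕ} {s p σ : ℝ} {f g : Spc m → ℝ}

/-- total energy -/
def ET {m : ℕ} (s p : ℝ) (f : Spc m → ℝ) : ℝ≥0∞ := En0 p f + (En1 p f + Eng s p f)

lemma LpN_eq (hp : 1 < p) (f : Spc m → ℝ) : LpN p f = (En0 p f) ^ (1 / p) := by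
  unfold LpN En0
  rw [eLpNorm_eq_lintegral_rpow_enorm_toReal (by simp; linarith) ENNReal.ofReal_ne_top, ENNReal.toReal_ofReal (by linarith)]
  rfl

lemma grdLp_eq (hp : 1 < p) (f : Spc m → ℝ) :
    eLpNorm (fun x => ‖grd f x‖) (ENNReal.ofReal p) (μT m) = (En1 p f) ^ (1 / p) := by
  rw [eLpNorm_norm]
  unfold En1
  rw [eLpNorm_eq_lintegral_rpow_enorm_toReal (by simp; linarith) ENNReal.ofReal_ne_top, ENNReal.toReal_ofReal (by linarith)]
  rfl

lemma wnorm_eq (hp : 1 < p) (h1 : 1 < σ) (h2 : σ < 2) (f : Spc m → ℝ) :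
    WNorm σ p f = (En0 p f) ^ (1 / p) + (En1 p f) ^ (1 / p) + (Eng (σ - 1) p f) ^ (1 / p) := by
  unfold WNorm
  rw [if_neg (by linarith), if_neg (by linarith), if_pos h2, if_neg h1.ne', LpN_eq hp, grdLp_eq hp]
  rfl

lemma le_rpow_of (hp : 1 < p) {a b : ℝ≥0∞} (h : a ^ (1 / p) ≤ b) : a ≤ b ^ p := by
  have := ENNReal.rpow_le_rpow h (show 0 ≤ p by linarith)
  rwa [← ENNReal.rpow_mul, show 1 / p * p = 1 by field_simp, ENNReal.rpow_one] at this

lemma ET_le (hp : 1 < p) (h1 : 1 < σ) (h2 : σ < 2) (f : Spc m → ℝ) :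
    ET (σ - 1) p f ≤ 3 * (WNorm σ p f) ^ p := by
  have hw := wnorm_eq hp h1 h2 f
  have a1 : En0 p f ≤ (WNorm σ p f) ^ p := le_rpow_of hp (by rw [hw, add_assoc]; exact le_self_add)
  have a2 : En1 p f ≤ (WNorm σ p f) ^ p := le_rpow_of hp (by
    rw [hw]; exact le_add_self.trans le_self_add)
  have a3 : Eng (σ-1) p f ≤ (WNorm σ p f) ^ p := le_rpow_of hp (by rw [hw]; exact le_add_self)
  calc _ ≤ (WNorm σ p f) ^ p + ((WNorm σ p f) ^ p + (WNorm σ p f) ^ p) := add_le_add a1 (add_le_add a2 a3)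
    _ = _ := by ring

lemma good_of (hp : 1 < p) (h1 : 1 < σ) (h2 : σ < 2) (hf : MemW σ p f) :
    Good (σ - 1) p f ∧ ET (σ - 1) p f ≠ ⊤ := by
  have h := ET_le hp h1 h2 f
  have hE : ET (σ - 1) p f ≠ ⊤ := by
    refine (h.trans_lt ?_).ne
    exact ENNReal.mul_lt_top (by norm_num) (ENNReal.rpow_lt_top_of_nonneg (by linarith) hf.2.2.2.2.ne)
  have hE' := hE
  unfold ET at hE
  rw [ENNReal.add_ne_top, ENNReal.add_ne_top] at hE
  exact ⟨⟨hf.1, hf.2.2.1 h1.le, hE.2.1, hE.2.2⟩, hE'⟩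

lemma grd_lin (hf : Differentiable ℝ f) (hg : Differentiable ℝ g) (c : ℝ) (x : Spc m) :
    grd (fun x => f x + c * g x) x = grd f x + c • grd g x := by
  unfold grd
  exact ((hf x).hasFDerivAt.add ((hg x).hasFDerivAt.const_mul c)).fderiv

lemma pow_lin {E : Type*} [NormedAddCommGroup E] [NormedSpace ℝ E] (hp : 1 < p) {c : ℝ} (hc : |c| = 1) (a b : E) :
    ‖a + c • b‖ₑ ^ p ≤ 2 ^ (p - 1) * (‖a‖ₑ ^ p + ‖b‖ₑ ^ p) := by
  have hc' : ‖c‖ₑ = 1 := by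
    rw [← ofReal_norm, Real.norm_eq_abs, hc]; simp
  calc ‖a + c • b‖ₑ ^ p ≤ (‖a‖ₑ + ‖b‖ₑ) ^ p := by
        gcongr
        refine (enorm_add_le _ _).trans ?_
        rw [enorm_smul, hc', one_mul]
    _ ≤ _ := ENNReal.rpow_add_le_mul_rpow_add_rpow _ _ hp.le

lemma kg_eq {E : Type*} [NormedAddCommGroup E] (hp : 1 < p) (v : Spc m → E) (x y : Spc m) :
    kg s p v x y = ‖v x - v y‖ₑ ^ p * ENNReal.ofReal ((‖x - y‖ ^ ((m : ℝ) + 1 + s * p))⁻¹) := by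
  unfold kg
  rw [div_eq_mul_inv, ENNReal.ofReal_mul (by positivity), ← ofReal_norm,
    ENNReal.ofReal_rpow_of_nonneg (norm_nonneg _) (by linarith)]

lemma ET_lin (hp : 1 < p) (hf : Differentiable ℝ f) (hg : Differentiable ℝ g) {c : ℝ} (hc : |c| = 1) :
    ET s p (fun x => f x + c * g x) ≤ 2 ^ (p - 1) * (ET s p f + ET s p g) := by
  have h2 : (2 : ℝ≥0∞) ^ (p - 1) ≠ ⊤ := by finiteness
  have b0 : En0 p (fun x => f x + c * g x) ≤ 2 ^ (p - 1) * (En0 p f + En0 p g) := by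
    unfold En0
    rw [← lintegral_add_left (hf.continuous.measurable.enorm.pow_const p), ← lintegral_const_mul' _ _ h2]
    exact lintegral_mono fun x => pow_lin hp hc (f x) (g x)
  have b1 : En1 p (fun x => f x + c * g x) ≤ 2 ^ (p - 1) * (En1 p f + En1 p g) := by
    unfold En1
    rw [← lintegral_add_left ((grd_sm f).enorm.pow_const p), ← lintegral_const_mul' _ _ h2]
    refine lintegral_mono fun x => ?_
    rw [grd_lin hf hg]
    exact pow_lin hp hc _ _
  have b2 : Eng s p (fun x => f x + c * g x) ≤ 2 ^ (p - 1) * (Eng s p f + Eng s p g) := by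
    unfold Eng
    rw [← lintegral_add_left (meas_phi s p f), ← lintegral_const_mul' _ _ h2]
    refine lintegral_mono fun x => ?_
    rw [← lintegral_add_left ((meas_kg (grd_sm f) s p).of_uncurry_left), ← lintegral_const_mul' _ _ h2]
    refine lintegral_mono fun y => ?_
    rw [kg_eq hp, kg_eq hp, kg_eq hp, ← add_mul, ← mul_assoc]
    gcongr
    rw [grd_lin hf hg, grd_lin hf hg]
    have : grd f x + c • grd g x - (grd f y + c • grd g y) = (grd f x - grd f y) + c • (grd g x - grd g y) := by
      rw [smul_sub]; abel
    rw [this]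
    exact pow_lin hp hc _ _
  unfold ET
  calc _ ≤ 2 ^ (p - 1) * (En0 p f + En0 p g) + (2 ^ (p - 1) * (En1 p f + En1 p g) + 2 ^ (p - 1) * (Eng s p f + Eng s p g)) :=
      add_le_add b0 (add_le_add b1 b2)
    _ = _ := by ring

lemma Good.of_ET (hp : PerE f) (hd : Differentiable ℝ f) (h : ET s p f ≠ ⊤) : Good s p f := by
  unfold ET at h
  rw [ENNReal.add_ne_top, ENNReal.add_ne_top] at h
  exact ⟨hp, hd, h.2.1, h.2.2⟩

lemma good_sub (hp : 1 < p) (hf : Good s p f) (hg : Good s p g) (hEf : ET s p f ≠ ⊤) (hEg : ET s p g ≠ ⊤) :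
    Good s p (fun x => f x - g x) ∧ ET s p (fun x => f x - g x) ≤ 2 ^ (p-1) * (ET s p f + ET s p g) := by
  have e : (fun x => f x - g x) = (fun x => f x + (-1) * g x) := by ext; ring
  have h := ET_lin (s := s) hp hf.diff hg.diff (c := -1) (by norm_num)
  rw [← e] at h
  refine ⟨Good.of_ET ?_ (hf.diff.sub hg.diff) (h.trans_lt ?_).ne, h⟩
  · intro x k j
    show f _ - g _ = _
    rw [hf.per, hg.per]
  · exact ENNReal.mul_lt_top (by finiteness) (ENNReal.add_lt_top.2 ⟨hEf.lt_top, hEg.lt_top⟩)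

lemma grd_sub (hf : Differentiable ℝ f) (hg : Differentiable ℝ g) (x : Spc m) :
    grd (fun x => f x - g x) x = grd f x - grd g x := by
  unfold grd
  exact ((hf x).hasFDerivAt.sub (hg x).hasFDerivAt).fderiv

/-- C¹ control -/
lemma c1_ctrl (hp : 1 < p) (hs : 0 < s) (hγ : 0 < s - ((m : ℝ) + 1) / p) :
    ∃ C : ℝ≥0∞, C ≠ ⊤ ∧ ∀ f : Spc m → ℝ, Good s p f → ∀ x, ‖f x‖ₑ ^ p ≤ C * ET s p f ∧ ‖grd f x‖ₑ ^ p ≤ C * ET s p f := by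
  obtain ⟨C1, h1, h1'⟩ := sup_grd (m := m) hp hs hγ
  obtain ⟨C2, h2, h2'⟩ := sup_fun (m := m) hp hs hγ
  refine ⟨C1 + C2, by finiteness, fun f hf x => ⟨(h2' f hf x).trans (mul_le_mul' le_add_self le_rfl),
    (h1' f hf x).trans (mul_le_mul' le_self_add le_add_self)⟩⟩

/-- consequences on `[0,T]` -/
structure Reg {m : ℕ} (s p T : ℝ) (ψ : ℝ → Spc m → ℝ) : Prop where
  hp : 1 < p
  hs : 0 < s
  hs1 : s < 1
  hγ : 0 < s - ((m : ℝ) + 1) / p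
  hT : 0 ≤ T
  good : ∀ t ∈ Icc 0 T, Good s p (ψ t)
  bd : ∃ B : ℝ≥0∞, B ≠ ⊤ ∧ ∀ t ∈ Icc 0 T, ET s p (ψ t) ≤ B
  cont : ∀ t ∈ Icc 0 T, ∀ ε : ℝ, 0 < ε → ∃ δ > 0, ∀ t' ∈ Icc 0 T, |t' - t| < δ →
    ∀ x, |ψ t' x - ψ t x| ≤ ε ∧ ‖grd (ψ t') x - grd (ψ t) x‖ ≤ ε
  mpos : ∀ t ∈ Icc 0 T, ∀ x1, 0 < marg (ψ t) x1

lemma reg_of {T : ℝ} (hT : 0 ≤ T) (h2 : Hyp2 m σ p) {ψ : ℝ → Spc m → ℝ} (hD : ∀ t ∈ Icc 0 T, MemD σ p (ψ t))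
    (hc : ContW σ p (Icc 0 T) ψ) : Reg (σ - 1) p T ψ := by
  obtain ⟨hm, hpm, hσ, hσ2⟩ := h2
  have hm0 : (0:ℝ) ≤ m := by positivity
  have hp : 1 < p := by linarith
  have hp0 : 0 < p := by linarith
  have hnp : 0 < ((m:ℝ) + 1) / p := by positivity
  have hσ1 : 1 < σ := by linarith
  have hγ : 0 < (σ - 1) - ((m : ℝ) + 1) / p := by linarith
  have hs : 0 < σ - 1 := by linarith
  have hg := fun t ht => (good_of hp hσ1 hσ2 (hD t ht).1)
  refine ⟨hp, hs, by linarith, hγ, hT, fun t ht => (hg t ht).1, ?_, ?_, fun t ht => (hD t ht).2⟩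
  · have := (isCompact_Icc (a := 0) (b := T)).induction_on (p := fun S => ∃ B : ℝ≥0∞, B ≠ ⊤ ∧ ∀ t ∈ S, t ∈ Icc 0 T → ET (σ - 1) p (ψ t) ≤ B)
      ⟨0, by simp, by simp⟩ (fun S S' hS ⟨B, h, h'⟩ => ⟨B, h, fun t ht => h' t (hS ht)⟩)
      (fun S S' ⟨B, h, h'⟩ ⟨B2, h2, h2'⟩ => ⟨B + B2, by finiteness, fun t ht ht' => ?_⟩) (fun t ht => ?_)
    · obtain ⟨B, hB, h⟩ := this
      exact ⟨B, hB, fun t ht => h t ht ht⟩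
    · rcases ht with ht | ht
      · exact (h' t ht ht').trans le_self_add
      · exact (h2' t ht ht').trans le_add_self
    · obtain ⟨δ, hδ, h⟩ := hc t ht 1 one_pos
      refine ⟨Metric.ball t δ, mem_nhdsWithin_of_mem_nhds (Metric.ball_mem_nhds t hδ), 2 ^ (p-1) * (ET (σ-1) p (ψ t) + 3 * 1), ?_, ?_⟩
      · have := (hg t ht).2
        finiteness
      · intro t' ht' htT
        have h3 := h t' htT ht'
        have h4 := ET_le hp hσ1 hσ2 (fun x => ψ t' x - ψ t x)
        have e : ψ t' = fun x => ψ t x + 1 * (ψ t' x - ψ t x) := by ext x; ring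
        have h5 := ET_lin (s := σ - 1) hp (hg t ht).1.diff ((hg t' htT).1.diff.sub (hg t ht).1.diff) (c := 1) (by simp)
        simp only [Pi.sub_apply] at h5
        rw [← e] at h5
        refine h5.trans ?_
        gcongr
        refine h4.trans ?_
        gcongr
        rw [ENNReal.ofReal_one] at h3
        exact ENNReal.rpow_le_one h3.le hp0.le
  · intro t ht ε hε
    obtain ⟨C, hC, hC'⟩ := c1_ctrl (m := m) hp hs hγ
    obtain ⟨η, hη, hη'⟩ : ∃ η : ℝ, 0 < η ∧ C * (3 * ENNReal.ofReal η ^ p) ≤ ENNReal.ofReal ε ^ p := by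
      have h1 : Tendsto (fun η : ℝ => C * (3 * ENNReal.ofReal η ^ p)) (nhdsWithin 0 (Ioi 0)) (nhds 0) := by
        have : Continuous (fun η : ℝ => C * (3 * ENNReal.ofReal η ^ p)) := by
          refine (ENNReal.continuous_const_mul hC).comp ((ENNReal.continuous_const_mul (by norm_num)).comp ?_)
          exact ENNReal.continuous_rpow_const.comp ENNReal.continuous_ofReal
        have h2 := this.tendsto 0
        simp only [ENNReal.ofReal_zero, ENNReal.zero_rpow_of_pos hp0, mul_zero] at h2
        exact h2.mono_left nhdsWithin_le_nhds
      have h3 := h1.eventually_le_const (u := ENNReal.ofReal ε ^ p) (ENNReal.rpow_pos (by simpa using hε) ENNReal.ofReal_ne_top)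
      obtain ⟨η, h4, h5⟩ := (h3.and self_mem_nhdsWithin).exists
      exact ⟨η, h5, h4⟩
    obtain ⟨δ, hδ, h⟩ := hc t ht η hη
    refine ⟨δ, hδ, fun t' ht' htt x => ?_⟩
    have h3 := h t' ht' htt
    have h4 := ET_le hp hσ1 hσ2 (fun x => ψ t' x - ψ t x)
    have hgs := (good_sub hp (hg t' ht').1 (hg t ht).1 (hg t' ht').2 (hg t ht).2).1
    obtain ⟨h5, h6⟩ := hC' _ hgs x
    rw [grd_sub (hg t' ht').1.diff (hg t ht).1.diff] at h6
    have h7 : C * ET (σ - 1) p (fun x => ψ t' x - ψ t x) ≤ ENNReal.ofReal ε ^ p := by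
      refine le_trans ?_ hη'
      gcongr
      refine h4.trans ?_
      gcongr
    have h8 := h5.trans h7
    have h9 := h6.trans h7
    rw [ENNReal.rpow_le_rpow_iff hp0, ← ofReal_norm, ENNReal.ofReal_le_ofReal_iff hε.le] at h8 h9
    exact ⟨h8, h9⟩

namespace Reg
variable {T : ℝ} {ψ : ℝ → Spc m → ℝ}

/-- time-clamped version -/
def ext (T : ℝ) (ψ : ℝ → Spc m → ℝ) (z : ℝ × Spc m) : ℝ := ψ (clp 0 T z.1) z.2

lemma clp_mem (hT : 0 ≤ T) (t : ℝ) : clp 0 T t ∈ Icc 0 T := ⟨le_max_left _ _, max_le hT (min_le_right _ _)⟩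
lemma clp_self {t : ℝ} (ht : t ∈ Icc 0 T) : clp 0 T t = t := by
  unfold clp; rw [min_eq_left ht.2, max_eq_right ht.1]
lemma clp_cont (T : ℝ) : Continuous (clp 0 T) := by unfold clp; fun_prop

lemma joint {E : Type*} [NormedAddCommGroup E] (hT : 0 ≤ T) {G : ℝ → Spc m → E} (hx : ∀ t ∈ Icc 0 T, Continuous (G t))
    (ht : ∀ t ∈ Icc 0 T, ∀ ε : ℝ, 0 < ε → ∃ δ > 0, ∀ t' ∈ Icc 0 T, |t' - t| < δ → ∀ x, ‖G t' x - G t x‖ ≤ ε) :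
    Continuous (fun z : ℝ × Spc m => G (clp 0 T z.1) z.2) := by
  rw [continuous_iff_continuousAt]
  rintro ⟨t, x⟩
  rw [Metric.continuousAt_iff']
  intro ε hε
  obtain ⟨δ, hδ, h⟩ := ht _ (clp_mem hT t) (ε/2) (by positivity)
  have h1 : ∀ᶠ z : ℝ × Spc m in nhds (t, x), dist (clp 0 T z.1) (clp 0 T t) < δ :=
    (Metric.continuousAt_iff'.1 ((clp_cont T).comp continuous_fst).continuousAt) δ hδ
  have h2 : ∀ᶠ z : ℝ × Spc m in nhds (t, x), dist (G (clp 0 T t) z.2) (G (clp 0 T t) x) < ε/2 :=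
    (Metric.continuousAt_iff'.1 ((hx _ (clp_mem hT t)).comp continuous_snd).continuousAt) (ε/2) (by positivity)
  filter_upwards [h1, h2] with z hz1 hz2
  have h3 := h _ (clp_mem hT z.1) hz1 z.2
  rw [← dist_eq_norm] at h3
  exact (dist_triangle _ (G (clp 0 T t) z.2) _).trans_lt (by linarith)

lemma joint0 (h : Reg s p T ψ) : Continuous (fun z : ℝ × Spc m => ψ (clp 0 T z.1) z.2) :=
  joint h.hT (fun t ht => (h.good t ht).diff.continuous) fun t ht ε hε => by
    obtain ⟨δ, hδ, h'⟩ := h.cont t ht ε hε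
    exact ⟨δ, hδ, fun t' ht' htt x => (h' t' ht' htt x).1⟩

lemma joint1 (h : Reg s p T ψ) : Continuous (fun z : ℝ × Spc m => grd (ψ (clp 0 T z.1)) z.2) :=
  joint (G := fun t => grd (ψ t)) h.hT (fun t ht => grd_cont h.hp h.hs h.hγ (h.good t ht)) fun t ht ε hε => by
    obtain ⟨δ, hδ, h'⟩ := h.cont t ht ε hε
    exact ⟨δ, hδ, fun t' ht' htt x => (h' t' ht' htt x).2⟩

lemma c1bd (h : Reg s p T ψ) : ∃ M : ℝ, 0 ≤ M ∧ ∀ t ∈ Icc 0 T, ∀ x, |ψ t x| ≤ M ∧ ‖grd (ψ t) x‖ ≤ M := by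
  obtain ⟨C, hC, hC'⟩ := c1_ctrl (m := m) h.hp h.hs h.hγ
  obtain ⟨B, hB, hB'⟩ := h.bd
  have hp0 : 0 < p := by linarith [h.hp]
  refine ⟨((C * B) ^ (1/p)).toReal, ENNReal.toReal_nonneg, fun t ht x => ?_⟩
  have hfin : (C * B) ^ (1/p) ≠ ⊤ := ENNReal.rpow_ne_top_of_nonneg (by positivity) (by finiteness)
  obtain ⟨h1, h2⟩ := hC' _ (h.good t ht) x
  have key : ∀ a : ℝ≥0∞, a ^ p ≤ C * ET s p (ψ t) → a ≤ (C * B) ^ (1 / p) := by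
    intro a ha
    rw [one_div, ENNReal.le_rpow_inv_iff hp0]
    exact ha.trans (by gcongr; exact hB' t ht)
  have h3 := key _ h1
  have h4 := key _ h2
  rw [← ofReal_norm, ENNReal.ofReal_le_iff_le_toReal hfin] at h3 h4
  exact ⟨h3, h4⟩
end Reg
end



section
variable {m : ℕ} {V u : Spc m → ℝ}

/-- partial average -/
def avg1 {m : ℕ} (k : Spc m → ℝ) (x1 : ℝ) : ℝ := ∫ y in cube1 m, k (x1, y)

lemma avg1_Icc (k : Spc m → ℝ) (x1 : ℝ) : avg1 k x1 = ∫ y in Icc (0 : Fin m → ℝ) 1, k (x1, y) :=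
  setIntegral_congr_set (cube1_ae m)

lemma avg1_cont {X : Type*} [TopologicalSpace X] [FirstCountableTopology X] [LocallyCompactSpace X]
    {K : X → Spc m → ℝ} (hK : Continuous (fun z : X × Spc m => K z.1 z.2)) :
    Continuous (fun z : X × ℝ => avg1 (K z.1) z.2) := by
  simp_rw [avg1_Icc]
  refine continuous_parametric_integral_of_continuous (f := fun (z : X × ℝ) (y : Fin m → ℝ) => K z.1 (z.2, y)) ?_ isCompact_Icc
  exact hK.comp (f := fun w : (X × ℝ) × (Fin m → ℝ) => (w.1.1, (w.1.2, w.2))) (by fun_prop)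

lemma avg1_int {k : Spc m → ℝ} (hk : Continuous k) (x1 : ℝ) : IntegrableOn (fun y => k (x1, y)) (cube1 m) := by
  have : IntegrableOn (fun y => k (x1, y)) (Icc 0 1) := (hk.comp (by fun_prop : Continuous fun y : Fin m → ℝ => (x1, y))).continuousOn.integrableOn_compact isCompact_Icc
  exact this.congr_set_ae (cube1_ae m)

lemma avg1_le {k : Spc m → ℝ} {M : ℝ} (hM : ∀ x, |k x| ≤ M) (x1 : ℝ) : |avg1 k x1| ≤ M := by
  have := norm_setIntegral_le_of_norm_le_const (μ := volume) (s := cube1 m) (f := fun y => k (x1, y)) (C := M) (by simp [vol_cube1]) (fun y _ => hM _)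
  simpa [Measure.real, vol_cube1, avg1] using this

lemma avg1_sub {k l : Spc m → ℝ} (hk : Continuous k) (hl : Continuous l) (x1 : ℝ) :
    avg1 k x1 - avg1 l x1 = avg1 (fun x => k x - l x) x1 :=
  (integral_sub (avg1_int hk x1) (avg1_int hl x1)).symm

lemma avg1_per {k : Spc m → ℝ} (hk : PerE k) (x1 : ℝ) (j : ℤ) : avg1 k (x1 + j) = avg1 k x1 := by
  unfold avg1
  congr 1; ext y
  have := hk (x1, y) j 0
  simpa using this

lemma pd_cont {k : Spc m → ℝ} (hk : Continuous (grd k)) (v : Spc m) : Continuous (pd v k) :=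
  (ContinuousLinearMap.apply ℝ ℝ v).continuous.comp hk

lemma avg1_deriv {k : Spc m → ℝ} (hd : Differentiable ℝ k) (hc : Continuous (grd k)) (x1 : ℝ) :
    HasDerivAt (avg1 k) (avg1 (pd (e1 m) k) x1) x1 := by
  have hpc := pd_cont hc (e1 m)
  obtain ⟨M, hM⟩ := ((isCompact_closedBall x1 1).prod (isCompact_Icc (a := (0 : Fin m → ℝ)) (b := 1))).exists_bound_of_continuousOn
    hpc.continuousOn
  refine (hasDerivAt_integral_of_dominated_loc_of_deriv_le (s := Metric.ball x1 1) (bound := fun _ => M) (F := fun a y => k (a, y))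
    (F' := fun a y => pd (e1 m) k (a, y)) (Metric.ball_mem_nhds x1 one_pos) ?_ (avg1_int hd.continuous x1) ?_ ?_ ?_ ?_).2
  · exact Eventually.of_forall fun a => (avg1_int hd.continuous a).aestronglyMeasurable
  · exact (avg1_int hpc x1).aestronglyMeasurable
  · refine (ae_restrict_mem (meas_cube1 m)).mono fun y hy a ha => hM _ ⟨Metric.ball_subset_closedBall ha, ?_⟩
    exact ⟨fun i => (hy i trivial).1, fun i => (hy i trivial).2.le⟩
  · exact integrable_const _
  · refine Eventually.of_forall fun y a _ => ?_
    have h1 : HasDerivAt (fun a : ℝ => ((a, y) : Spc m)) (e1 m) a := (hasDerivAt_id a).prodMk (hasDerivAt_const a y)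
    exact (hd (a, y)).hasFDerivAt.comp_hasDerivAt a h1

lemma V_pd (hV : ContDiff ℝ 2 V) (v : Spc m) : ContDiff ℝ 1 (pd v V) := by
  have h := hV.fderiv_right (m := 1) (by norm_num)
  exact (ContinuousLinearMap.apply ℝ ℝ v).contDiff.comp h

lemma V_pdpd (hV : ContDiff ℝ 2 V) (v w : Spc m) : Continuous (pd w (pd v V)) :=
  pd_cont ((V_pd hV v).continuous_fderiv (by norm_num)) w

lemma grd_mul {a b : Spc m → ℝ} (ha : Differentiable ℝ a) (hb : Differentiable ℝ b) :
    grd (fun x => a x * b x) = fun x => a x • grd b x + b x • grd a x := by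
  ext1 x
  exact ((ha x).hasFDerivAt.mul (hb x).hasFDerivAt).fderiv

lemma pd_mul {a b : Spc m → ℝ} (ha : Differentiable ℝ a) (hb : Differentiable ℝ b) (v x : Spc m) :
    pd v (fun x => a x * b x) x = a x * pd v b x + b x * pd v a x := by
  have := congrFun (grd_mul ha hb) x
  have := congrArg (fun L => L v) this
  simpa [grd, pd] using this

/-- numerators -/
def Nn {m : ℕ} (V u : Spc m → ℝ) : Spc m → ℝ := fun z => pd (e1 m) V z * u z
/-- derivative of numerators -/
def Nd {m : ℕ} (V u : Spc m → ℝ) : Spc m → ℝ := fun z => pd (e1 m) V z * pd (e1 m) u z + u z * pd (e1 m) (pd (e1 m) V) z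

lemma phi_deriv (hV : ContDiff ℝ 2 V) (hd : Differentiable ℝ u) (hc : Continuous (grd u)) (x1 : ℝ) (hpos : 0 < marg u x1) :
    HasDerivAt (phiF V u) ((avg1 (Nd V u) x1 * avg1 u x1 - avg1 (Nn V u) x1 * avg1 (pd (e1 m) u) x1) / avg1 u x1 ^ 2) x1 := by
  have hVd := (V_pd hV (e1 m)).differentiable (by norm_num)
  have h1 := avg1_deriv (k := Nn V u) (hVd.mul hd) (by
    unfold Nn
    rw [grd_mul hVd hd]
    exact ((V_pd hV (e1 m)).continuous.smul hc).add (hd.continuous.smul ((V_pd hV (e1 m)).continuous_fderiv (by norm_num)))) x1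
  have e : pd (e1 m) (Nn V u) = Nd V u := by
    ext x; unfold Nn; rw [pd_mul hVd hd]; rfl
  rw [e] at h1
  exact h1.div (avg1_deriv hd hc x1) hpos.ne'

lemma phiu_fderiv (hV : ContDiff ℝ 2 V) (hd : Differentiable ℝ u) (hc : Continuous (grd u)) (x : Spc m) (hpos : 0 < marg u x.1) :
    DifferentiableAt ℝ (fun z : Spc m => phiF V u z.1 * u z) x ∧ pd (e1 m) (fun z => phiF V u z.1 * u z) x =
     (avg1 (Nd V u) x.1 * avg1 u x.1 - avg1 (Nn V u) x.1 * avg1 (pd (e1 m) u) x.1) / avg1 u x.1 ^ 2 * u x +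
      avg1 (Nn V u) x.1 / avg1 u x.1 * pd (e1 m) u x := by
  have h1 := phi_deriv hV hd hc x.1 hpos
  have h2 := h1.comp_hasFDerivAt x (hasFDerivAt_fst (𝕜 := ℝ) (p := x))
  have h3 := h2.mul (hd x).hasFDerivAt
  refine ⟨h3.differentiableAt, ?_⟩
  have h4 := h3.fderiv
  have h5 := congrArg (fun L => L (e1 m)) h4
  refine h5.trans ?_
  have : phiF V u x.1 = avg1 (Nn V u) x.1 / avg1 u x.1 := rfl
  rw [← this]
  have h6 : (e1 m).1 = 1 := rfl
  simp [h6, pd]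
  ring

lemma Fop_formula (hV : ContDiff ℝ 2 V) (hd : Differentiable ℝ u) (hc : Continuous (grd u)) (x : Spc m) (hpos : 0 < marg u x.1) :
    Fop V u x = gradDot V u x + lap V x * u x - ((avg1 (Nd V u) x.1 * avg1 u x.1 - avg1 (Nn V u) x.1 * avg1 (pd (e1 m) u) x.1) / avg1 u x.1 ^ 2 * u x +
      avg1 (Nn V u) x.1 / avg1 u x.1 * pd (e1 m) u x) := by
  unfold Fop
  rw [(phiu_fderiv hV hd hc x hpos).2]

lemma pd_per {k : Spc m → ℝ} (hk : PerE k) (v : Spc m) : PerE (pd v k) := fun x i j => by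
  have := perE_grd hk x i j
  exact congrArg (fun L => L v) this

lemma phiu_per (hV : PerE V) (hu : PerE u) : PerE (fun z : Spc m => phiF V u z.1 * u z) := by
  intro x k j
  have h1 : phiF V u (x.1 + k) = phiF V u x.1 := by
    have a := avg1_per hu x.1 k
    have b := avg1_per (k := Nn V u) (fun x k j => by unfold Nn; rw [pd_per hV _ x k j, hu x k j]) x.1 k
    change avg1 (Nn V u) _ / avg1 u _ = avg1 (Nn V u) _ / avg1 u _
    rw [a, b]
  show phiF V u (x.1 + k) * u _ = _
  rw [h1, hu x k j]

lemma Fop_per (hV : PerE V) (hu : PerE u) : PerE (Fop V u) := by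
  intro x k j
  unfold Fop gradDot lap
  have e := pd_per (phiu_per hV hu) (e1 m) x k j
  have e2 := pd_per hV (e1 m) x k j
  have e3 := pd_per hu (e1 m) x k j
  have e4 := pd_per (pd_per hV (e1 m)) (e1 m) x k j
  have e5 := fun i => pd_per hV (eC m i) x k j
  have e6 := fun i => pd_per hu (eC m i) x k j
  have e7 := fun i => pd_per (pd_per hV (eC m i)) (eC m i) x k j
  rw [e, e2, e3, e4, hu x k j]
  simp_rw [e5, e6, e7]

lemma per_bdd {E : Type*} [NormedAddCommGroup E] {k : Spc m → E} (hk : PerE k) (hc : Continuous k) : ∃ M : ℝ, 0 ≤ M ∧ ∀ x, ‖k x‖ ≤ M := by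
  obtain ⟨M, hM⟩ := (isCompact_Icc (a := (0 : Spc m)) (b := 1)).exists_bound_of_continuousOn hc.continuousOn
  refine ⟨max M 0, le_max_right _ _, fun x => ?_⟩
  rw [← hk.frc x]
  exact (hM _ (cube_sub_cubeC m (frc_mem x))).trans (le_max_left _ _)

lemma cube_int {k : Spc m → ℝ} (hc : Continuous k) : IntegrableOn k (cube m) := by
  have : IntegrableOn k (Icc 0 1) := hc.continuousOn.integrableOn_compact isCompact_Icc
  exact this.congr_set_ae (cube_ae m)

lemma mean0 {w : Spc m → ℝ} (hw : PerE w) (hd : Differentiable ℝ w) {v : Spc m} (hc : Continuous (pd v w))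
    (hv : ∀ x, w (x + v) = w x) : ∫ x in cube m, pd v w x = 0 := by
  have h1 : ∀ x : Spc m, ∫ θ in (0:ℝ)..1, pd v w (x + θ • v) = 0 := by
    intro x
    have hder : ∀ θ : ℝ, HasDerivAt (fun θ : ℝ => w (x + θ • v)) (pd v w (x + θ • v)) θ := by
      intro θ
      have h1 : HasDerivAt (fun θ : ℝ => x + θ • v) v θ := by
        simpa using ((hasDerivAt_id θ).smul_const v).const_add x
      exact (hd _).hasFDerivAt.comp_hasDerivAt θ h1
    have := intervalIntegral.integral_eq_sub_of_hasDerivAt (a := 0) (b := 1) (fun θ _ => hder θ)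
      ((hc.comp (by fun_prop : Continuous fun θ : ℝ => x + θ • v)).intervalIntegrable _ _)
    rw [this]; simp [hv]
  have h2 : ∀ θ : ℝ, ∫ x in cube m, pd v w (x + θ • v) = ∫ x in cube m, pd v w x :=
    fun θ => int_per (pd_per hw v) (θ • v)
  have h3 : ∫ x in cube m, ∫ θ in (0:ℝ)..1, pd v w (x + θ • v) = ∫ θ in (0:ℝ)..1, ∫ x in cube m, pd v w (x + θ • v) := by
    simp_rw [intervalIntegral.integral_of_le zero_le_one]
    rw [integral_integral_swap]
    have hcc : Continuous (fun z : Spc m × ℝ => pd v w (z.1 + z.2 • v)) := hc.comp (by fun_prop)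
    obtain ⟨M, hM, hM'⟩ := per_bdd (pd_per hw v) hc
    have : IsFiniteMeasure ((volume.restrict (cube m))) := ⟨by simp [vol_cube]⟩
    exact Integrable.of_bound hcc.aestronglyMeasurable M (Eventually.of_forall fun z => hM' _)
  simp_rw [h1, h2] at h3
  simpa using h3.symm

lemma per_e1 {w : Spc m → ℝ} (hw : PerE w) (x : Spc m) : w (x + e1 m) = w x := by
  have := hw x 1 0
  rw [← this]; congr 1
  ext <;> simp [e1]

lemma per_eC {w : Spc m → ℝ} (hw : PerE w) (i : Fin m) (x : Spc m) : w (x + eC m i) = w x := by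
  have := hw x 0 (Pi.single i 1)
  rw [← this]; congr 1
  ext l
  · simp [eC]
  · simp only [eC, Prod.snd_add, Pi.add_apply]
    congr 1
    rcases eq_or_ne l i with rfl | h
    · simp
    · simp [h]

lemma Fop_cont (hV : ContDiff ℝ 2 V) (hd : Differentiable ℝ u) (hc : Continuous (grd u)) (hpos : ∀ x1, 0 < marg u x1) :
    Continuous (pd (e1 m) (fun z => phiF V u z.1 * u z)) := by
  have e : (pd (e1 m) (fun z => phiF V u z.1 * u z)) = _ := funext fun x => (phiu_fderiv hV hd hc x (hpos x.1)).2
  rw [e]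
  have A : ∀ k : Spc m → ℝ, Continuous k → Continuous (fun x : Spc m => avg1 k x.1) := by
    intro k hk
    exact (avg1_cont (X := Unit) (K := fun _ => k) (hk.comp continuous_snd)).comp (by fun_prop : Continuous fun x : Spc m => ((), x.1))
  have hu := hd.continuous
  have c1 := pd_cont hc (e1 m)
  have c2 := (V_pd hV (e1 m)).continuous
  have c3 := V_pdpd hV (e1 m) (e1 m)
  have a1 := A (Nd V u) (by unfold Nd; fun_prop)
  have a2 := A (Nn V u) (by unfold Nn; fun_prop)
  have a3 := A u hu
  have a4 := A _ c1
  have hne : ∀ x : Spc m, avg1 u x.1 ≠ 0 := fun x => (hpos x.1).ne'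
  have hne2 : ∀ x : Spc m, avg1 u x.1 ^ 2 ≠ 0 := fun x => pow_ne_zero 2 (hne x)
  exact ((((a1.mul a3).sub (a2.mul a4)).div (a3.pow 2) hne2).mul hu).add ((a2.div a3 hne).mul c1)

lemma Fop_mean0 (hV : ContDiff ℝ 2 V) (hVp : PerE V) (hu : PerE u) (hd : Differentiable ℝ u) (hc : Continuous (grd u)) (hpos : ∀ x1, 0 < marg u x1) :
    ∫ x in cube m, Fop V u x = 0 := by
  have hW : ∀ v : Spc m, Differentiable ℝ (fun x => pd v V x * u x) := fun v => ((V_pd hV v).differentiable (by norm_num)).mul hd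
  have hWc : ∀ v : Spc m, Continuous (pd v (fun x => pd v V x * u x)) := by
    intro v
    have : pd v (fun x => pd v V x * u x) = fun x => pd v V x * pd v u x + u x * pd v (pd v V) x :=
      funext fun x => pd_mul ((V_pd hV v).differentiable (by norm_num)) hd v x
    rw [this]
    have := (V_pd hV v).continuous
    have := V_pdpd hV v v
    have := hd.continuous
    have := pd_cont hc v
    fun_prop
  have hWp : ∀ v : Spc m, PerE (fun x => pd v V x * u x) := fun v x k j => by
    show pd v V _ * u _ = _
    rw [pd_per hVp v x k j, hu x k j]
  have e : ∀ x, Fop V u x = pd (e1 m) (fun x => pd (e1 m) V x * u x) x + ∑ i, pd (eC m i) (fun x => pd (eC m i) V x * u x) x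
      - pd (e1 m) (fun z => phiF V u z.1 * u z) x := by
    intro x
    unfold Fop gradDot lap
    simp_rw [fun v => pd_mul ((V_pd hV v).differentiable (by norm_num)) hd v x]
    rw [Finset.sum_add_distrib, add_mul, Finset.sum_mul]
    simp_rw [mul_comm (u x)]
    ring
  simp_rw [e]
  have i1 := cube_int (hWc (e1 m))
  have i2 := fun i => cube_int (hWc (eC m i))
  have i3 := cube_int (Fop_cont hV hd hc hpos)
  have i4 : IntegrableOn (fun x => ∑ i, pd (eC m i) (fun x => pd (eC m i) V x * u x) x) (cube m) :=
    integrable_finsetSum _ fun i _ => i2 i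
  have i5 : IntegrableOn (fun x => pd (e1 m) (fun x => pd (e1 m) V x * u x) x + ∑ i, pd (eC m i) (fun x => pd (eC m i) V x * u x) x) (cube m) :=
    i1.add i4
  rw [integral_sub i5 i3, integral_add i1 i4,
    integral_finsetSum _ fun i _ => i2 i, mean0 (hWp _) (hW _) (hWc _) (per_e1 (hWp _)),
    mean0 (phiu_per hVp hu) (fun x => (phiu_fderiv hV hd hc x (hpos x.1)).1) (Fop_cont hV hd hc hpos) (per_e1 (phiu_per hVp hu))]
  simp [fun i => mean0 (hWp _) (hW (eC m i)) (hWc _) (per_eC (hWp _) i)]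

lemma Fop_cont' (hV : ContDiff ℝ 2 V) (hd : Differentiable ℝ u) (hc : Continuous (grd u)) (hpos : ∀ x1, 0 < marg u x1) :
    Continuous (Fop V u) := by
  have h := Fop_cont hV hd hc hpos
  unfold Fop gradDot lap
  have c1 := fun v => (V_pd hV v).continuous
  have c2 := fun v => V_pdpd hV v v
  have c3 := hd.continuous
  have c4 := fun v => pd_cont hc v
  fun_prop

lemma Fop_L0 {p : ℝ} (hp : 1 < p) (hV : ContDiff ℝ 2 V) (hVp : PerE V) (hu : PerE u) (hd : Differentiable ℝ u) (hc : Continuous (grd u)) (hpos : ∀ x1, 0 < marg u x1) :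
    MemL0 p (Fop V u) := by
  have h := Fop_cont' hV hd hc hpos
  refine ⟨Fop_per hVp hu, h.measurable, ?_, Fop_mean0 hV hVp hu hd hc hpos⟩
  obtain ⟨M, hM, hM'⟩ := per_bdd (Fop_per hVp hu) h
  exact (MemLp.of_bound h.aestronglyMeasurable M (Eventually.of_forall hM')).2
end



section
variable {m : ℕ} {s p T : ℝ} {ψ : ℝ → Spc m → ℝ} {V : Spc m → ℝ}

lemma Reg.ucont (h : Reg s p T ψ) {t : ℝ} (ht : t ∈ Icc 0 T) : Continuous (ψ t) := (h.good t ht).diff.continuous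
lemma Reg.gcont (h : Reg s p T ψ) {t : ℝ} (ht : t ∈ Icc 0 T) : Continuous (grd (ψ t)) := grd_cont h.hp h.hs h.hγ (h.good t ht)

lemma Reg.Fjoint (h : Reg s p T ψ) (hV : ContDiff ℝ 2 V) :
    Continuous (fun z : ℝ × Spc m => Fop V (ψ (clp 0 T z.1)) z.2) := by
  have e : (fun z : ℝ × Spc m => Fop V (ψ (clp 0 T z.1)) z.2) = _ := funext fun z =>
    Fop_formula hV (h.good _ (Reg.clp_mem h.hT z.1)).diff (h.gcont (Reg.clp_mem h.hT z.1)) z.2 (h.mpos _ (Reg.clp_mem h.hT z.1) _)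
  rw [e]
  have j0 := h.joint0
  have j1 := h.joint1
  have jp : ∀ v : Spc m, Continuous (fun z : ℝ × Spc m => pd v (ψ (clp 0 T z.1)) z.2) := fun v =>
    (ContinuousLinearMap.apply ℝ ℝ v).continuous.comp j1
  have A : ∀ K : ℝ → Spc m → ℝ, Continuous (fun z : ℝ × Spc m => K z.1 z.2) → Continuous (fun x : ℝ × Spc m => avg1 (K x.1) x.2.1) := by
    intro K hK
    exact (avg1_cont hK).comp (by fun_prop : Continuous fun x : ℝ × Spc m => (x.1, x.2.1))
  have c1 := fun v => (V_pd hV v).continuous.comp (continuous_snd (X := ℝ) (Y := Spc m))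
  have c2 := fun v => (V_pdpd hV v v).comp (continuous_snd (X := ℝ) (Y := Spc m))
  have a1 := A (fun t => Nd V (ψ (clp 0 T t))) (((c1 _).mul (jp _)).add (j0.mul (c2 _)))
  have a2 := A (fun t => Nn V (ψ (clp 0 T t))) ((c1 _).mul j0)
  have a3 := A (fun t => ψ (clp 0 T t)) j0
  have a4 := A (fun t => pd (e1 m) (ψ (clp 0 T t))) (jp _)
  have hne : ∀ x : ℝ × Spc m, avg1 (ψ (clp 0 T x.1)) x.2.1 ≠ 0 := fun x => (h.mpos _ (Reg.clp_mem h.hT x.1) x.2.1).ne'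
  have hne2 : ∀ x : ℝ × Spc m, avg1 (ψ (clp 0 T x.1)) x.2.1 ^ 2 ≠ 0 := fun x => pow_ne_zero 2 (hne x)
  have b1 : Continuous (fun z : ℝ × Spc m => gradDot V (ψ (clp 0 T z.1)) z.2) := by
    unfold gradDot
    exact ((c1 _).mul (jp _)).add (continuous_finsetSum _ fun i _ => (c1 _).mul (jp _))
  have b2 : Continuous (fun z : ℝ × Spc m => lap V z.2) := by
    unfold lap
    exact (c2 _).add (continuous_finsetSum _ fun i _ => c2 _)
  exact (b1.add (b2.mul j0)).sub (((((a1.mul a3).sub (a2.mul a4)).div (a3.pow 2) hne2).mul j0).add ((a2.div a3 hne).mul (jp _)))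

lemma Reg.mlow (h : Reg s p T ψ) : ∃ c > 0, ∀ t ∈ Icc 0 T, ∀ x1, c ≤ marg (ψ t) x1 := by
  have hc : Continuous (fun z : ℝ × ℝ => avg1 (ψ (clp 0 T z.1)) z.2) := avg1_cont (K := fun t => ψ (clp 0 T t)) h.joint0
  obtain ⟨z, hz, hz'⟩ := ((isCompact_Icc (a := 0) (b := T)).prod (isCompact_Icc (a := (0:ℝ)) (b := 1))).exists_isMinOn
    ⟨(0, 0), ⟨⟨le_rfl, h.hT⟩, ⟨le_rfl, zero_le_one⟩⟩⟩ hc.continuousOn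
  refine ⟨_, h.mpos _ (Reg.clp_mem h.hT z.1) z.2, fun t ht x1 => ?_⟩
  have h1 := hz' (show (t, Int.fract x1) ∈ _ from ⟨ht, Int.fract_nonneg _, (Int.fract_lt_one _).le⟩)
  have h2 := avg1_per (h.good t ht).per (Int.fract x1) ⌊x1⌋
  rw [Int.fract_add_floor] at h2
  simp only [mem_ofPred_eq, Reg.clp_self ht] at h1
  change avg1 _ _ ≤ avg1 _ _
  rw [h2]; exact h1

/-- bounded, continuous and Lipschitz dependence -/
def LB {m : ℕ} (T : ℝ) (ψ : ℝ → Spc m → ℝ) (a : ℝ → Spc m → ℝ) : Prop :=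
  (∀ t ∈ Icc 0 T, Continuous (a t)) ∧ ∃ L : ℝ, 0 ≤ L ∧ ∀ t ∈ Icc 0 T, ∀ x, |a t x| ≤ L ∧ ∀ t' ∈ Icc 0 T, ∀ η : ℝ, 0 ≤ η →
    (∀ x, |ψ t' x - ψ t x| ≤ η ∧ ‖grd (ψ t') x - grd (ψ t) x‖ ≤ η) → |a t' x - a t x| ≤ L * η

lemma LB.add {a b : ℝ → Spc m → ℝ} (ha : LB T ψ a) (hb : LB T ψ b) : LB T ψ (fun t x => a t x + b t x) := by
  obtain ⟨ca, L, hL, h⟩ := ha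
  obtain ⟨cb, L', hL', h'⟩ := hb
  refine ⟨fun t ht => (ca t ht).add (cb t ht), L + L', by positivity, fun t ht x => ⟨?_, fun t' ht' η hη hh => ?_⟩⟩
  · exact (abs_add_le _ _).trans (add_le_add (h t ht x).1 (h' t ht x).1)
  · rw [show a t' x + b t' x - (a t x + b t x) = (a t' x - a t x) + (b t' x - b t x) by ring, add_mul]
    exact (abs_add_le _ _).trans (add_le_add ((h t ht x).2 t' ht' η hη hh) ((h' t ht x).2 t' ht' η hη hh))

lemma LB.mul {a b : ℝ → Spc m → ℝ} (ha : LB T ψ a) (hb : LB T ψ b) : LB T ψ (fun t x => a t x * b t x) := by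
  obtain ⟨ca, L, hL, h⟩ := ha
  obtain ⟨cb, L', hL', h'⟩ := hb
  refine ⟨fun t ht => (ca t ht).mul (cb t ht), 2 * (L * L'), by positivity, fun t ht x => ⟨?_, fun t' ht' η hη hh => ?_⟩⟩
  · rw [abs_mul]
    have := mul_le_mul (h t ht x).1 (h' t ht x).1 (abs_nonneg _) hL
    have : 0 ≤ L * L' := by positivity
    linarith
  · rw [show a t' x * b t' x - (a t x * b t x) = (a t' x - a t x) * b t' x + a t x * (b t' x - b t x) by ring]
    refine (abs_add_le _ _).trans ?_
    rw [abs_mul, abs_mul]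
    have h1 := mul_le_mul ((h t ht x).2 t' ht' η hη hh) (h' t' ht' x).1 (abs_nonneg _) (by positivity)
    have h2 := mul_le_mul (h t ht x).1 ((h' t ht x).2 t' ht' η hη hh) (abs_nonneg _) hL
    nlinarith

lemma LB.neg {a : ℝ → Spc m → ℝ} (ha : LB T ψ a) : LB T ψ (fun t x => - a t x) := by
  obtain ⟨ca, L, hL, h⟩ := ha
  refine ⟨fun t ht => (ca t ht).neg, L, hL, fun t ht x => ⟨?_, fun t' ht' η hη hh => ?_⟩⟩
  · rw [abs_neg]; exact (h t ht x).1
  · rw [← abs_neg, show - (-a t' x - -a t x) = a t' x - a t x by ring]; exact (h t ht x).2 t' ht' η hη hh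

lemma LB.const {k : Spc m → ℝ} (hk : Continuous k) (hp : PerE k) : LB T ψ (fun _ x => k x) := by
  obtain ⟨M, hM, hM'⟩ := per_bdd hp hk
  refine ⟨fun t ht => hk, M, hM, fun t ht x => ⟨hM' x, fun t' ht' η hη hh => ?_⟩⟩
  simp; positivity

lemma LB.sum {ι : Type*} (S : Finset ι) {a : ι → ℝ → Spc m → ℝ} (ha : ∀ i, LB T ψ (a i)) : LB T ψ (fun t x => ∑ i ∈ S, a i t x) := by
  classical
  induction S using Finset.induction_on with
  | empty => simpa using LB.const (T := T) (ψ := ψ) (k := fun _ => (0:ℝ)) continuous_const (fun _ _ _ => rfl)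
  | insert i S hi ih =>
    simp_rw [Finset.sum_insert hi]
    exact (ha i).add ih

lemma LB.inv {a : ℝ → Spc m → ℝ} (ha : LB T ψ a) {c : ℝ} (hc : 0 < c) (hac : ∀ t ∈ Icc 0 T, ∀ x, c ≤ a t x) : LB T ψ (fun t x => (a t x)⁻¹) := by
  obtain ⟨ca, L, hL, h⟩ := ha
  have hpos : ∀ t ∈ Icc 0 T, ∀ x, 0 < a t x := fun t ht x => hc.trans_le (hac t ht x)
  refine ⟨fun t ht => (ca t ht).inv₀ fun x => (hpos t ht x).ne', c⁻¹ + L * (c⁻¹ * c⁻¹), by positivity, fun t ht x => ⟨?_, fun t' ht' η hη hh => ?_⟩⟩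
  · have h0 := hpos t ht x
    rw [abs_of_pos (by positivity)]
    have : (a t x)⁻¹ ≤ c⁻¹ := inv_anti₀ hc (hac t ht x)
    have : 0 ≤ L * (c⁻¹ * c⁻¹) := by positivity
    linarith
  · have h0 := hpos t ht x
    have h0' := hpos t' ht' x
    have h1 : (a t x)⁻¹ ≤ c⁻¹ := inv_anti₀ hc (hac t ht x)
    have h2 : (a t' x)⁻¹ ≤ c⁻¹ := inv_anti₀ hc (hac t' ht' x)
    rw [show (a t' x)⁻¹ - (a t x)⁻¹ = -((a t' x - a t x) * ((a t x)⁻¹ * (a t' x)⁻¹)) by field_simp; ring, abs_neg, abs_mul,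
      abs_of_pos (show 0 < (a t x)⁻¹ * (a t' x)⁻¹ by positivity)]
    have h3 := mul_le_mul ((h t ht x).2 t' ht' η hη hh) (mul_le_mul h1 h2 (by positivity) (by positivity)) (by positivity) (by positivity)
    refine h3.trans ?_
    have : 0 ≤ c⁻¹ * η := by positivity
    nlinarith

lemma LB.avg {a : ℝ → Spc m → ℝ} (ha : LB T ψ a) : LB T ψ (fun t x => avg1 (a t) x.1) := by
  obtain ⟨ca, L, hL, h⟩ := ha
  refine ⟨fun t ht => ?_, L, hL, fun t ht x => ⟨avg1_le (fun x => (h t ht x).1) _, fun t' ht' η hη hh => ?_⟩⟩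
  · exact (avg1_cont (X := Unit) (K := fun _ => a t) ((ca t ht).comp continuous_snd)).comp (by fun_prop : Continuous fun x : Spc m => ((), x.1))
  · rw [avg1_sub (ca t' ht') (ca t ht)]
    exact avg1_le (fun x => (h t ht x).2 t' ht' η hη hh) _

lemma Reg.LBu (h : Reg s p T ψ) : LB T ψ ψ := by
  obtain ⟨M, hM, hM'⟩ := h.c1bd
  refine ⟨fun t ht => h.ucont ht, M + 1, by positivity, fun t ht x => ⟨by linarith [(hM' t ht x).1], fun t' ht' η hη hh => ?_⟩⟩
  have := (hh x).1
  nlinarith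

lemma Reg.LBpd (h : Reg s p T ψ) (v : Spc m) : LB T ψ (fun t => pd v (ψ t)) := by
  obtain ⟨M, hM, hM'⟩ := h.c1bd
  refine ⟨fun t ht => pd_cont (h.gcont ht) v, (M + 1) * ‖v‖, by positivity, fun t ht x => ⟨?_, fun t' ht' η hη hh => ?_⟩⟩
  · have h1 := (grd (ψ t) x).le_opNorm v
    have h2 : |pd v (ψ t) x| ≤ ‖grd (ψ t) x‖ * ‖v‖ := h1
    have := (hM' t ht x).2
    refine h2.trans ?_
    gcongr
    linarith
  · have h1 := (grd (ψ t') x - grd (ψ t) x).le_opNorm v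
    have h2 : |pd v (ψ t') x - pd v (ψ t) x| ≤ ‖grd (ψ t') x - grd (ψ t) x‖ * ‖v‖ := h1
    have := (hh x).2
    have h3 : ‖grd (ψ t') x - grd (ψ t) x‖ * ‖v‖ ≤ η * ‖v‖ := by gcongr
    have : 0 ≤ M * ‖v‖ * η := by positivity
    linarith

lemma LB.congr {a b : ℝ → Spc m → ℝ} (ha : LB T ψ a) (hab : ∀ t ∈ Icc 0 T, b t = a t) : LB T ψ b := by
  obtain ⟨ca, L, hL, h⟩ := ha
  refine ⟨fun t ht => by rw [hab t ht]; exact ca t ht, L, hL, fun t ht x => ⟨by rw [hab t ht]; exact (h t ht x).1, fun t' ht' η hη hh => ?_⟩⟩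
  rw [hab t ht, hab t' ht']; exact (h t ht x).2 t' ht' η hη hh

lemma Reg.FLB (h : Reg s p T ψ) (hV : ContDiff ℝ 2 V) (hVp : PerE V) : LB T ψ (fun t => Fop V (ψ t)) := by
  obtain ⟨c, hc, hc'⟩ := h.mlow
  have u := h.LBu
  have g := h.LBpd
  have v1 := fun w => LB.const (T := T) (ψ := ψ) (V_pd hV w).continuous (pd_per hVp w)
  have v2 := fun w => LB.const (T := T) (ψ := ψ) (V_pdpd hV w w) (pd_per (pd_per hVp w) w)
  have D := u.avg
  have Di := D.inv hc (fun t ht x => hc' t ht x.1)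
  have N := ((v1 (e1 m)).mul u).avg
  have N' := (((v1 (e1 m)).mul (g (e1 m))).add (u.mul (v2 (e1 m)))).avg
  have D' := (g (e1 m)).avg
  have gd := ((v1 (e1 m)).mul (g (e1 m))).add (LB.sum Finset.univ fun i => (v1 (eC m i)).mul (g (eC m i)))
  have lp := (v2 (e1 m)).add (LB.sum Finset.univ fun i => v2 (eC m i))
  have tot := (gd.add (lp.mul u)).add (((((N'.mul D).add (N.mul D').neg).mul (Di.mul Di)).mul u).add ((N.mul Di).mul (g (e1 m)))).neg
  refine tot.congr fun t ht => ?_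
  ext x
  rw [Fop_formula hV (h.good t ht).diff (h.gcont ht) x (h.mpos t ht _), gradDot, lap]
  have e1' : Nd V (ψ t) = fun x => pd (e1 m) V x * pd (e1 m) (ψ t) x + ψ t x * pd (e1 m) (pd (e1 m) V) x := rfl
  have e2' : Nn V (ψ t) = fun x => pd (e1 m) V x * ψ t x := rfl
  rw [← e1', ← e2']
  have hne := (h.mpos t ht x.1).ne'
  change avg1 (ψ t) x.1 ≠ 0 at hne
  field_simp
  ring
end



section
variable {m : ℕ} {s p : ℝ}

lemma jen_swap {α : Type*} [MeasurableSpace α] (ν : Measure α) [SFinite ν] (hp : 1 < p)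
    {Φ : α → Spc m → ℝ≥0∞} (hΦ : Measurable (Function.uncurry Φ)) :
    ∫⁻ x in cube m, (∫⁻ a, Φ a x ∂ν) ^ p ≤
      (ν univ) ^ (p - 1) * ∫⁻ a, (∫⁻ x in cube m, Φ a x ^ p) ∂ν := by
  have h1 : ∀ x, (∫⁻ a, Φ a x ∂ν) ^ p ≤ (ν univ) ^ (p - 1) * ∫⁻ a, Φ a x ^ p ∂ν := fun x =>
    jensen_pow ν hp (hΦ.comp (measurable_id.prodMk measurable_const)).aemeasurable
  have hm : Measurable (fun z : Spc m × α => Φ z.2 z.1 ^ p) :=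
    (hΦ.comp measurable_swap).pow_const p
  have hm2 : Measurable (fun x : Spc m => ∫⁻ a, Φ a x ^ p ∂ν) := hm.lintegral_prod_right'
  refine (lintegral_mono h1).trans ?_
  rw [lintegral_const_mul _ hm2, lintegral_lintegral_swap hm.aemeasurable]

lemma line_ftc {u : Spc m → ℝ} (hd : Differentiable ℝ u) (hc : Continuous (grd u)) (x z : Spc m)
    (a b : ℝ) : ∫ r in a..b, grd u (x + r • z) z = u (x + b • z) - u (x + a • z) := by
  apply intervalIntegral.integral_eq_sub_of_hasDerivAt (f := fun r => u (x + r • z))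
  · intro r _
    have h1 : HasDerivAt (fun r : ℝ => x + r • z) z r := by
      simpa using ((hasDerivAt_id r).smul_const z).const_add x
    exact (hd (x + r • z)).hasFDerivAt.comp_hasDerivAt r h1
  · apply Continuous.intervalIntegrable
    fun_prop

lemma line_le {u : Spc m → ℝ} (hd : Differentiable ℝ u) (hc : Continuous (grd u)) (x h : Spc m) :
    ‖u (x + h) - u x‖ₑ ≤ ∫⁻ r in Ioc (0:ℝ) 1, ‖h‖ₑ * ‖grd u (x + r • h)‖ₑ := by
  have h1 := line_ftc hd hc x h 0 1
  rw [one_smul, zero_smul, add_zero, intervalIntegral.integral_of_le zero_le_one] at h1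
  rw [← h1]
  refine (enorm_integral_le_lintegral_enorm _).trans (lintegral_mono fun r => ?_)
  rw [mul_comm]
  exact ContinuousLinearMap.le_opENorm _ _

lemma line_le2 {u : Spc m → ℝ} (hd : Differentiable ℝ u) (hc : Continuous (grd u)) (x h : Spc m) :
    ‖grd u x h‖ₑ ≤ ‖u (x + h) - u x‖ₑ + ∫⁻ r in Ioc (0:ℝ) 1, ‖h‖ₑ * ‖grd u (x + r • h) - grd u x‖ₑ := by
  have h1 := line_ftc hd hc x h 0 1
  have h2 : ∫ r in (0:ℝ)..1, (grd u (x + r • h) - grd u x) h = u (x + h) - u x - grd u x h := by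
    simp only [sub_apply]
    rw [intervalIntegral.integral_sub, h1]
    · simp
    · apply Continuous.intervalIntegrable; fun_prop
    · apply Continuous.intervalIntegrable; fun_prop
  rw [intervalIntegral.integral_of_le zero_le_one] at h2
  have h3 : grd u x h = (u (x + h) - u x) - ∫ r in Ioc (0:ℝ) 1, (grd u (x + r • h) - grd u x) h := by
    rw [h2]; ring
  rw [h3]
  refine enorm_sub_le.trans (add_le_add le_rfl ?_)
  refine (enorm_integral_le_lintegral_enorm _).trans (lintegral_mono fun r => ?_)
  rw [mul_comm]
  exact ContinuousLinearMap.le_opENorm _ _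

lemma tr_u (hp : 1 < p) {u : Spc m → ℝ} (hper : PerE u) (hd : Differentiable ℝ u)
    (hc : Continuous (grd u)) (h : Spc m) :
    ∫⁻ x in cube m, ‖u (x + h) - u x‖ₑ ^ p ≤ ‖h‖ₑ ^ p * En1 p u := by
  refine (lintegral_mono fun x => ENNReal.rpow_le_rpow (line_le hd hc x h) (by linarith)).trans ?_
  refine (jen_swap (volume.restrict (Ioc (0:ℝ) 1)) hp
    (Φ := fun r x => ‖h‖ₑ * ‖grd u (x + r • h)‖ₑ) ?_).trans ?_
  · apply Continuous.measurable
    apply ENNReal.continuous_const_mul (by simp) |>.comp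
    exact (hc.comp (by fun_prop)).enorm
  · have : ∀ r : ℝ, ∫⁻ x in cube m, (‖h‖ₑ * ‖grd u (x + r • h)‖ₑ) ^ p = ‖h‖ₑ ^ p * En1 p u := by
      intro r
      simp_rw [ENNReal.mul_rpow_of_nonneg _ _ (by linarith : 0 ≤ p)]
      rw [lintegral_const_mul' _ _ (by finiteness)]
      congr 1
      exact lint_per (perE_enorm (perE_grd hper) p) (r • h)
    simp [this]

lemma tr_g (hp : 1 < p) (hs : 0 < s) (hγ : 0 < s - ((m : ℝ) + 1) / p) {u : Spc m → ℝ}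
    (hu : Good s p u) {r : ℝ} (hr : 0 < r) {h : Spc m} (hh : ‖h‖ ≤ r) :
    ∫⁻ x in cube m, ‖grd u x h‖ₑ ^ p ≤ 2 ^ (p - 1) * (2 ^ p * En0 p u +
      ENNReal.ofReal (r ^ p) * (ENNReal.ofReal (KA m s p * r ^ (s * p)) * (En1 p u + Eng s p u))) := by
  have hc := grd_cont hp hs hγ hu
  have hd := hu.diff
  have hp0 : 0 < p := by linarith
  have hm1 : Measurable (Function.uncurry fun (r:ℝ) (x : Spc m) => ‖h‖ₑ * ‖grd u (x + r • h) - grd u x‖ₑ) := by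
    apply Continuous.measurable
    apply ENNReal.continuous_const_mul (by simp) |>.comp
    exact ((hc.comp (by fun_prop)).sub (hc.comp (by fun_prop))).enorm
  have hm2 : Measurable (fun x => ∫⁻ r in Ioc (0:ℝ) 1, ‖h‖ₑ * ‖grd u (x + r • h) - grd u x‖ₑ) := 
    hm1.lintegral_prod_left'
  calc _ ≤ ∫⁻ x in cube m, 2 ^ (p - 1) * (‖u (x + h) - u x‖ₑ ^ p + 
      (∫⁻ r in Ioc (0:ℝ) 1, ‖h‖ₑ * ‖grd u (x + r • h) - grd u x‖ₑ) ^ p) := by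
        refine lintegral_mono fun x => ?_
        exact (ENNReal.rpow_le_rpow (line_le2 hd hc x h) hp0.le).trans 
          (ENNReal.rpow_add_le_mul_rpow_add_rpow _ _ hp.le)
    _ = 2 ^ (p - 1) * ((∫⁻ x in cube m, ‖u (x + h) - u x‖ₑ ^ p) + ∫⁻ x in cube m,
      (∫⁻ r in Ioc (0:ℝ) 1, ‖h‖ₑ * ‖grd u (x + r • h) - grd u x‖ₑ) ^ p) := by
        rw [lintegral_const_mul' _ _ (by finiteness), lintegral_add_right _ (hm2.pow_const p)]
    _ ≤ _ := by
      refine mul_le_mul' le_rfl (add_le_add ?_ ?_)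
      · exact trans_triv hp hu.per hd.continuous.stronglyMeasurable h
      · refine (jen_swap (volume.restrict (Ioc (0:ℝ) 1)) hp hm1).trans ?_
        have : ∀ q ∈ Ioc (0:ℝ) 1, ∫⁻ x in cube m, (‖h‖ₑ * ‖grd u (x + q • h) - grd u x‖ₑ) ^ p ≤
            ENNReal.ofReal (r ^ p) * (ENNReal.ofReal (KA m s p * r ^ (s * p)) * (En1 p u + Eng s p u)) := by
          intro q hq
          simp_rw [ENNReal.mul_rpow_of_nonneg _ _ hp0.le]
          rw [lintegral_const_mul' _ _ (by finiteness)]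
          refine mul_le_mul' ?_ (trans_all hp hs hγ hu hr ?_)
          · rw [← ofReal_norm, ENNReal.ofReal_rpow_of_nonneg (norm_nonneg _) hp0.le]
            gcongr
          · rw [norm_smul, Real.norm_of_nonneg hq.1.le]
            nlinarith [norm_nonneg h, hq.1, hq.2]
        refine (mul_le_mul' le_rfl (setLIntegral_mono' measurableSet_Ioc this)).trans ?_
        simp

/-- radial kernel -/
def rker (m : ℕ) (q κ δ : ℝ) (h : Spc m) : ℝ≥0∞ :=
  ENNReal.ofReal (min ((‖h‖ / δ) ^ q) 1 * (‖h‖ ^ ((m:ℝ) + 1 + κ))⁻¹)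

lemma rker_meas (m : ℕ) (q κ δ : ℝ) : Measurable (rker m q κ δ) := by
  unfold rker
  fun_prop

def RR (m : ℕ) (q κ : ℝ) : ℝ≥0∞ := ∫⁻ h : Spc m, rker m q κ 1 h

lemma RR_fin (m : ℕ) {q κ : ℝ} (hκ : 0 < κ) (hq : κ < q) : RR m q κ ≠ ⊤ := by
  have h1 : Integrable (fun h : Spc m => (fun t : ℝ => min (t ^ q) 1 * (t ^ ((m:ℝ) + 1 + κ))⁻¹) ‖h‖) := by
    refine (integrable_fun_norm_addHaar (volume : Measure (Spc m)) (f := fun t : ℝ => min (t ^ q) 1 * (t ^ ((m:ℝ) + 1 + κ))⁻¹)).2 ?_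
    rw [finrank_spc]
    simp only [add_tsub_cancel_right, smul_eq_mul]
    rw [← Ioc_union_Ioi_eq_Ioi (zero_le_one' ℝ)]
    apply IntegrableOn.union
    · have h2 : IntegrableOn (fun t : ℝ => t ^ (q - κ - 1)) (Ioc 0 1) := by
        rw [← intervalIntegrable_iff_integrableOn_Ioc_of_le zero_le_one]
        exact intervalIntegral.intervalIntegrable_rpow' (by linarith)
      refine h2.congr_fun ?_ measurableSet_Ioc
      intro t ht
      have : t ^ q ≤ 1 := Real.rpow_le_one ht.1.le ht.2 (by linarith)
      simp only
      rw [min_eq_left this, ← Real.rpow_neg ht.1.le, ← Real.rpow_natCast, ← Real.rpow_add ht.1,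
        ← Real.rpow_add ht.1]
      congr 1; ring
    · have h2 : IntegrableOn (fun t : ℝ => t ^ (- κ - 1)) (Ioi 1) := by
        exact integrableOn_Ioi_rpow_of_lt (by linarith) one_pos
      refine h2.congr_fun ?_ measurableSet_Ioi
      intro t ht
      have ht0 : 0 < t := one_pos.trans ht
      have : 1 ≤ t ^ q := Real.one_le_rpow (le_of_lt ht) (by linarith)
      simp only
      rw [min_eq_right this, one_mul, ← Real.rpow_neg ht0.le, ← Real.rpow_natCast, ← Real.rpow_add ht0]
      congr 1; ring
  unfold RR rker
  simp only [div_one]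
  exact (h1.lintegral_lt_top).ne

lemma RR_scale (m : ℕ) {q κ δ : ℝ} (hδ : 0 < δ) : 
    ∫⁻ h : Spc m, rker m q κ δ h = ENNReal.ofReal (δ ^ (-κ)) * RR m q κ := by
  have h1 : ∀ h : Spc m, rker m q κ δ h = ENNReal.ofReal (δ ^ (-((m:ℝ) + 1 + κ))) * rker m q κ 1 (δ⁻¹ • h) := by
    intro h
    unfold rker
    rw [← ENNReal.ofReal_mul (by positivity)]
    congr 1
    rw [norm_smul, norm_inv, Real.norm_of_nonneg hδ.le, div_one, inv_mul_eq_div, 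
      Real.div_rpow (norm_nonneg _) hδ.le _, Real.rpow_neg hδ.le, Real.div_rpow (norm_nonneg _) hδ.le, inv_div]
    have : δ ^ ((m:ℝ) + 1 + κ) ≠ 0 := by positivity
    field_simp
  simp_rw [h1]
  rw [lintegral_const_mul' _ _ (by finiteness)]
  have h2 : ∫⁻ h : Spc m, rker m q κ 1 (δ⁻¹ • h) = ∫⁻ h, rker m q κ 1 h ∂(Measure.map (δ⁻¹ • ·) volume) := by
    rw [lintegral_map (rker_meas _ _ _ _) (measurable_const_smul _)]
  rw [h2, Measure.map_addHaar_smul _ (inv_ne_zero hδ.ne'), lintegral_smul_measure, finrank_spc, smul_eq_mul, 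
    ← mul_assoc, ← ENNReal.ofReal_mul (by positivity)]
  unfold RR
  congr 2
  rw [abs_of_pos (by positivity), inv_pow, inv_inv, ← Real.rpow_natCast, ← Real.rpow_add hδ]
  congr 1; push_cast; ring

lemma kg_int_le {E : Type*} [NormedAddCommGroup E] (hp : 1 < p) {v : Spc m → E} 
    (hv : StronglyMeasurable v) {θ q δ : ℝ} (hδ : 0 < δ) {B : ℝ≥0∞}
    (hB : ∀ h : Spc m, ∫⁻ x in cube m, ‖v (x + h) - v x‖ₑ ^ p ≤ B * ENNReal.ofReal (min ((‖h‖ / δ) ^ q) 1)) :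
    ∫⁻ x in cube m, ∫⁻ y in cube m, kg θ p v x y ≤ B * (ENNReal.ofReal (δ ^ (-(θ * p))) * RR m q (θ * p)) := by
  have hm : Measurable (fun z : Spc m × Spc m => kg θ p v z.1 z.2) := meas_kg hv θ p
  have hk : ∀ x h : Spc m, kg θ p v x (x + h) = ‖v (x + h) - v x‖ₑ ^ p * ENNReal.ofReal ((‖h‖ ^ ((m:ℝ) + 1 + θ * p))⁻¹) := by
    intro x h
    rw [kg_eq hp, enorm_sub_rev]; simp
  calc _ ≤ ∫⁻ x in cube m, ∫⁻ y, kg θ p v x y := lintegral_mono fun x => setLIntegral_le_lintegral _ _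
    _ = ∫⁻ x in cube m, ∫⁻ h, kg θ p v x (x + h) := by
      congr 1; ext x
      exact (lintegral_add_left_eq_self (fun y => kg θ p v x y) x).symm
    _ = ∫⁻ h, ∫⁻ x in cube m, kg θ p v x (x + h) := by
      apply lintegral_lintegral_swap
      exact (hm.comp (measurable_fst.prodMk (measurable_fst.add measurable_snd))).aemeasurable
    _ ≤ ∫⁻ h, B * rker m q (θ * p) δ h := by
      refine lintegral_mono fun h => ?_
      simp_rw [hk]
      rw [lintegral_mul_const' _ _ (by finiteness)]
      refine (mul_le_mul' (hB h) le_rfl).trans_eq ?_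
      rw [mul_assoc, ← ENNReal.ofReal_mul (by positivity)]
      rfl
    _ = _ := by
      rw [lintegral_const_mul _ (rker_meas _ _ _ _), RR_scale _ hδ]
end



section
variable {m : ℕ} {s p : ℝ}

/-- directions -/
def dirs (m : ℕ) : Option (Fin m) → Spc m := fun o => o.elim (e1 m) (eC m)

lemma dirs_norm (o : Option (Fin m)) : ‖dirs m o‖ ≤ 1 := by
  rw [norm_spc_le zero_le_one]
  cases o with
  | none => simp [dirs, e1]
  | some i =>
    simp only [dirs, eC, Option.elim]
    refine ⟨by simp, fun j => ?_⟩
    by_cases h : j = i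
    · subst h; simp
    · simp [h]

lemma clm_enorm_le (L : Spc m →L[ℝ] ℝ) : ‖L‖ₑ ≤ ∑ o, ‖L (dirs m o)‖ₑ := by
  have h : ‖L‖ ≤ ∑ o, ‖L (dirs m o)‖ := by
    apply ContinuousLinearMap.opNorm_le_bound _ (by positivity)
    intro x
    have hx : x = x.1 • e1 m + ∑ i, x.2 i • eC m i := by
      ext i
      · simp [e1, eC, Prod.fst_sum]
      · simp [e1, eC, Prod.snd_sum, Pi.single_apply]
    have hn := (norm_spc_le (norm_nonneg x)).1 le_rfl
    conv_lhs => rw [hx]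
    rw [map_add, map_sum, Fintype.sum_option, add_mul, Finset.sum_mul]
    simp only [map_smul, dirs, Option.elim]
    refine (norm_add_le _ _).trans (add_le_add ?_ ((norm_sum_le _ _).trans (Finset.sum_le_sum fun i _ => ?_)))
    · rw [norm_smul, mul_comm]; gcongr; exact hn.1
    · rw [norm_smul, mul_comm]; gcongr; exact hn.2 i
  rw [← ofReal_norm]
  refine (ENNReal.ofReal_le_ofReal h).trans_eq ?_
  rw [ENNReal.ofReal_sum_of_nonneg (fun _ _ => norm_nonneg _)]
  simp only [ofReal_norm]

lemma clm_pow_le (hp : 1 < p) (L : Spc m →L[ℝ] ℝ) :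
    ‖L‖ₑ ^ p ≤ ((m + 1 : ℕ) : ℝ≥0∞) ^ (p - 1) * ∑ o, ‖L (dirs m o)‖ₑ ^ p := by
  letI : MeasurableSpace (Option (Fin m)) := ⊤
  have h := jensen_pow (Measure.count : Measure (Option (Fin m))) hp (f := fun o => ‖L (dirs m o)‖ₑ)
    (measurable_from_top).aemeasurable
  rw [lintegral_count, lintegral_count, tsum_fintype, tsum_fintype, Measure.count_univ] at h
  refine (ENNReal.rpow_le_rpow (clm_enorm_le L) (by linarith)).trans (h.trans_eq ?_)
  simp

lemma ofReal_rpow_add {δ : ℝ} (hδ : 0 < δ) {a b c : ℝ} (h : c = a + b) :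
    ENNReal.ofReal (δ ^ c) = ENNReal.ofReal (δ ^ a) * ENNReal.ofReal (δ ^ b) := by
  rw [← ENNReal.ofReal_mul (by positivity), ← Real.rpow_add hδ, h]

lemma en1_interp (hp : 1 < p) (hs : 0 < s) (hγ : 0 < s - ((m : ℝ) + 1) / p) :
    ∃ C : ℝ≥0∞, C ≠ ⊤ ∧ ∀ u : Spc m → ℝ, Good s p u → ∀ δ : ℝ, 0 < δ → ∀ X : ℝ≥0∞,
      En0 p u ≤ X * ENNReal.ofReal (δ ^ ((1 + s) * p)) → ET s p u ≤ X →
      En1 p u ≤ C * X * ENNReal.ofReal (δ ^ (s * p)) := by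
  refine ⟨((m + 1 : ℕ) : ℝ≥0∞) ^ (p - 1) * (((m + 1 : ℕ) : ℝ≥0∞) * (2 ^ (p - 1) * (2 ^ p + ENNReal.ofReal (KA m s p)))),
    ?_, fun u hu δ hδ X h0 hE => ?_⟩
  · have : ((m + 1 : ℕ) : ℝ≥0∞) ^ (p - 1) ≠ ⊤ := ENNReal.rpow_ne_top_of_nonneg (by linarith) (by simp)
    have : ((m + 1 : ℕ) : ℝ≥0∞) ≠ ⊤ := by simp
    finiteness
  have hp0 : 0 < p := by linarith
  have hc := grd_cont hp hs hγ hu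
  have hE' : En1 p u + Eng s p u ≤ X := le_add_self.trans hE
  have key : ∀ o, ∫⁻ x in cube m, ‖grd u x (dirs m o)‖ₑ ^ p ≤
      2 ^ (p - 1) * (2 ^ p + ENNReal.ofReal (KA m s p)) * X * ENNReal.ofReal (δ ^ (s * p)) := by
    intro o
    have h1 := tr_g hp hs hγ hu hδ (h := δ • dirs m o) (by
      rw [norm_smul, Real.norm_of_nonneg hδ.le]; nlinarith [dirs_norm o])
    have h2 : ∀ x, ‖grd u x (δ • dirs m o)‖ₑ ^ p = ENNReal.ofReal (δ ^ p) * ‖grd u x (dirs m o)‖ₑ ^ p := by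
      intro x
      rw [map_smul, enorm_smul, ENNReal.mul_rpow_of_nonneg _ _ hp0.le, ← ofReal_norm, Real.norm_of_nonneg hδ.le,
        ENNReal.ofReal_rpow_of_nonneg hδ.le hp0.le]
    simp_rw [h2] at h1
    rw [lintegral_const_mul' _ _ (by finiteness)] at h1
    have hne : ENNReal.ofReal (δ ^ p) ≠ 0 := by
      simp only [ne_eq, ENNReal.ofReal_eq_zero, not_le]; positivity
    rw [← ENNReal.mul_le_mul_iff_right hne (by finiteness)]
    refine h1.trans ?_
    calc _ ≤ 2 ^ (p - 1) * (2 ^ p * (X * ENNReal.ofReal (δ ^ ((1 + s) * p))) + ENNReal.ofReal (δ ^ p) *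
          (ENNReal.ofReal (KA m s p * δ ^ (s * p)) * X)) := by
            gcongr
      _ = _ := by
        rw [ofReal_rpow_add hδ (show (1 + s) * p = p + s * p by ring), ENNReal.ofReal_mul (KA_nonneg hγ)]
        ring
  calc En1 p u ≤ ∫⁻ x in cube m, ((m + 1 : ℕ) : ℝ≥0∞) ^ (p - 1) * ∑ o, ‖grd u x (dirs m o)‖ₑ ^ p :=
        lintegral_mono fun x => clm_pow_le hp _
    _ = ((m + 1 : ℕ) : ℝ≥0∞) ^ (p - 1) * ∑ o, ∫⁻ x in cube m, ‖grd u x (dirs m o)‖ₑ ^ p := by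
      rw [lintegral_const_mul' _ _ (ENNReal.rpow_ne_top_of_nonneg (by linarith) (by simp)), lintegral_finsetSum]
      intro o _
      apply Measurable.pow_const
      exact (hc.clm_apply continuous_const).enorm.measurable
    _ ≤ ((m + 1 : ℕ) : ℝ≥0∞) ^ (p - 1) * ∑ o : Option (Fin m), 2 ^ (p - 1) * (2 ^ p + ENNReal.ofReal (KA m s p)) * X * ENNReal.ofReal (δ ^ (s * p)) := by
      gcongr with o; exact key o
    _ = _ := by
      simp only [Finset.sum_const, Finset.card_univ, Fintype.card_option, Fintype.card_fin, nsmul_eq_mul]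
      ring

lemma min_comb {X : ℝ≥0∞} {a b : ℝ≥0∞} {r : ℝ} (h1 : X ≤ a * ENNReal.ofReal r) (h2 : X ≤ b) :
    X ≤ (a + b) * ENNReal.ofReal (min r 1) := by
  rcases le_total r 1 with h | h
  · rw [min_eq_left h]; exact h1.trans (mul_le_mul' le_self_add le_rfl)
  · rw [min_eq_right h]; simp only [ENNReal.ofReal_one, mul_one]; exact h2.trans le_add_self

lemma eng0_interp (hp : 1 < p) (hs : 0 < s) (hγ : 0 < s - ((m : ℝ) + 1) / p) {τ : ℝ} (hτ : 0 < τ) (hτ1 : τ < 1) :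
    ∃ C : ℝ≥0∞, C ≠ ⊤ ∧ ∀ u : Spc m → ℝ, Good s p u → ∀ δ : ℝ, 0 < δ → ∀ X : ℝ≥0∞,
      En0 p u ≤ X * ENNReal.ofReal (δ ^ ((1 + s) * p)) → ET s p u ≤ X →
      ∫⁻ x in cube m, ∫⁻ y in cube m, kg τ p u x y ≤ C * X * ENNReal.ofReal (δ ^ ((1 + s - τ) * p)) := by
  obtain ⟨C, hC, hC'⟩ := en1_interp (m := m) hp hs hγ
  have hp0 : 0 < p := by linarith
  have hR := RR_fin m (κ := τ * p) (q := p) (by positivity) (by nlinarith)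
  refine ⟨(C + 2 ^ p) * RR m p (τ * p), by finiteness, fun u hu δ hδ X h0 hE => ?_⟩
  have hc := grd_cont hp hs hγ hu
  refine (kg_int_le hp hu.diff.continuous.stronglyMeasurable (θ := τ) (q := p) hδ
    (B := (C + 2 ^ p) * X * ENNReal.ofReal (δ ^ ((1 + s) * p))) fun h => ?_).trans_eq ?_
  · rw [add_mul, add_mul]
    apply min_comb
    · refine (tr_u hp hu.per hu.diff hc h).trans ((mul_le_mul' le_rfl (hC' u hu δ hδ X h0 hE)).trans_eq ?_)
      rw [ofReal_rpow_add hδ (show (1 + s) * p = p + s * p by ring), Real.div_rpow (norm_nonneg _) hδ.le,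
        ENNReal.ofReal_div_of_pos (by positivity), ← ofReal_norm, ENNReal.ofReal_rpow_of_nonneg (norm_nonneg _) hp0.le]
      have hne : ENNReal.ofReal (δ ^ p) ≠ 0 := by
        simp only [ne_eq, ENNReal.ofReal_eq_zero, not_le]; positivity
      rw [div_eq_mul_inv]
      calc _ = (ENNReal.ofReal (δ ^ p) * (ENNReal.ofReal (δ ^ p))⁻¹) * (ENNReal.ofReal (‖h‖ ^ p) * (C * X * ENNReal.ofReal (δ ^ (s * p)))) := by
            rw [ENNReal.mul_inv_cancel hne (by finiteness), one_mul]
        _ = _ := by ring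
    · refine (trans_triv hp hu.per hu.diff.continuous.stronglyMeasurable h).trans ?_
      rw [mul_assoc]
      exact mul_le_mul' le_rfl h0
  · rw [ofReal_rpow_add hδ (show (1 + s - τ) * p = (1 + s) * p + (-(τ * p)) by ring)]
    ring

lemma eng1_interp (hp : 1 < p) (hs : 0 < s) (hγ : 0 < s - ((m : ℝ) + 1) / p) {θ : ℝ} (hθ : 0 < θ) (hθs : θ < s) :
    ∃ C : ℝ≥0∞, C ≠ ⊤ ∧ ∀ u : Spc m → ℝ, Good s p u → ∀ δ : ℝ, 0 < δ → ∀ X : ℝ≥0∞,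
      En0 p u ≤ X * ENNReal.ofReal (δ ^ ((1 + s) * p)) → ET s p u ≤ X →
      Eng θ p u ≤ C * X * ENNReal.ofReal (δ ^ ((s - θ) * p)) := by
  obtain ⟨C, hC, hC'⟩ := en1_interp (m := m) hp hs hγ
  have hp0 : 0 < p := by linarith
  have hR := RR_fin m (κ := θ * p) (q := s * p) (by positivity) (by nlinarith)
  refine ⟨(ENNReal.ofReal (KA m s p) + 2 ^ p * C) * RR m (s * p) (θ * p), by finiteness, fun u hu δ hδ X h0 hE => ?_⟩
  have hE' : En1 p u + Eng s p u ≤ X := le_add_self.trans hE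
  refine (kg_int_le hp (grd_sm u) (θ := θ) (q := s * p) hδ
    (B := (ENNReal.ofReal (KA m s p) + 2 ^ p * C) * X * ENNReal.ofReal (δ ^ (s * p))) fun h => ?_).trans_eq ?_
  · rw [add_mul, add_mul]
    apply min_comb
    · rcases eq_or_ne h 0 with rfl | hh
      · have h00 : ∀ x, ‖grd u (x + 0) - grd u x‖ₑ ^ p = 0 := by
          intro x; rw [add_zero, sub_self, ← ofReal_norm, norm_zero, ENNReal.ofReal_zero, ENNReal.zero_rpow_of_pos hp0]
        simp_rw [h00]; simp
      · have hh' : 0 < ‖h‖ := norm_pos_iff.2 hh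
        refine (trans_all hp hs hγ hu hh' le_rfl).trans ((mul_le_mul' le_rfl hE').trans_eq ?_)
        rw [mul_assoc, ← ENNReal.ofReal_mul (by positivity), Real.div_rpow (norm_nonneg _) hδ.le,
          mul_div_cancel₀ _ (by positivity), ENNReal.ofReal_mul (KA_nonneg hγ)]
        ring
    · refine (trans_triv hp (perE_grd hu.per) (grd_sm u) h).trans ?_
      rw [mul_assoc, mul_assoc, ← mul_assoc C]
      exact mul_le_mul' le_rfl (hC' u hu δ hδ X h0 hE)
  · rw [ofReal_rpow_add hδ (show (s - θ) * p = s * p + (-(θ * p)) by ring)]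
    ring

lemma lower_pow {δ D a b : ℝ} (hδ : 0 < δ) (hD : δ ≤ D) (hab : b ≤ a) :
    ENNReal.ofReal (δ ^ a) ≤ ENNReal.ofReal (D ^ (a - b)) * ENNReal.ofReal (δ ^ b) := by
  rw [ofReal_rpow_add hδ (show a = (a - b) + b by ring)]
  gcongr

/-- Interpolated energies. -/
lemma ET_interp (hp : 1 < p) (hs : 0 < s) (hγ : 0 < s - ((m : ℝ) + 1) / p) {θ : ℝ} (hθ : 0 < θ) (hθs : θ < s) (D : ℝ) :
    ∃ C : ℝ≥0∞, C ≠ ⊤ ∧ ∀ u : Spc m → ℝ, Good s p u → ∀ δ : ℝ, 0 < δ → δ ≤ D → ∀ X : ℝ≥0∞,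
      En0 p u ≤ X * ENNReal.ofReal (δ ^ ((1 + s) * p)) → ET s p u ≤ X →
      ET θ p u ≤ C * X * ENNReal.ofReal (δ ^ ((s - θ) * p)) := by
  obtain ⟨C1, hC1, hC1'⟩ := en1_interp (m := m) hp hs hγ
  obtain ⟨C2, hC2, hC2'⟩ := eng1_interp (m := m) hp hs hγ hθ hθs
  have hp0 : 0 < p := by linarith
  refine ⟨ENNReal.ofReal (D ^ ((1 + s) * p - (s - θ) * p)) + (C1 * ENNReal.ofReal (D ^ (s * p - (s - θ) * p)) + C2), by finiteness,
    fun u hu δ hδ hD X h0 hE => ?_⟩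
  unfold ET
  have a1 := hC1' u hu δ hδ X h0 hE
  have a2 := hC2' u hu δ hδ X h0 hE
  have b0 := lower_pow hδ hD (show (s - θ) * p ≤ (1 + s) * p by nlinarith)
  have b1 := lower_pow hδ hD (show (s - θ) * p ≤ s * p by nlinarith)
  calc _ ≤ X * (ENNReal.ofReal (D ^ ((1 + s) * p - (s - θ) * p)) * ENNReal.ofReal (δ ^ ((s - θ) * p))) +
      (C1 * X * (ENNReal.ofReal (D ^ (s * p - (s - θ) * p)) * ENNReal.ofReal (δ ^ ((s - θ) * p))) +
       C2 * X * ENNReal.ofReal (δ ^ ((s - θ) * p))) :=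
        add_le_add (h0.trans (mul_le_mul' le_rfl b0)) (add_le_add (a1.trans (mul_le_mul' le_rfl b1)) a2)
    _ = _ := by ring

lemma root_le (hp : 1 < p) {Y C X : ℝ≥0∞} {δ a : ℝ} (hδ : 0 < δ) (h : Y ≤ C * X * ENNReal.ofReal (δ ^ (a * p))) :
    Y ^ (1 / p) ≤ C ^ (1 / p) * (X ^ (1 / p) * ENNReal.ofReal (δ ^ a)) := by
  have hp0 : 0 < p := by linarith
  refine (ENNReal.rpow_le_rpow h (by positivity)).trans_eq ?_
  rw [ENNReal.mul_rpow_of_nonneg _ _ (by positivity), ENNReal.mul_rpow_of_nonneg _ _ (by positivity),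
    ENNReal.ofReal_rpow_of_nonneg (by positivity) (by positivity), ← Real.rpow_mul hδ.le,
    show a * p * (1 / p) = a by field_simp]
  ring

lemma W_interp (hp : 1 < p) (hs : 0 < s) (hs1 : s < 1) (hγ : 0 < s - ((m : ℝ) + 1) / p) {τ : ℝ} (hτ : 0 ≤ τ) (hτs : τ < 1 + s) (D : ℝ) :
    ∃ C : ℝ≥0∞, C ≠ ⊤ ∧ ∀ u : Spc m → ℝ, Good s p u → ∀ δ : ℝ, 0 < δ → δ ≤ D → ∀ X : ℝ≥0∞,
      En0 p u ≤ X * ENNReal.ofReal (δ ^ ((1 + s) * p)) → ET s p u ≤ X →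
      WNorm τ p u ≤ C * (X ^ (1 / p) * ENNReal.ofReal (δ ^ (1 + s - τ))) := by
  have hp0 : 0 < p := by linarith
  have hp1 : 0 ≤ 1 / p := by positivity
  obtain ⟨C1, hC1, hC1'⟩ := en1_interp (m := m) hp hs hγ
  have b0 : ∀ u : Spc m → ℝ, ∀ δ : ℝ, 0 < δ → δ ≤ D → ∀ X : ℝ≥0∞,
      En0 p u ≤ X * ENNReal.ofReal (δ ^ ((1 + s) * p)) → LpN p u ≤ 
        ENNReal.ofReal (D ^ ((1 + s) * p - (1 + s - τ) * p)) ^ (1 / p) * (X ^ (1 / p) * ENNReal.ofReal (δ ^ (1 + s - τ))) := by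
    intro u δ hδ hD X h0
    rw [LpN_eq hp]
    apply root_le hp hδ
    refine h0.trans ((mul_le_mul' le_rfl (lower_pow hδ hD (show (1 + s - τ) * p ≤ (1 + s) * p by nlinarith))).trans_eq ?_)
    ring
  rcases le_or_gt τ 0 with h | h
  · refine ⟨ENNReal.ofReal (D ^ ((1 + s) * p - (1 + s - τ) * p)) ^ (1 / p), by finiteness, fun u hu δ hδ hD X h0 hE => ?_⟩
    unfold WNorm; rw [if_pos h]; exact b0 u δ hδ hD X h0
  rcases lt_or_ge τ 1 with h1 | h1
  · obtain ⟨C2, hC2, hC2'⟩ := eng0_interp (m := m) hp hs hγ h h1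
    refine ⟨ENNReal.ofReal (D ^ ((1 + s) * p - (1 + s - τ) * p)) ^ (1 / p) + C2 ^ (1 / p), by finiteness, fun u hu δ hδ hD X h0 hE => ?_⟩
    unfold WNorm; rw [if_neg (not_le.2 h), if_pos h1, add_mul]
    exact add_le_add (b0 u δ hδ hD X h0) (root_le hp hδ (hC2' u hu δ hδ X h0 hE))
  · have b1 : ∀ u : Spc m → ℝ, Good s p u → ∀ δ : ℝ, 0 < δ → δ ≤ D → ∀ X : ℝ≥0∞,
      En0 p u ≤ X * ENNReal.ofReal (δ ^ ((1 + s) * p)) → ET s p u ≤ X → 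
      eLpNorm (fun x => ‖grd u x‖) (ENNReal.ofReal p) (μT m) ≤ 
        (C1 * ENNReal.ofReal (D ^ (s * p - (1 + s - τ) * p))) ^ (1 / p) * (X ^ (1 / p) * ENNReal.ofReal (δ ^ (1 + s - τ))) := by
      intro u hu δ hδ hD X h0 hE
      rw [grdLp_eq hp]
      apply root_le hp hδ
      refine (hC1' u hu δ hδ X h0 hE).trans ((mul_le_mul' le_rfl (lower_pow hδ hD (show (1 + s - τ) * p ≤ s * p by nlinarith))).trans_eq ?_)
      ring
    rcases eq_or_lt_of_le h1 with h2 | h2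
    · refine ⟨ENNReal.ofReal (D ^ ((1 + s) * p - (1 + s - τ) * p)) ^ (1 / p) + 
        (C1 * ENNReal.ofReal (D ^ (s * p - (1 + s - τ) * p))) ^ (1 / p), by finiteness, fun u hu δ hδ hD X h0 hE => ?_⟩
      unfold WNorm; rw [if_neg (not_le.2 h), if_neg (not_lt.2 h1), if_pos (by linarith), if_pos h2.symm, add_zero, add_mul]
      exact add_le_add (b0 u δ hδ hD X h0) (b1 u hu δ hδ hD X h0 hE)
    · obtain ⟨C2, hC2, hC2'⟩ := eng1_interp (m := m) hp hs hγ (θ := τ - 1) (by linarith) (by linarith)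
      refine ⟨ENNReal.ofReal (D ^ ((1 + s) * p - (1 + s - τ) * p)) ^ (1 / p) + 
        (C1 * ENNReal.ofReal (D ^ (s * p - (1 + s - τ) * p))) ^ (1 / p) + C2 ^ (1 / p), by finiteness, fun u hu δ hδ hD X h0 hE => ?_⟩
      unfold WNorm; rw [if_neg (not_le.2 h), if_neg (not_lt.2 h1), if_pos (by linarith), if_neg h2.ne', add_mul, add_mul]
      refine add_le_add (add_le_add (b0 u δ hδ hD X h0) (b1 u hu δ hδ hD X h0 hE)) ?_
      refine root_le hp hδ ?_
      have := hC2' u hu δ hδ X h0 hE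
      rwa [show (s - (τ - 1)) = 1 + s - τ by ring] at this
end



section
variable {m : ℕ} {s p : ℝ}

lemma qd_nonneg (z : Spc m) : 0 ≤ qd z := by unfold qd; positivity

lemma qd_cont : Continuous (qd : Spc m → ℝ) := by unfold qd; fun_prop

lemma qd_smul (c : ℝ) (z : Spc m) : qd (c • z) = c ^ 2 * qd z := by
  unfold qd
  simp [mul_pow, Finset.mul_sum, mul_add]

lemma norm_sq_le_qd (z : Spc m) : ‖z‖ ^ 2 ≤ qd z := by
  have h : ‖z‖ ≤ Real.sqrt (qd z) := by
    rw [norm_spc_le (Real.sqrt_nonneg _)]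
    refine ⟨?_, fun i => ?_⟩
    · apply Real.abs_le_sqrt
      unfold qd
      have : 0 ≤ ∑ i, z.2 i ^ 2 := by positivity
      linarith
    · apply Real.abs_le_sqrt
      unfold qd
      have : z.2 i ^ 2 ≤ ∑ i, z.2 i ^ 2 := Finset.single_le_sum (f := fun i => z.2 i ^ 2) (fun _ _ => sq_nonneg _) (Finset.mem_univ i)
      nlinarith [sq_nonneg z.1]
  calc ‖z‖ ^ 2 ≤ Real.sqrt (qd z) ^ 2 := by gcongr
    _ = _ := Real.sq_sqrt (qd_nonneg z)

lemma gauss_eq (c : ℝ) (z : Spc m) : Real.exp (-c * qd z) = Real.exp (-c * z.1 ^ 2) * ∏ i, Real.exp (-c * z.2 i ^ 2) := by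
  unfold qd
  rw [mul_add, Real.exp_add, Finset.mul_sum, Real.exp_sum]

lemma gauss_int {c : ℝ} (hc : 0 < c) : Integrable (fun z : Spc m => Real.exp (-c * qd z)) := by
  simp_rw [gauss_eq]
  exact (integrable_exp_neg_mul_sq hc).mul_prod (Integrable.fintype_prod (f := fun _ x => Real.exp (-c * x ^ 2)) fun i => integrable_exp_neg_mul_sq hc)

lemma gauss_val {c : ℝ} (hc : 0 < c) : ∫ z : Spc m, Real.exp (-c * qd z) = (Real.pi / c) ^ (((m:ℝ) + 1) / 2) := by
  simp_rw [gauss_eq]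
  rw [show (volume : Measure (Spc m)) = (volume : Measure ℝ).prod volume from rfl]
  rw [integral_prod_mul (fun a : ℝ => Real.exp (-c * a ^ 2)) (fun b : Fin m → ℝ => ∏ i, Real.exp (-c * b i ^ 2)), 
    integral_fintype_prod_volume_eq_prod (fun _ x => Real.exp (-c * x ^ 2))]
  simp only [integral_gaussian, Finset.prod_const, Finset.card_univ, Fintype.card_fin]
  have hpc : 0 < Real.pi / c := by positivity
  rw [← pow_succ', Real.sqrt_eq_rpow, ← Real.rpow_natCast, ← Real.rpow_mul hpc.le]
  congr 1; push_cast; ring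

/-- heat kernel -/
def Gk {m : ℕ} (c : ℝ) (z : Spc m) : ℝ := (4 * Real.pi * c) ^ (-((m : ℝ) + 1) / 2) * Real.exp (-qd z / (4 * c))

lemma Gk_nonneg {c : ℝ} (hc : 0 < c) (z : Spc m) : 0 ≤ Gk c z := by
  have := Real.pi_pos
  unfold Gk; positivity

lemma Gk_cont (c : ℝ) : Continuous (Gk c : Spc m → ℝ) := by
  unfold Gk
  have := qd_cont (m := m)
  fun_prop

lemma Gk_eq (c : ℝ) (z : Spc m) : Gk c z = (4 * Real.pi * c) ^ (-((m : ℝ) + 1) / 2) * Real.exp (-(1 / (4 * c)) * qd z) := by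
  unfold Gk
  congr 2; ring

lemma Gk_int {c : ℝ} (hc : 0 < c) : Integrable (Gk c : Spc m → ℝ) := by
  have : (Gk c : Spc m → ℝ) = fun z => (4 * Real.pi * c) ^ (-((m : ℝ) + 1) / 2) * Real.exp (-(1 / (4 * c)) * qd z) :=
    funext fun z => Gk_eq c z
  rw [this]
  exact (gauss_int (by positivity)).const_mul _

lemma Gk_one {c : ℝ} (hc : 0 < c) : ∫ z : Spc m, Gk c z = 1 := by
  have hpi := Real.pi_pos
  simp_rw [Gk_eq]
  rw [integral_const_mul, gauss_val (by positivity), show Real.pi / (1 / (4 * c)) = 4 * Real.pi * c by field_simp,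
    ← Real.rpow_add (by positivity)]
  ring_nf
  exact Real.rpow_zero _

lemma Gk_scale {c : ℝ} (hc : 0 < c) (z : Spc m) : Gk c (Real.sqrt c • z) = (c ^ (((m:ℝ) + 1) / 2))⁻¹ * Gk 1 z := by
  have hpi := Real.pi_pos
  rw [Gk_eq, Gk_eq, qd_smul, Real.sq_sqrt hc.le, Real.mul_rpow (by positivity) hc.le, neg_div, Real.rpow_neg hc.le]
  rw [mul_one, show -(1 / (4 * c)) * (c * qd z) = -(1 / (4 * 1)) * qd z by field_simp]
  ring

lemma heat_eq {β t : ℝ} (hβ : 0 < β) (ht : 0 ≤ t) (f : Spc m → ℝ) (x : Spc m) :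
    heatSG β t f x = ∫ z : Spc m, Gk 1 z * f (x - Real.sqrt (t / β) • z) := by
  rcases eq_or_lt_of_le ht with rfl | ht
  · simp only [heatSG, le_refl, if_true, zero_div, Real.sqrt_zero, zero_smul, sub_zero]
    rw [integral_mul_const, Gk_one one_pos, one_mul]
  · have hc : 0 < t / β := by positivity
    have hsc : 0 < Real.sqrt (t / β) := Real.sqrt_pos.2 hc
    simp only [heatSG, not_le.2 ht, if_false]
    set c := t / β
    have h1 : ∫ y : Spc m, (4 * Real.pi * c) ^ (-((m : ℝ) + 1) / 2) * Real.exp (-qd (x - y) / (4 * c)) * f y =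
        ∫ w : Spc m, Gk c w * f (x - w) := by
      rw [← integral_sub_left_eq_self (fun w => Gk c w * f (x - w)) volume x]
      simp [Gk]
    rw [h1]
    have h2 := Measure.integral_comp_smul (volume : Measure (Spc m)) (fun w => Gk c w * f (x - w)) (Real.sqrt c)
    simp_rw [Gk_scale hc, mul_assoc] at h2
    rw [integral_const_mul, finrank_spc, abs_of_pos (by positivity), smul_eq_mul, Real.sqrt_eq_rpow, ← Real.rpow_natCast,
      ← Real.rpow_mul hc.le, show (1 / 2 * ((m + 1 : ℕ) : ℝ)) = ((m:ℝ) + 1) / 2 by push_cast; ring] at h2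
    have h3 : (c ^ (((m:ℝ) + 1) / 2))⁻¹ ≠ 0 := by positivity
    rw [Real.sqrt_eq_rpow]
    exact (mul_left_cancel₀ h3 h2).symm

lemma Gk_neg (c : ℝ) (z : Spc m) : Gk c (-z) = Gk c z := by
  unfold Gk qd; simp

lemma exp_mom (k y : ℝ) (hk : 0 ≤ k) (hy : 0 ≤ y) : (1 + y) ^ k ≤ Real.exp (2 * k ^ 2) * Real.exp (y ^ 2 / 8) := by
  rw [← Real.exp_add, Real.rpow_def_of_pos (by linarith)]
  apply Real.exp_le_exp.2
  have : Real.log (1 + y) ≤ y := by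
    have := Real.log_le_sub_one_of_pos (show 0 < 1 + y by linarith); linarith
  nlinarith [sq_nonneg (y - 4 * k), mul_le_mul_of_nonneg_right this hk]

/-- moments -/
def Mom (m : ℕ) (k : ℝ) : ℝ≥0∞ := ∫⁻ z : Spc m, ENNReal.ofReal (Gk 1 z) * ENNReal.ofReal ((1 + ‖z‖) ^ k)

lemma Mom_fin (m : ℕ) {k : ℝ} (hk : 0 ≤ k) : Mom m k ≠ ⊤ := by
  have hi := (gauss_int (m := m) (c := 1/8) (by norm_num)).const_mul
    ((4 * Real.pi * 1) ^ (-((m : ℝ) + 1) / 2) * Real.exp (2 * k ^ 2))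
  refine ne_top_of_le_ne_top hi.lintegral_lt_top.ne (lintegral_mono fun z => ?_)
  rw [← ENNReal.ofReal_mul (Gk_nonneg one_pos z)]
  apply ENNReal.ofReal_le_ofReal
  have hpi := Real.pi_pos
  rw [Gk_eq, mul_assoc ((4 * Real.pi * 1) ^ (-((m : ℝ) + 1) / 2)), mul_assoc ((4 * Real.pi * 1) ^ (-((m : ℝ) + 1) / 2))]
  refine mul_le_mul_of_nonneg_left ?_ (by positivity)
  calc Real.exp (-(1 / (4 * 1)) * qd z) * (1 + ‖z‖) ^ k ≤ Real.exp (-(1 / (4 * 1)) * qd z) * (Real.exp (2 * k ^ 2) * Real.exp (qd z / 8)) := by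
        gcongr
        refine (exp_mom k _ hk (norm_nonneg z)).trans ?_
        gcongr
        exact norm_sq_le_qd z
    _ = _ := by
      rw [← Real.exp_add, ← Real.exp_add, ← Real.exp_add]
      congr 1; ring

lemma Gk_diff {c c' : ℝ} (hc : 0 < c) (hcc : c ≤ c') :
    ∫ z : Spc m, |Gk c' z - Gk c z| ≤ 2 * (1 - (c / c') ^ (((m:ℝ) + 1) / 2)) := by
  have hpi := Real.pi_pos
  have hc' : 0 < c' := hc.trans_le hcc
  set l := (c / c') ^ (((m:ℝ) + 1) / 2) with hl
  have hl1 : l ≤ 1 := Real.rpow_le_one (by positivity) (by rw [div_le_one hc']; exact hcc) (by positivity)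
  have key : ∀ z : Spc m, l * Gk c z ≤ Gk c' z := by
    intro z
    unfold Gk
    rw [← mul_assoc]
    have e : l * (4 * Real.pi * c) ^ (-((m : ℝ) + 1) / 2) = (4 * Real.pi * c') ^ (-((m : ℝ) + 1) / 2) := by
      rw [hl, Real.div_rpow hc.le hc'.le, neg_div, Real.mul_rpow (by positivity) hc.le, Real.mul_rpow (by positivity) hc'.le,
        Real.rpow_neg hc.le, Real.rpow_neg hc'.le]
      have : c ^ (((m:ℝ) + 1) / 2) ≠ 0 := by positivity
      field_simp
    rw [e]
    gcongr ?_ * Real.exp ?_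
    rw [neg_div, neg_div, neg_le_neg_iff]
    exact div_le_div_of_nonneg_left (qd_nonneg z) (by positivity) (by linarith)
  have h1 : ∫ z : Spc m, |Gk c' z - Gk c z| ≤ ∫ z : Spc m, ((Gk c' z - l * Gk c z) + (1 - l) * Gk c z) := by
    apply integral_mono ((Gk_int hc').sub (Gk_int hc)).abs
    · exact ((Gk_int hc').sub ((Gk_int hc).const_mul _)).add ((Gk_int hc).const_mul _)
    · intro z
      have := key z
      have h2 := Gk_nonneg hc z
      show |Gk c' z - Gk c z| ≤ _
      rw [abs_le]
      constructor <;> nlinarith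
  refine h1.trans_eq ?_
  rw [integral_add, integral_sub, integral_const_mul, integral_const_mul, Gk_one hc, Gk_one hc']
  · ring
  · exact Gk_int hc'
  · exact (Gk_int hc).const_mul _
  · exact (Gk_int hc').sub ((Gk_int hc).const_mul _)
  · exact (Gk_int hc).const_mul _

lemma one_sub_le {c c' a : ℝ} (hc : 0 < c) (hcc : c ≤ c') (ha : 0 < a) (ha1 : a ≤ 1) :
    1 - (c / c') ^ (((m:ℝ) + 1) / 2) ≤ ((m:ℝ) + 1) * ((c' - c) / c) ^ a := by
  have hc' : 0 < c' := hc.trans_le hcc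
  set y := (c' - c) / c with hy
  have hy0 : 0 ≤ y := div_nonneg (by linarith) hc.le
  have e : c / c' = (1 + y)⁻¹ := by rw [hy, show 1 + (c' - c) / c = c' / c by field_simp; ring, inv_div]
  have h1 : 1 - (c / c') ^ (((m:ℝ) + 1) / 2) ≤ ((m:ℝ) + 1) / 2 * y := by
    rw [e, Real.inv_rpow (by linarith), ← Real.rpow_neg (by linarith), Real.rpow_def_of_pos (by linarith)]
    have h2 := Real.add_one_le_exp (Real.log (1 + y) * -(((m:ℝ) + 1) / 2))
    have h3 : Real.log (1 + y) ≤ y := by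
      have := Real.log_le_sub_one_of_pos (show 0 < 1 + y by linarith); linarith
    have h4 : 0 ≤ ((m:ℝ) + 1) / 2 := by positivity
    nlinarith
  have h2 : 0 ≤ (c / c') ^ (((m:ℝ) + 1) / 2) := by positivity
  have hm : (0:ℝ) ≤ m := by positivity
  rcases le_total y 1 with h | h
  · have h3 : y ≤ y ^ a := by
      conv_lhs => rw [← Real.rpow_one y]
      exact Real.rpow_le_rpow_of_exponent_ge_of_imp hy0 h ha1 (fun _ h => absurd h one_ne_zero)
    nlinarith
  · have h3 : 1 ≤ y ^ a := Real.one_le_rpow h ha.le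
    nlinarith

lemma heat_diff {β t t' L a : ℝ} (hβ : 0 < β) (ht : 0 < t) (htt : t ≤ t') (ha : 0 < a) (ha1 : a ≤ 1) {f : Spc m → ℝ} (hf : Continuous f)
    (hL : ∀ x, |f x| ≤ L) (x : Spc m) :
    |heatSG β t' f x - heatSG β t f x| ≤ L * (2 * (((m:ℝ) + 1) * ((t' - t) / t) ^ a)) := by
  have hL0 : 0 ≤ L := (abs_nonneg _).trans (hL x)
  have h1 : ∀ t, 0 < t → heatSG β t f x = ∫ w : Spc m, Gk (t / β) w * f (x - w) := by
    intro t ht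
    simp only [heatSG, not_le.2 ht, if_false]
    rw [← integral_sub_left_eq_self (fun w => Gk (t / β) w * f (x - w)) volume x]
    simp [Gk]
  have hi : ∀ t, 0 < t → Integrable (fun w : Spc m => Gk (t / β) w * f (x - w)) := by
    intro t ht
    refine (Gk_int (by positivity)).mul_bdd (c := L) ?_ ?_
    · exact (hf.comp (continuous_const.sub continuous_id)).aestronglyMeasurable
    · exact Eventually.of_forall fun w => hL _
  have ht' := ht.trans_le htt
  have hcc : t / β ≤ t' / β := by gcongr
  rw [h1 t ht, h1 t' ht', ← integral_sub (hi t' ht') (hi t ht)]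
  calc _ ≤ ∫ w : Spc m, |Gk (t' / β) w * f (x - w) - Gk (t / β) w * f (x - w)| := abs_integral_le_integral_abs
    _ ≤ ∫ w : Spc m, L * |Gk (t' / β) w - Gk (t / β) w| := by
      apply integral_mono ((hi t' ht').sub (hi t ht)).abs
      · exact ((Gk_int (by positivity)).sub (Gk_int (by positivity))).abs.const_mul L
      · intro w
        show |Gk (t' / β) w * f (x - w) - Gk (t / β) w * f (x - w)| ≤ _
        rw [← sub_mul, abs_mul, mul_comm]
        exact mul_le_mul_of_nonneg_right (hL _) (abs_nonneg _)
    _ ≤ L * (2 * (1 - ((t / β) / (t' / β)) ^ (((m:ℝ) + 1) / 2))) := by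
      rw [integral_const_mul]
      gcongr
      exact Gk_diff (by positivity) hcc
    _ ≤ _ := by
      gcongr
      have := one_sub_le (m := m) (c := t / β) (c' := t' / β) (by positivity) hcc ha ha1
      rwa [show (t' / β - t / β) / (t / β) = (t' - t) / t by field_simp] at this

lemma heat_bdd {β t L : ℝ} (hβ : 0 < β) (ht : 0 ≤ t) {f : Spc m → ℝ} 
    (hL : ∀ x, |f x| ≤ L) (x : Spc m) : |heatSG β t f x| ≤ L := by
  rw [heat_eq hβ ht]
  refine (abs_integral_le_integral_abs).trans ?_
  calc _ ≤ ∫ z : Spc m, Gk 1 z * L := by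
        apply integral_mono_of_nonneg (Eventually.of_forall fun _ => abs_nonneg _)
        · exact (Gk_int one_pos).mul_const L
        · refine Eventually.of_forall fun z => ?_
          simp only
          rw [abs_mul, abs_of_nonneg (Gk_nonneg one_pos z)]
          exact mul_le_mul_of_nonneg_left (hL _) (Gk_nonneg one_pos z)
    _ = _ := by rw [integral_mul_const, Gk_one one_pos, one_mul]
end



section
variable {m : ℕ} {s p : ℝ}

/-- symmetrized difference -/
def Sym4 {m : ℕ} (f : Spc m → ℝ) (a b : ℝ) (z x : Spc m) : ℝ :=
  (f (x + b • z) - f (x + a • z)) + (f (x + b • (-z)) - f (x + a • (-z)))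

lemma Sym4_le {f : Spc m → ℝ} (hd : Differentiable ℝ f) (hc : Continuous (grd f)) {a b : ℝ} (hab : a ≤ b) (z x : Spc m) :
    ‖Sym4 f a b z x‖ₑ ≤ ∫⁻ r in Ioc a b, ‖z‖ₑ * ‖grd f (x + r • z) - grd f (x + r • (-z))‖ₑ := by
  have h1 := line_ftc hd hc x z a b
  have h2 := line_ftc hd hc x (-z) a b
  have h3 : Sym4 f a b z x = ∫ r in a..b, (grd f (x + r • z) - grd f (x + r • (-z))) z := by
    unfold Sym4
    rw [← h1, ← h2, ← intervalIntegral.integral_add]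
    · congr 1; ext r
      simp only [sub_apply, map_neg]; ring
    · apply Continuous.intervalIntegrable; fun_prop
    · apply Continuous.intervalIntegrable; fun_prop
  rw [h3, intervalIntegral.integral_of_le hab]
  refine (enorm_integral_le_lintegral_enorm _).trans (lintegral_mono fun r => ?_)
  rw [mul_comm]
  exact ContinuousLinearMap.le_opENorm _ _

lemma Sym4_int (hp : 1 < p) (hs : 0 < s) (hγ : 0 < s - ((m : ℝ) + 1) / p) {f : Spc m → ℝ} (hf : Good s p f)
    {a b : ℝ} (ha : 0 ≤ a) (hab : a < b) (z : Spc m) :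
    ∫⁻ x in cube m, ‖Sym4 f a b z x‖ₑ ^ p ≤ ENNReal.ofReal ((b - a) ^ p * b ^ (s * p)) *
      (ENNReal.ofReal (KA m s p * 2 ^ (s * p)) * (En1 p f + Eng s p f)) * ENNReal.ofReal ((1 + ‖z‖) ^ (p + s * p)) := by
  have hp0 : 0 < p := by linarith
  have hb : 0 < b := ha.trans_lt hab
  have hc := grd_cont hp hs hγ hf
  have hd := hf.diff
  have hK := KA_nonneg (m := m) (s := s) (p := p) hγ
  have hz : 0 < 1 + ‖z‖ := by positivity
  refine (lintegral_mono fun x => ENNReal.rpow_le_rpow (Sym4_le hd hc hab.le z x) hp0.le).trans ?_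
  have hm1 : Measurable (Function.uncurry fun (r:ℝ) (x : Spc m) => ‖z‖ₑ * ‖grd f (x + r • z) - grd f (x + r • (-z))‖ₑ) := by
    apply Continuous.measurable
    apply ENNReal.continuous_const_mul (by simp) |>.comp
    exact ((hc.comp (by fun_prop)).sub (hc.comp (by fun_prop))).enorm
  refine (jen_swap (volume.restrict (Ioc a b)) hp hm1).trans ?_
  have key : ∀ r ∈ Ioc a b, ∫⁻ x in cube m, (‖z‖ₑ * ‖grd f (x + r • z) - grd f (x + r • (-z))‖ₑ) ^ p ≤
      ENNReal.ofReal ((1 + ‖z‖) ^ p) * (ENNReal.ofReal (KA m s p * (2 * b * (1 + ‖z‖)) ^ (s * p)) * (En1 p f + Eng s p f)) := by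
    intro r hr
    simp_rw [ENNReal.mul_rpow_of_nonneg _ _ hp0.le]
    rw [lintegral_const_mul' _ _ (by finiteness)]
    refine mul_le_mul' ?_ ?_
    · rw [← ofReal_norm, ENNReal.ofReal_rpow_of_nonneg (norm_nonneg _) hp0.le]
      gcongr; linarith
    · have hP : PerE (fun x => ‖grd f (x + (2 * r) • z) - grd f x‖ₑ ^ p) := by
        intro x k j
        have e1 := (perE_grd hf.per).comp_add ((2 * r) • z) x k j
        have e2 := perE_grd hf.per x k j
        simp only at e1 e2 ⊢
        rw [e1, e2]
      have h1 := lint_per hP (r • (-z))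
      have e : ∀ x, x + r • (-z) + (2 * r) • z = x + r • z := fun x => by module
      simp only [e] at h1
      rw [h1]
      apply trans_all hp hs hγ hf (by positivity)
      rw [norm_smul, Real.norm_of_nonneg (by linarith [hr.1])]
      have := norm_nonneg z
      have := hr.2
      have := hr.1
      nlinarith [mul_nonneg hb.le (norm_nonneg z)]
  refine (mul_le_mul' le_rfl (setLIntegral_mono' measurableSet_Ioc key)).trans_eq ?_
  have hba : 0 < b - a := by linarith
  rw [lintegral_const]
  simp only [Measure.restrict_apply_univ, Real.volume_Ioc]
  have e1 : ENNReal.ofReal ((b - a) ^ p) = ENNReal.ofReal (b - a) ^ (p - 1) * ENNReal.ofReal (b - a) := by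
    rw [ENNReal.ofReal_rpow_of_pos hba, ← ENNReal.ofReal_mul (by positivity)]
    congr 1
    conv_rhs => rw [← Real.rpow_one (b - a), ← Real.rpow_mul hba.le, ← Real.rpow_add hba]
    congr 1; ring
  rw [ENNReal.ofReal_mul (by positivity : 0 ≤ (b - a) ^ p), e1, Real.rpow_add hz, ENNReal.ofReal_mul (by positivity : 0 ≤ (1 + ‖z‖) ^ p),
    Real.mul_rpow (by positivity) (by positivity), Real.mul_rpow (by positivity) (by positivity),
    ENNReal.ofReal_mul hK, ENNReal.ofReal_mul hK, ENNReal.ofReal_mul (by positivity : 0 ≤ (2:ℝ) ^ (s * p) * b ^ (s * p)), 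
    ENNReal.ofReal_mul (by positivity : 0 ≤ (2:ℝ) ^ (s * p))]
  ring

lemma Gk_comp_int {f : Spc m → ℝ} (hf : Continuous f) {M : ℝ} (hM : ∀ x, ‖f x‖ ≤ M) (x : Spc m) (a : ℝ) :
    Integrable (fun z : Spc m => Gk 1 z * f (x + a • z)) := by
  refine (Gk_int one_pos).mul_bdd (c := M) ?_ ?_
  · exact (hf.comp (by fun_prop)).aestronglyMeasurable
  · exact Eventually.of_forall fun w => hM _

lemma heat_sym {β t : ℝ} (hβ : 0 < β) (ht : 0 ≤ t) (f : Spc m → ℝ) (x : Spc m) :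
    heatSG β t f x = ∫ z : Spc m, Gk 1 z * f (x + Real.sqrt (t / β) • z) := by
  rw [heat_eq hβ ht, ← integral_neg_eq_self]
  simp [Gk_neg, sub_neg_eq_add]

lemma heat_sym2 {β t : ℝ} (hβ : 0 < β) (ht : 0 ≤ t) (f : Spc m → ℝ) (x : Spc m) :
    heatSG β t f x = ∫ z : Spc m, Gk 1 z * f (x + Real.sqrt (t / β) • (-z)) := by
  rw [heat_eq hβ ht]
  simp [sub_eq_add_neg]

lemma heat_Sym4 {β t t' : ℝ} (hβ : 0 < β) (ht : 0 ≤ t) (ht' : 0 ≤ t') {f : Spc m → ℝ} (hf : Continuous f) (hper : PerE f) (x : Spc m) :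
    2 * (heatSG β t' f x - heatSG β t f x) = 
      ∫ z : Spc m, Gk 1 z * Sym4 f (Real.sqrt (t / β)) (Real.sqrt (t' / β)) z x := by
  obtain ⟨M, hM0, hM⟩ := per_bdd hper hf
  have i1 := Gk_comp_int hf hM x
  have i2 : ∀ a : ℝ, Integrable (fun z : Spc m => Gk 1 z * f (x + a • (-z))) := fun a => by
    have := i1 (-a); simpa using this
  unfold Sym4
  simp_rw [mul_add, mul_sub]
  have i3 : ∀ a b : ℝ, Integrable (fun z : Spc m => Gk 1 z * f (x + a • z) - Gk 1 z * f (x + b • z)) := fun a b => (i1 a).sub (i1 b)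
  have i4 : ∀ a b : ℝ, Integrable (fun z : Spc m => Gk 1 z * f (x + a • (-z)) - Gk 1 z * f (x + b • (-z))) := fun a b => (i2 a).sub (i2 b)
  rw [integral_add (i3 _ _) (i4 _ _), integral_sub (i1 _) (i1 _), integral_sub (i2 _) (i2 _),
    ← heat_sym hβ ht, ← heat_sym hβ ht', ← heat_sym2 hβ ht, ← heat_sym2 hβ ht']
  ring

lemma heat_init (hp : 1 < p) (hs : 0 < s) (hγ : 0 < s - ((m : ℝ) + 1) / p) {f : Spc m → ℝ} (hf : Good s p f)
    {β t t' : ℝ} (hβ : 0 < β) (ht : 0 ≤ t) (htt : t < t') :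
    En0 p (fun x => heatSG β t' f x - heatSG β t f x) ≤ 
      ENNReal.ofReal ((Real.sqrt (t' / β) - Real.sqrt (t / β)) ^ p * Real.sqrt (t' / β) ^ (s * p)) *
      ((ENNReal.ofReal (KA m s p * 2 ^ (s * p)) * (En1 p f + Eng s p f)) * Mom m (p + s * p)) := by
  have hp0 : 0 < p := by linarith
  set a := Real.sqrt (t / β)
  set b := Real.sqrt (t' / β)
  have hab : a < b := Real.sqrt_lt_sqrt (by positivity) (by gcongr)
  have hc := hf.diff.continuous
  set ν : Measure (Spc m) := volume.withDensity (fun z => ENNReal.ofReal (Gk 1 z)) with hν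
  have hGm : Measurable (fun z : Spc m => ENNReal.ofReal (Gk 1 z)) := (Gk_cont 1).measurable.ennreal_ofReal
  have hν1 : ν univ = 1 := by
    rw [hν, withDensity_apply _ MeasurableSet.univ, Measure.restrict_univ, 
      ← ofReal_integral_eq_lintegral_ofReal (Gk_int one_pos) (Eventually.of_forall fun z => Gk_nonneg one_pos z), Gk_one one_pos]
    simp
  have hSc : Continuous (Function.uncurry (Sym4 f a b)) := by
    unfold Sym4 Function.uncurry
    simp only
    refine ((hc.comp ?_).sub (hc.comp ?_)).add ((hc.comp ?_).sub (hc.comp ?_)) <;> fun_prop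
  have hSm : Measurable (Function.uncurry (fun z x => ‖Sym4 f a b z x‖ₑ)) := hSc.enorm.measurable
  have hpt : ∀ x, ‖heatSG β t' f x - heatSG β t f x‖ₑ ≤ ∫⁻ z, ‖Sym4 f a b z x‖ₑ ∂ν := by
    intro x
    have hSm1 : Measurable (fun z => ‖Sym4 f a b z x‖ₑ) := hSm.comp (measurable_id.prodMk measurable_const)
    rw [hν, lintegral_withDensity_eq_lintegral_mul _ hGm hSm1]
    calc ‖heatSG β t' f x - heatSG β t f x‖ₑ ≤ ‖2 * (heatSG β t' f x - heatSG β t f x)‖ₑ := by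
          rw [← ofReal_norm, ← ofReal_norm, norm_mul]
          apply ENNReal.ofReal_le_ofReal
          rw [Real.norm_of_nonneg (by norm_num : (0:ℝ) ≤ 2)]
          linarith [norm_nonneg (heatSG β t' f x - heatSG β t f x)]
      _ ≤ _ := by
        rw [heat_Sym4 hβ ht (ht.trans htt.le) hc hf.per x]
        refine (enorm_integral_le_lintegral_enorm _).trans_eq (lintegral_congr fun z => ?_)
        rw [enorm_mul, ← ofReal_norm (Gk 1 z), Real.norm_of_nonneg (Gk_nonneg one_pos z)]
        rfl
  unfold En0
  refine (lintegral_mono fun x => ENNReal.rpow_le_rpow (hpt x) hp0.le).trans ?_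
  refine (jen_swap ν hp hSm).trans ?_
  rw [hν1, ENNReal.one_rpow, one_mul]
  refine (lintegral_mono fun z => Sym4_int hp hs hγ hf (Real.sqrt_nonneg _) hab z).trans_eq ?_
  have hzm : Measurable (fun z : Spc m => ENNReal.ofReal ((1 + ‖z‖) ^ (p + s * p))) := by fun_prop
  rw [lintegral_const_mul _ hzm, hν, lintegral_withDensity_eq_lintegral_mul _ hGm hzm, mul_assoc]
  rfl

lemma sqrt_est {β t t' : ℝ} (hβ : 0 < β) (hs : 0 < s) (hs1 : s < 1) (ht : 0 ≤ t) (htt : t < t') :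
    (Real.sqrt (t' / β) - Real.sqrt (t / β)) * Real.sqrt (t' / β) ^ s ≤ (β ^ ((1 + s) / 2))⁻¹ * (t' - t) ^ ((1 + s) / 2) := by
  have ht' : 0 < t' := by linarith
  set y := t' / β with hy
  set w := t / β with hw
  have hy0 : 0 < y := by positivity
  have hw0 : 0 ≤ w := by positivity
  have hwy : w < y := by rw [hy, hw]; gcongr
  have hsy : 0 < Real.sqrt y := Real.sqrt_pos.2 hy0
  have e : (β ^ ((1 + s) / 2))⁻¹ * (t' - t) ^ ((1 + s) / 2) = (y - w) ^ ((1 + s) / 2) := by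
    rw [hy, hw, ← sub_div, Real.div_rpow (by linarith) hβ.le]; field_simp
  rw [e]
  have h1 : Real.sqrt y - Real.sqrt w ≤ (y - w) / Real.sqrt y := by
    rw [le_div_iff₀ hsy]
    have a1 := Real.mul_self_sqrt hy0.le
    have a2 := Real.mul_self_sqrt hw0
    have a3 := Real.sqrt_nonneg w
    have a4 := Real.sqrt_le_sqrt hwy.le
    nlinarith
  have h2 : (y - w) / Real.sqrt y * Real.sqrt y ^ s = (y - w) * y ^ (-((1 - s) / 2)) := by
    rw [Real.sqrt_eq_rpow, ← Real.rpow_mul hy0.le, div_eq_mul_inv, ← Real.rpow_neg hy0.le, mul_assoc, ← Real.rpow_add hy0]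
    congr 2; ring
  calc _ ≤ (y - w) / Real.sqrt y * Real.sqrt y ^ s := by gcongr
    _ = (y - w) * y ^ (-((1 - s) / 2)) := h2
    _ ≤ (y - w) * (y - w) ^ (-((1 - s) / 2)) := by
      apply mul_le_mul_of_nonneg_left _ (by linarith)
      exact Real.rpow_le_rpow_of_nonpos (by linarith) (by linarith) (by linarith)
    _ = _ := by
      have hd : 0 < y - w := by linarith
      conv_lhs => rw [← Real.rpow_one (y - w), ← Real.rpow_mul hd.le, ← Real.rpow_add hd]
      congr 1; ring
end



section
variable {m : ℕ} {s p T : ℝ} {ψ : ℝ → Spc m → ℝ} {V : Spc m → ℝ}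

lemma Reg.heatF_cont (h : Reg s p T ψ) (hV : ContDiff ℝ 2 V) (hVp : PerE V) (β t : ℝ) (x : Spc m) :
    Continuous (fun r : ℝ => ∫ z : Spc m, Gk 1 z * Fop V (ψ (clp 0 T r)) (x - Real.sqrt ((t - r) / β) • z)) := by
  obtain ⟨-, L, hL, hL'⟩ := h.FLB hV hVp
  have hj := h.Fjoint hV
  apply continuous_of_dominated (bound := fun z => Gk 1 z * L)
  · intro r
    refine ((Gk_cont 1).mul (hj.comp (f := fun z : Spc m => (r, x - Real.sqrt ((t - r) / β) • z)) ?_)).aestronglyMeasurable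
    fun_prop
  · intro r
    refine Eventually.of_forall fun z => ?_
    rw [norm_mul, Real.norm_of_nonneg (Gk_nonneg one_pos z)]
    exact mul_le_mul_of_nonneg_left (hL' _ (Reg.clp_mem h.hT r) _).1 (Gk_nonneg one_pos z)
  · exact (Gk_int one_pos).mul_const L
  · refine Eventually.of_forall fun z => ?_
    refine continuous_const.mul (hj.comp (f := fun r : ℝ => (r, x - Real.sqrt ((t - r) / β) • z)) ?_)
    fun_prop

lemma Reg.heatF_int (h : Reg s p T ψ) (hV : ContDiff ℝ 2 V) (hVp : PerE V) {β : ℝ} (hβ : 0 < β) {t a b : ℝ} (x : Spc m)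
    (ha : 0 ≤ a) (hab : a ≤ b) (hbt : b ≤ t) (htT : t ≤ T) :
    IntervalIntegrable (fun r => heatSG β (t - r) (Fop V (ψ r)) x) volume a b := by
  rw [intervalIntegrable_iff_integrableOn_Ioc_of_le hab]
  have h1 := ((h.heatF_cont hV hVp β t x).integrableOn_Ioc (a := a) (b := b) (μ := volume))
  refine h1.congr_fun (fun r hr => ?_) measurableSet_Ioc
  have hr1 : r ∈ Icc 0 T := ⟨by linarith [hr.1], by linarith [hr.2]⟩
  simp only
  rw [heat_eq hβ (by linarith [hr.2]), Reg.clp_self hr1]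

lemma Reg.duh (h : Reg s p T ψ) (hV : ContDiff ℝ 2 V) (hVp : PerE V) {β : ℝ} (hβ : 0 < β) {a : ℝ} (ha : 0 < a) (ha1 : a < 1) :
    ∃ K : ℝ, 0 ≤ K ∧ ∀ t t' : ℝ, 0 ≤ t → t < t' → t' ≤ T → ∀ x,
      |(∫ r in Ioc (0:ℝ) t', heatSG β (t' - r) (Fop V (ψ r)) x) - ∫ r in Ioc (0:ℝ) t, heatSG β (t - r) (Fop V (ψ r)) x| ≤
        K * (t' - t) ^ a := by
  obtain ⟨hc, L, hL, hL'⟩ := h.FLB hV hVp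
  have h1a : 0 < 1 - a := by linarith
  have hT := h.hT
  refine ⟨L * (2 * ((m:ℝ) + 1)) * (T ^ (1 - a) / (1 - a)) + L * T ^ (1 - a), by positivity, fun t t' ht htt htT x => ?_⟩
  have hd : 0 < t' - t := by linarith
  rw [← intervalIntegral.integral_of_le (by linarith), ← intervalIntegral.integral_of_le ht,
    ← intervalIntegral.integral_add_adjacent_intervals (h.heatF_int hV hVp hβ x le_rfl ht htt.le htT)
      (h.heatF_int hV hVp hβ x ht htt.le le_rfl htT), add_sub_right_comm,
      ← intervalIntegral.integral_sub (h.heatF_int hV hVp hβ x le_rfl ht htt.le htT) (h.heatF_int hV hVp hβ x le_rfl ht le_rfl (by linarith))]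
  have b2 : |∫ r in t..t', heatSG β (t' - r) (Fop V (ψ r)) x| ≤ L * T ^ (1 - a) * (t' - t) ^ a := by
    have := intervalIntegral.norm_integral_le_of_norm_le_const (a := t) (b := t') (C := L)
      (f := fun r => heatSG β (t' - r) (Fop V (ψ r)) x) (fun r hr => by
        rw [uIoc_of_le htt.le] at hr
        exact heat_bdd hβ (by linarith [hr.2]) (fun y => (hL' r ⟨by linarith [hr.1], by linarith [hr.2]⟩ y).1) x)
    rw [abs_of_pos hd, Real.norm_eq_abs] at this
    refine this.trans ?_
    rw [mul_assoc]
    apply mul_le_mul_of_nonneg_left _ hL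
    calc t' - t = (t' - t) ^ (1 - a) * (t' - t) ^ a := by
          rw [← Real.rpow_add hd]; simp
      _ ≤ _ := by gcongr; linarith
  have hi0 : IntervalIntegrable (fun r : ℝ => r ^ (-a)) volume 0 t := intervalIntegral.intervalIntegrable_rpow' (by linarith)
  have hi : IntervalIntegrable (fun r : ℝ => (t - r) ^ (-a)) volume 0 t := by
    have := hi0.comp_sub_left t
    simp only [sub_zero, sub_self] at this
    exact this.symm
  have b1 : |∫ r in (0:ℝ)..t, (heatSG β (t' - r) (Fop V (ψ r)) x - heatSG β (t - r) (Fop V (ψ r)) x)| ≤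
      L * (2 * ((m:ℝ) + 1)) * (T ^ (1 - a) / (1 - a)) * (t' - t) ^ a := by
    have h1 : ‖∫ r in (0:ℝ)..t, (heatSG β (t' - r) (Fop V (ψ r)) x - heatSG β (t - r) (Fop V (ψ r)) x)‖ ≤
        ∫ r in (0:ℝ)..t, (L * (2 * ((m:ℝ) + 1)) * (t' - t) ^ a) * (t - r) ^ (-a) := by
      apply intervalIntegral.norm_integral_le_of_norm_le ht _ (hi.const_mul _)
      have hne : ∀ᵐ r : ℝ, r ≠ t := by
        have : ({t} : Set ℝ)ᶜ ∈ ae (volume : Measure ℝ) := by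
          rw [compl_mem_ae_iff]; simp
        exact this
      filter_upwards [hne] with r hr1 hr
      have hrt : 0 < t - r := by
        have := lt_of_le_of_ne hr.2 hr1; linarith
      have hrT : r ∈ Icc 0 T := ⟨hr.1.le, by linarith⟩
      have := heat_diff hβ hrt (show t - r ≤ t' - r by linarith) ha ha1.le (hc r hrT) (fun y => (hL' r hrT y).1) x
      rw [Real.norm_eq_abs]
      refine this.trans_eq ?_
      rw [show t' - r - (t - r) = t' - t by ring, Real.div_rpow hd.le hrt.le, Real.rpow_neg hrt.le]
      ring
    rw [Real.norm_eq_abs] at h1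
    refine h1.trans ?_
    rw [intervalIntegral.integral_const_mul, intervalIntegral.integral_comp_sub_left (fun r => r ^ (-a)) t, sub_self, sub_zero,
      integral_rpow (Or.inl (by linarith)), show -a + 1 = 1 - a by ring, Real.zero_rpow h1a.ne', sub_zero]
    have : t ^ (1 - a) ≤ T ^ (1 - a) := by gcongr; linarith
    calc _ ≤ L * (2 * ((m:ℝ) + 1)) * (t' - t) ^ a * (T ^ (1 - a) / (1 - a)) := by gcongr
      _ = _ := by ring
  rw [add_mul]
  exact (abs_add_le _ _).trans (add_le_add b1 b2)

lemma Reg.time_est (h : Reg s p T ψ) (hV : ContDiff ℝ 2 V) (hVp : PerE V) {β : ℝ} (hβ : 0 < β)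
    (hm : ∀ t ∈ Icc 0 T, ∀ᵐ x ∂(volume : Measure (Spc m)),
      ψ t x = heatSG β t (ψ 0) x + ∫ r in Set.Ioc (0 : ℝ) t, heatSG β (t - r) (Fop V (ψ r)) x) :
    ∃ X : ℝ≥0∞, X ≠ ⊤ ∧ ∀ t t' : ℝ, 0 ≤ t → t < t' → t' ≤ T →
      En0 p (fun x => ψ t' x - ψ t x) ≤ X * ENNReal.ofReal ((t' - t) ^ ((1 + s) / 2 * p)) := by
  have hs := h.hs
  have hs1 := h.hs1
  have hp := h.hp
  have hp0 : 0 < p := by linarith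
  obtain ⟨K, hK, hK'⟩ := h.duh hV hVp hβ (a := (1 + s) / 2) (by linarith) (by linarith)
  have g0 := h.good 0 ⟨le_rfl, h.hT⟩
  have hE : En1 p (ψ 0) + Eng s p (ψ 0) ≠ ⊤ := ENNReal.add_ne_top.2 ⟨g0.e1, g0.eg⟩
  have hM := Mom_fin m (k := p + s * p) (by positivity)
  refine ⟨2 ^ (p - 1) * (ENNReal.ofReal ((β ^ ((1 + s) / 2))⁻¹ ^ p) * ((ENNReal.ofReal (KA m s p * 2 ^ (s * p)) * (En1 p (ψ 0) + Eng s p (ψ 0))) * Mom m (p + s * p))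
    + ENNReal.ofReal (K ^ p)), by finiteness, fun t t' ht htt htT => ?_⟩
  have hd : 0 < t' - t := by linarith
  have hdp : 0 ≤ (t' - t) ^ ((1 + s) / 2) := by positivity
  have h1 := hm t ⟨ht, by linarith⟩
  have h2 := hm t' ⟨by linarith, htT⟩
  have e1 : ENNReal.ofReal ((Real.sqrt (t' / β) - Real.sqrt (t / β)) ^ p * Real.sqrt (t' / β) ^ (s * p)) ≤
      ENNReal.ofReal ((β ^ ((1 + s) / 2))⁻¹ ^ p) * ENNReal.ofReal ((t' - t) ^ ((1 + s) / 2 * p)) := by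
    have ha : 0 ≤ Real.sqrt (t' / β) - Real.sqrt (t / β) := by
      have := Real.sqrt_le_sqrt (show t / β ≤ t' / β by gcongr); linarith
    rw [← ENNReal.ofReal_mul (by positivity)]
    apply ENNReal.ofReal_le_ofReal
    rw [Real.rpow_mul (Real.sqrt_nonneg _), Real.rpow_mul hd.le, ← Real.mul_rpow ha (by positivity), ← Real.mul_rpow (by positivity) hdp]
    have := sqrt_est hβ hs hs1 ht htt
    gcongr
  calc En0 p (fun x => ψ t' x - ψ t x) ≤ ∫⁻ x in cube m, 2 ^ (p - 1) * (‖heatSG β t' (ψ 0) x - heatSG β t (ψ 0) x‖ₑ ^ p + 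
        ENNReal.ofReal ((K * (t' - t) ^ ((1 + s) / 2)) ^ p)) := by
        unfold En0
        refine lintegral_mono_ae ?_
        filter_upwards [ae_restrict_of_ae h1, ae_restrict_of_ae h2] with x hx1 hx2
        rw [hx1, hx2, add_sub_add_comm]
        refine (ENNReal.rpow_le_rpow (enorm_add_le _ _) hp0.le).trans ((ENNReal.rpow_add_le_mul_rpow_add_rpow _ _ hp.le).trans ?_)
        refine mul_le_mul' le_rfl (add_le_add le_rfl ?_)
        rw [← ofReal_norm, ENNReal.ofReal_rpow_of_nonneg (norm_nonneg _) hp0.le]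
        apply ENNReal.ofReal_le_ofReal
        have := hK' t t' ht htt htT x
        rw [Real.norm_eq_abs]
        gcongr
    _ = 2 ^ (p - 1) * (En0 p (fun x => heatSG β t' (ψ 0) x - heatSG β t (ψ 0) x) + ENNReal.ofReal ((K * (t' - t) ^ ((1 + s) / 2)) ^ p)) := by
      rw [lintegral_const_mul' _ _ (by finiteness), lintegral_add_right _ measurable_const]
      simp [En0, vol_cube]
    _ ≤ 2 ^ (p - 1) * (ENNReal.ofReal ((β ^ ((1 + s) / 2))⁻¹ ^ p) * ENNReal.ofReal ((t' - t) ^ ((1 + s) / 2 * p)) * 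
        ((ENNReal.ofReal (KA m s p * 2 ^ (s * p)) * (En1 p (ψ 0) + Eng s p (ψ 0))) * Mom m (p + s * p))
        + ENNReal.ofReal (K ^ p) * ENNReal.ofReal ((t' - t) ^ ((1 + s) / 2 * p))) := by
      refine mul_le_mul' le_rfl (add_le_add ?_ ?_)
      · exact (heat_init hp hs h.hγ g0 hβ ht htt).trans (mul_le_mul' e1 le_rfl)
      · rw [Real.mul_rpow hK hdp, ENNReal.ofReal_mul (by positivity), ← Real.rpow_mul hd.le]
    _ = _ := by ring
end



section
variable {m : ℕ} {s p T : ℝ} {ψ : ℝ → Spc m → ℝ} {V : Spc m → ℝ}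

lemma WNorm_zero (hp : 1 < p) (τ : ℝ) : WNorm τ p (fun _ : Spc m => (0:ℝ)) = 0 := by
  have hp0 : 0 < p := by linarith
  have h1 : LpN p (fun _ : Spc m => (0:ℝ)) = 0 := by simp [LpN]
  have h2 : grd (fun _ : Spc m => (0:ℝ)) = fun _ => 0 := by
    funext x; simp [grd]
  have h3 : gagl τ p (fun _ : Spc m => (0:ℝ)) = 0 := by
    simp [gagl, Real.zero_rpow hp0.ne', hp0]
  have h4 : gagl (τ-1) p (fun _ : Spc m => (0:Spc m →L[ℝ] ℝ)) = 0 := by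
    simp [gagl, Real.zero_rpow hp0.ne', hp0]
  have h5 : iteratedFDeriv ℝ 2 (fun _ : Spc m => (0:ℝ)) = fun _ => 0 := by
    have := iteratedFDeriv_fun_zero (𝕜 := ℝ) (E := Spc m) (F := ℝ) (n := 2)
    exact this
  unfold WNorm
  rw [h1, h2, h3, h4, h5]
  simp

/-- passing from an extended bound to the Hölder property -/
lemma holder_of (hp : 1 < p) {a μ τ : ℝ} (hμ : μ ≤ a) {A : ℝ → Spc m → ℝ}
    (h : ∃ C : ℝ≥0∞, C ≠ ⊤ ∧ ∀ t ∈ Icc 0 T, ∀ t' ∈ Icc 0 T, t ≠ t' →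
      WNorm τ p (fun x => A t' x - A t x) ≤ C * ENNReal.ofReal (|t' - t| ^ a)) :
    HolderW μ τ p (Icc 0 T) A := by
  obtain ⟨C, hC, h⟩ := h
  refine ⟨(C * ENNReal.ofReal (T ^ (a - μ))).toReal, fun t ht t' ht' => ?_⟩
  by_cases e : t = t'
  · subst e
    simp only [sub_self]
    rw [WNorm_zero hp]
    exact zero_le
  · have hpos : 0 < |t' - t| := abs_pos.2 (sub_ne_zero.2 (Ne.symm e))
    have hle : |t' - t| ≤ T := abs_le.2 ⟨by linarith [ht.1, ht.2, ht'.1, ht'.2], by linarith [ht.1, ht.2, ht'.1, ht'.2]⟩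
    refine (h t ht t' ht' e).trans ?_
    rw [ENNReal.ofReal_mul ENNReal.toReal_nonneg, ENNReal.ofReal_toReal (by finiteness), mul_assoc]
    exact mul_le_mul' le_rfl (lower_pow hpos hle hμ)

lemma Reg.diff_est (h : Reg s p T ψ) (hV : ContDiff ℝ 2 V) (hVp : PerE V) {β : ℝ} (hβ : 0 < β)
    (hm : ∀ t ∈ Icc 0 T, ∀ᵐ x ∂(volume : Measure (Spc m)),
      ψ t x = heatSG β t (ψ 0) x + ∫ r in Set.Ioc (0 : ℝ) t, heatSG β (t - r) (Fop V (ψ r)) x) :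
    ∃ X : ℝ≥0∞, X ≠ ⊤ ∧ ∀ t ∈ Icc 0 T, ∀ t' ∈ Icc 0 T, t ≠ t' →
      0 < |t' - t| ^ (1/2:ℝ) ∧ |t' - t| ^ (1/2:ℝ) ≤ T ^ (1/2:ℝ) ∧ 
      Good s p (fun x => ψ t' x - ψ t x) ∧
      En0 p (fun x => ψ t' x - ψ t x) ≤ X * ENNReal.ofReal ((|t' - t| ^ (1/2:ℝ)) ^ ((1 + s) * p)) ∧
      ET s p (fun x => ψ t' x - ψ t x) ≤ X := by
  obtain ⟨X, hX, hX'⟩ := h.time_est hV hVp hβ hm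
  obtain ⟨B, hB, hB'⟩ := h.bd
  have hp := h.hp
  refine ⟨X + 2 ^ (p-1) * (B + B), by finiteness, fun t ht t' ht' e => ?_⟩
  have hpos : 0 < |t' - t| := abs_pos.2 (sub_ne_zero.2 (Ne.symm e))
  have hle : |t' - t| ≤ T := abs_le.2 ⟨by linarith [ht.1, ht.2, ht'.1, ht'.2], by linarith [ht.1, ht.2, ht'.1, ht'.2]⟩
  have hb := fun t ht => ((hB' t ht).trans_lt hB.lt_top).ne
  have hg := good_sub hp (h.good t' ht') (h.good t ht) (hb t' ht') (hb t ht)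
  refine ⟨by positivity, Real.rpow_le_rpow hpos.le hle (by norm_num), hg.1, ?_,
    (hg.2.trans (mul_le_mul' le_rfl (add_le_add (hB' t' ht') (hB' t ht)))).trans le_add_self⟩
  rw [← Real.rpow_mul hpos.le, show (1/2:ℝ) * ((1 + s) * p) = (1 + s) / 2 * p by ring]
  refine le_trans ?_ (mul_le_mul' (le_self_add (a := X)) le_rfl)
  rcases lt_or_gt_of_ne e with hlt | hlt
  · rw [abs_of_pos (sub_pos.2 hlt)]
    exact hX' t t' ht.1 hlt ht'.2
  · rw [abs_of_neg (sub_neg.2 hlt), neg_sub]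
    refine le_trans (le_of_eq ?_) (hX' t' t ht'.1 hlt ht.2)
    unfold En0
    simp_rw [enorm_sub_rev]

lemma Reg.part1 (h : Reg s p T ψ) (hV : ContDiff ℝ 2 V) (hVp : PerE V) {β : ℝ} (hβ : 0 < β)
    (hm : ∀ t ∈ Icc 0 T, ∀ᵐ x ∂(volume : Measure (Spc m)),
      ψ t x = heatSG β t (ψ 0) x + ∫ r in Set.Ioc (0 : ℝ) t, heatSG β (t - r) (Fop V (ψ r)) x)
    {τ μ : ℝ} (hτ : 0 ≤ τ) (hτs : τ < 1 + s) (hμ : μ ≤ (1 + s - τ) / 2) :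
    HolderW μ τ p (Icc 0 T) ψ := by
  obtain ⟨X, hX, hX'⟩ := h.diff_est hV hVp hβ hm
  obtain ⟨C, hC, hC'⟩ := W_interp (m := m) h.hp h.hs h.hs1 h.hγ hτ hτs (T ^ (1/2:ℝ))
  have hp0 : 0 < p := by linarith [h.hp]
  refine holder_of h.hp hμ ⟨C * X ^ (1 / p), ?_, fun t ht t' ht' e => ?_⟩
  · have : 0 ≤ 1 / p := by positivity
    finiteness
  · obtain ⟨h1, h2, h3, h4, h5⟩ := hX' t ht t' ht' e
    refine (hC' _ h3 _ h1 h2 X h4 h5).trans_eq ?_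
    rw [← Real.rpow_mul (abs_nonneg _), show (1/2:ℝ) * (1 + s - τ) = (1 + s - τ) / 2 by ring, mul_assoc]

lemma LpN_le_sup (hp : 1 < p) {f : Spc m → ℝ} {K : ℝ≥0∞} (h : ∀ x, ‖f x‖ₑ ≤ K) : LpN p f ≤ K := by
  have hp0 : 0 < p := by linarith
  rw [LpN_eq hp]
  have : En0 p f ≤ K ^ p := by
    unfold En0
    calc _ ≤ ∫⁻ x in cube m, K ^ p := lintegral_mono fun x => ENNReal.rpow_le_rpow (h x) hp0.le
      _ = _ := by simp [vol_cube]
  refine (ENNReal.rpow_le_rpow this (by positivity)).trans_eq ?_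
  rw [← ENNReal.rpow_mul, mul_one_div_cancel hp0.ne', ENNReal.rpow_one]

lemma Reg.part2 (h : Reg s p T ψ) (hV : ContDiff ℝ 2 V) (hVp : PerE V) {β : ℝ} (hβ : 0 < β)
    (hm : ∀ t ∈ Icc 0 T, ∀ᵐ x ∂(volume : Measure (Spc m)),
      ψ t x = heatSG β t (ψ 0) x + ∫ r in Set.Ioc (0 : ℝ) t, heatSG β (t - r) (Fop V (ψ r)) x)
    {θ μ : ℝ} (hθ : ((m:ℝ) + 1) / p < θ) (hθs : θ < s) (hμ : μ ≤ (s - θ) / 2) :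
    HolderW μ 0 p (Icc 0 T) (fun t => Fop V (ψ t)) := by
  have hp := h.hp
  have hp0 : 0 < p := by linarith [h.hp]
  have hp1 : 0 ≤ 1 / p := by positivity
  have hθ0 : 0 < θ := lt_of_le_of_lt (by positivity) hθ
  obtain ⟨X, hX, hX'⟩ := h.diff_est hV hVp hβ hm
  obtain ⟨C, hC, hC'⟩ := ET_interp (m := m) hp h.hs h.hγ hθ0 hθs (T ^ (1/2:ℝ))
  obtain ⟨K, hK, hK'⟩ := c1_ctrl (m := m) hp hθ0 (sub_pos.2 hθ)
  obtain ⟨-, L, hL, hL'⟩ := h.FLB hV hVp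
  set M : ℝ≥0∞ := (K * C) ^ (1 / p) * X ^ (1 / p) with hM
  have hMt : M ≠ ⊤ := by rw [hM]; finiteness
  refine holder_of hp hμ ⟨ENNReal.ofReal L * M, by finiteness, fun t ht t' ht' e => ?_⟩
  obtain ⟨h1, h2, h3, h4, h5⟩ := hX' t ht t' ht' e
  have hE := hC' _ h3 _ h1 h2 X h4 h5
  have hg : Good θ p (fun x => ψ t' x - ψ t x) :=
    Good.of_ET h3.per h3.diff (hE.trans_lt (by finiteness)).ne
  have key : ∀ Y : ℝ≥0∞, Y ^ p ≤ K * ET θ p (fun x => ψ t' x - ψ t x) →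
      Y ≤ M * ENNReal.ofReal (|t' - t| ^ ((s - θ) / 2)) := by
    intro Y hY
    have := root_le hp h1 (a := s - θ) (Y := Y ^ p) (C := K * C) (X := X)
      (by refine hY.trans ((mul_le_mul' le_rfl hE).trans_eq ?_); ring)
    rw [← ENNReal.rpow_mul, mul_one_div_cancel hp0.ne', ENNReal.rpow_one, ← Real.rpow_mul (abs_nonneg _),
      show (1/2:ℝ) * (s - θ) = (s - θ) / 2 by ring, ← mul_assoc] at this
    exact this
  set η : ℝ := M.toReal * |t' - t| ^ ((s - θ) / 2) with hη
  have hη0 : 0 ≤ η := by positivity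
  have hηE : M * ENNReal.ofReal (|t' - t| ^ ((s - θ) / 2)) = ENNReal.ofReal η := by
    rw [hη, ENNReal.ofReal_mul ENNReal.toReal_nonneg, ENNReal.ofReal_toReal hMt]
  rw [hηE] at key
  have hc : ∀ x, |ψ t' x - ψ t x| ≤ η ∧ ‖grd (ψ t') x - grd (ψ t) x‖ ≤ η := by
    intro x
    obtain ⟨a1, a2⟩ := hK' _ hg x
    have b1 := key _ a1
    have b2 := key _ a2
    rw [grd_sub (h.good t' ht').diff (h.good t ht).diff] at b2
    rw [← ofReal_norm, ENNReal.ofReal_le_ofReal_iff hη0] at b1 b2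
    exact ⟨b1, b2⟩
  rw [mul_assoc, hηE, ← ENNReal.ofReal_mul hL]
  simp only [WNorm, le_refl, if_true]
  refine LpN_le_sup hp fun x => ?_
  rw [← ofReal_norm]
  exact ENNReal.ofReal_le_ofReal ((hL' t ht x).2 t' ht' η hη0 hc)

lemma memD_lower {σ τ : ℝ} {f : Spc m → ℝ} (h2 : Hyp2 m σ p) (hf : MemD σ p f) (hτ : 0 ≤ τ) (hτs : τ < σ) : MemD τ p f := by
  obtain ⟨hm, hpm, hσ, hσ2⟩ := h2
  have hp : 1 < p := by have : (0:ℝ) ≤ m := by positivity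
                        linarith
  have hp0 : 0 < p := by linarith
  have hp1 : 0 ≤ 1 / p := by positivity
  have hnp : 0 < ((m:ℝ) + 1) / p := by positivity
  obtain ⟨⟨a1, a2, a3, a4, a5⟩, hpos⟩ := hf
  obtain ⟨hg, hE⟩ := good_of hp (by linarith) hσ2 ⟨a1, a2, a3, a4, a5⟩
  obtain ⟨C, hC, hC'⟩ := W_interp (m := m) hp (s := σ - 1) (by linarith) (by linarith) (by linarith) hτ (by linarith) 1
  refine ⟨⟨a1, a2, fun h => hg.diff, fun h => by linarith, ?_⟩, hpos⟩
  refine (hC' f hg 1 one_pos le_rfl _ ?_ le_rfl).trans_lt (by finiteness)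
  simp only [Real.one_rpow, ENNReal.ofReal_one, mul_one]
  exact le_self_add

end

/-- **Hölder regularity of the mild solution (Lemma `holfp`).** Assume `[H₁]` and `[H₂]`, and
let `ψ : [0,T_max) → 𝒟^{σ,p}(𝕋ⁿ)` be the maximal mild solution. Then:
(1) for every `ε ∈ [0, 1 − σ/2)` and `τ ∈ [0, σ)`,
`ψ ∈ C^μ_loc([0,T_max), 𝒟^{τ,p}(𝕋ⁿ))` with `μ := min(1 − σ/2 − ε, (σ−τ)/2)`;
(2) `F(ψ(·)) ∈ C^{ν−ε}_loc([0,T_max), L^p₀(𝕋ⁿ))` for every `ε ∈ (0,ν)`, where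
`ν := min(1 − σ/2, σ/2 − 1/2 − n/(2p))` (`n = m + 1`). -/
theorem mild_solution_holder_regularity
    (m : ℕ) (V : Spc m → ℝ) (β σ p : ℝ) (ψ0 : Spc m → ℝ)
    (Tmax : ℝ≥0∞) (ψ : ℝ → Spc m → ℝ)
    (hV : ContDiff ℝ 2 V) (hVper : IsPeriodic V) (hβ : 0 < β)
    (h1 : Hyp1 σ p ψ0) (h2 : Hyp2 m σ p)
    (hψ : IsMaximalMildSolution V β σ p ψ0 Tmax ψ) :
    (∀ ε τ : ℝ, 0 ≤ ε → ε < 1 - σ / 2 → 0 ≤ τ → τ < σ →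
      (∀ t ∈ Ico0 Tmax, MemD τ p (ψ t)) ∧
      ∀ T : ℝ, 0 ≤ T → ENNReal.ofReal T < Tmax →
        HolderW (min (1 - σ / 2 - ε) ((σ - τ) / 2)) τ p (Set.Icc 0 T) ψ) ∧
    (∀ ε : ℝ, 0 < ε →
        ε < min (1 - σ / 2) (σ / 2 - 1 / 2 - ((m : ℝ) + 1) / (2 * p)) →
      ∀ T : ℝ, 0 ≤ T → ENNReal.ofReal T < Tmax →
        (∀ t ∈ Ico0 Tmax, MemL0 p (Fop V (ψ t))) ∧
        HolderW (min (1 - σ / 2) (σ / 2 - 1 / 2 - ((m : ℝ) + 1) / (2 * p)) - ε) 0 p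
          (Set.Icc 0 T) (fun t => Fop V (ψ t))) := by
  obtain ⟨⟨hi, hD, hc, hmild⟩, -, -⟩ := hψ
  have h0 : ψ 0 = ψ0 := funext hi
  have hsub : ∀ T : ℝ, ENNReal.ofReal T < Tmax → Set.Icc 0 T ⊆ Ico0 Tmax := fun T hT t ht =>
    ⟨ht.1, (ENNReal.ofReal_le_ofReal ht.2).trans_lt hT⟩
  have hreg : ∀ T : ℝ, 0 ≤ T → ENNReal.ofReal T < Tmax → Reg (σ - 1) p T ψ := by
    intro T hT hT'
    refine reg_of hT h2 (fun t ht => hD t (hsub T hT' ht)) ?_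
    intro t ht ε hε
    obtain ⟨δ, hδ, h⟩ := hc t (hsub T hT' ht) ε hε
    exact ⟨δ, hδ, fun t' ht' => h t' (hsub T hT' ht')⟩
  have hm : ∀ T : ℝ, ENNReal.ofReal T < Tmax → ∀ t ∈ Icc 0 T, ∀ᵐ x ∂(volume : Measure (Spc m)),
      ψ t x = heatSG β t (ψ 0) x + ∫ r in Set.Ioc (0 : ℝ) t, heatSG β (t - r) (Fop V (ψ r)) x := by
    intro T hT t ht
    rw [h0]
    exact hmild t (hsub T hT ht)
  refine ⟨fun ε τ hε hε' hτ hτσ => ⟨fun t ht => memD_lower h2 (hD t ht) hτ hτσ, fun T hT hT' => ?_⟩,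
    fun ε hε hε' T hT hT' => ⟨fun t ht => ?_, ?_⟩⟩
  · refine (hreg T hT hT').part1 hV hVper hβ (hm T hT') hτ (by linarith) ?_
    refine (min_le_right _ _).trans (le_of_eq ?_)
    ring
  · have hr := hreg t ht.1 ht.2
    have htt : t ∈ Icc 0 t := ⟨ht.1, le_rfl⟩
    exact Fop_L0 hr.hp hV hVper (hr.good t htt).per (hr.good t htt).diff (hr.gcont htt) (hr.mpos t htt)
  · have hr := hreg T hT hT'
    have hp0 : 0 < p := by linarith [hr.hp]
    have e1 : ((m : ℝ) + 1) / (2 * p) = ((m : ℝ) + 1) / p / 2 := by field_simp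
    have hle := min_le_right (1 - σ / 2) (σ / 2 - 1 / 2 - ((m : ℝ) + 1) / (2 * p))
    refine hr.part2 hV hVper hβ (hm T hT') (θ := ((m : ℝ) + 1) / p + 2 * ε) (by linarith) ?_ ?_
    · linarith
    · linarith
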